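/- Let X be a conjugacy class of involutions in G_n with labelled cycle type (m,k_e,k_o,0), where n ≥ 7, m ≥ 1, l = 0, and k_e ≥ 2 and k_o ≥ 2. Then C(G_n,X) is connected with diameter at most n+2. If moreover m ≥ 2, then Diam C(G_n,X) ≤ n. -/

import Mathlib

/-!
Common setup: the affine Weyl group of type C̃ₙ, realized as the semidirect
product of the group Wₙ of signed permutations of {1,…,n} with the translation
lattice ℤⁿ.  An element is a triple `(π, s, v)`, where `π` is the underlying
permutation of the n points, `s i` is the sign attached to the point `i`
(so the signed permutation maps the point `i` to the point `π i` with sign `s i`),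
and `v ∈ ℤⁿ` is the translation part.  The multiplication realizes
`(α,v)(τ,u) = (ατ, vᵗ + u)`.
-/

/-- An element of the affine Weyl group of type C̃ₙ: a signed permutation
`(π, s)` together with a translation vector `v ∈ ℤⁿ`. -/
@[ext]
structure AffineWeylC (n : ℕ) where
  π : Equiv.Perm (Fin n)
  s : Fin n → ℤˣ
  v : Fin n → ℤ

namespace AffineWeylC

variable {n : ℕ}

instance : One (AffineWeylC n) := ⟨⟨1, 1, 0⟩⟩

instance : Mul (AffineWeylC n) :=
  ⟨fun g h => ⟨h.π * g.π, fun j => g.s j * h.s (g.π j),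
    fun i => (h.s (h.π⁻¹ i) : ℤ) * g.v (h.π⁻¹ i) + h.v i⟩⟩

instance : Inv (AffineWeylC n) :=
  ⟨fun g => ⟨g.π⁻¹, fun k => (g.s (g.π⁻¹ k))⁻¹,
    fun i => -(((g.s i)⁻¹ : ℤˣ) : ℤ) * g.v (g.π i)⟩⟩

@[simp] lemma mul_π (g h : AffineWeylC n) : (g * h).π = h.π * g.π := rfl
@[simp] lemma mul_s (g h : AffineWeylC n) (j : Fin n) :
    (g * h).s j = g.s j * h.s (g.π j) := rfl
@[simp] lemma mul_v (g h : AffineWeylC n) (i : Fin n) :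
    (g * h).v i = (h.s (h.π⁻¹ i) : ℤ) * g.v (h.π⁻¹ i) + h.v i := rfl
@[simp] lemma one_π : (1 : AffineWeylC n).π = 1 := rfl
@[simp] lemma one_s (j : Fin n) : (1 : AffineWeylC n).s j = 1 := rfl
@[simp] lemma one_v (i : Fin n) : (1 : AffineWeylC n).v i = 0 := rfl
@[simp] lemma inv_π (g : AffineWeylC n) : g⁻¹.π = g.π⁻¹ := rfl
@[simp] lemma inv_s (g : AffineWeylC n) (k : Fin n) :
    g⁻¹.s k = (g.s (g.π⁻¹ k))⁻¹ := rfl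
@[simp] lemma inv_v (g : AffineWeylC n) (i : Fin n) :
    g⁻¹.v i = -(((g.s i)⁻¹ : ℤˣ) : ℤ) * g.v (g.π i) := rfl

instance : Group (AffineWeylC n) where
  mul_assoc a b c := by
    refine AffineWeylC.ext ?_ (funext fun j => ?_) (funext fun i => ?_)
    · simp [mul_assoc]
    · simp only [mul_s, mul_π, Equiv.Perm.mul_apply]
      rw [mul_assoc]
    · simp only [mul_v, mul_s, mul_π, mul_inv_rev, Equiv.Perm.mul_apply,
        show ∀ (f : Equiv.Perm (Fin n)) (x : Fin n), f (f⁻¹ x) = x from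
          fun f x => f.apply_symm_apply x, Units.val_mul]
      ring
  one_mul a := by
    refine AffineWeylC.ext ?_ (funext fun j => ?_) (funext fun i => ?_) <;>
      simp
  mul_one a := by
    refine AffineWeylC.ext ?_ (funext fun j => ?_) (funext fun i => ?_) <;>
      simp
  inv_mul_cancel a := by
    refine AffineWeylC.ext ?_ (funext fun j => ?_) (funext fun i => ?_)
    · simp
    · simp
    · simp only [mul_v, inv_v, inv_s, one_v,
        show ∀ (f : Equiv.Perm (Fin n)) (x : Fin n), f (f⁻¹ x) = x from
          fun f x => f.apply_symm_apply x]
      have h1 : ((a.s (a.π⁻¹ i) : ℤ)) * (((a.s (a.π⁻¹ i))⁻¹ : ℤˣ) : ℤ) = 1 := by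
        rw [← Units.val_mul, mul_inv_cancel, Units.val_one]
      linear_combination (-(a.v i)) * h1

/-- `g` is an involution: a non-identity element squaring to the identity. -/
def Involution (g : AffineWeylC n) : Prop := g ≠ 1 ∧ g * g = 1

/-- The conjugacy class of `a`. -/
def conjClass (a : AffineWeylC n) : Set (AffineWeylC n) := {b | IsConj a b}

/-- The number of transpositions (2-cycles) of the underlying signed permutation. -/
noncomputable def numTrans (g : AffineWeylC n) : ℕ :=
  {i : Fin n | g.π i ≠ i}.ncard / 2

/-- The number of negative 1-cycles of `g` carrying an even label. -/
noncomputable def numNegEven (g : AffineWeylC n) : ℕ :=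
  {i : Fin n | g.π i = i ∧ g.s i = -1 ∧ Even (g.v i)}.ncard

/-- The number of negative 1-cycles of `g` carrying an odd label. -/
noncomputable def numNegOdd (g : AffineWeylC n) : ℕ :=
  {i : Fin n | g.π i = i ∧ g.s i = -1 ∧ Odd (g.v i)}.ncard

/-- The number of positive 1-cycles (fixed points) of `g`. -/
noncomputable def numPos (g : AffineWeylC n) : ℕ :=
  {i : Fin n | g.π i = i ∧ g.s i = 1}.ncard

/-- The labelled cycle type `(m, k_e, k_o, l)` of an involution. -/
noncomputable def cycleType (g : AffineWeylC n) : ℕ × ℕ × ℕ × ℕ :=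
  (numTrans g, numNegEven g, numNegOdd g, numPos g)

/-- `g` has labelled cycle type `(m, k_e, k_o, l)`. -/
def HasType (g : AffineWeylC n) (m ke ko l : ℕ) : Prop :=
  numTrans g = m ∧ numNegEven g = ke ∧ numNegOdd g = ko ∧ numPos g = l

/-- The canonical class representative
`a_{m,k_e,k_o,l} = (1 2)⁺₀ ⋯ (2m−1 2m)⁺₀ (2m+1)⁻₀ ⋯ (2m+k_e)⁻₀
(2m+k_e+1)⁻₁ ⋯ (n−l)⁻₁ (n−l+1)⁺₀ ⋯ (n)⁺₀`
(here written with 0-based indices): points `0,…,2m-1` are paired off into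
label‑0 positive transpositions, points `2m,…,2m+k_e-1` are negative 1-cycles
with label 0, points `2m+k_e,…,2m+k_e+k_o-1` are negative 1-cycles with label 1,
and the remaining `l` points are positive fixed points with label 0. -/
def IsCanon (a : AffineWeylC n) (m ke ko l : ℕ) : Prop :=
  2*m + ke + ko + l = n ∧
  (∀ i : Fin n, i.val < 2*m → i.val % 2 = 0 → (a.π i).val = i.val + 1) ∧
  (∀ i : Fin n, i.val < 2*m → i.val % 2 = 1 → (a.π i).val = i.val - 1) ∧
  (∀ i : Fin n, 2*m ≤ i.val → a.π i = i) ∧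
  (∀ i : Fin n, i.val < 2*m → a.s i = 1 ∧ a.v i = 0) ∧
  (∀ i : Fin n, 2*m ≤ i.val → i.val < 2*m + ke → a.s i = -1 ∧ a.v i = 0) ∧
  (∀ i : Fin n, 2*m + ke ≤ i.val → i.val < 2*m + ke + ko → a.s i = -1 ∧ a.v i = 1) ∧
  (∀ i : Fin n, 2*m + ke + ko ≤ i.val → a.s i = 1 ∧ a.v i = 0)

/-- The labelled positive transposition `(α β)⁺_λ`. -/
def posTrans (α β : Fin n) (lam : ℤ) : AffineWeylC n :=
  ⟨Equiv.swap α β, 1, fun i => if i = α then lam else if i = β then -lam else 0⟩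

/-- The labelled negative transposition `(α β)⁻_λ`. -/
def negTrans (α β : Fin n) (lam : ℤ) : AffineWeylC n :=
  ⟨Equiv.swap α β, fun i => if i = α then -1 else if i = β then -1 else 1,
    fun i => if i = α then lam else if i = β then lam else 0⟩

/-- The labelled negative 1-cycle `(α)⁻_λ`. -/
def negOne (α : Fin n) (lam : ℤ) : AffineWeylC n :=
  ⟨1, fun i => if i = α then -1 else 1, fun i => if i = α then lam else 0⟩

/-- The finite Weyl group Wₙ of type Cₙ, as the subgroup of the affine Weyl
group consisting of the elements with trivial translation part. -/
def WeylSub (n : ℕ) : Subgroup (AffineWeylC n) where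
  carrier := {g | g.v = 0}
  one_mem' := rfl
  mul_mem' := by
    intro g h hg hh
    show (g * h).v = 0
    funext i
    simp only [mul_v]
    rw [show g.v = 0 from hg, show h.v = 0 from hh]
    simp
  inv_mem' := by
    intro g hg
    show g⁻¹.v = 0
    funext i
    simp only [inv_v]
    rw [show g.v = 0 from hg]
    simp

/-- The projection `G_n → W_n`, `(σ, v) ↦ σ`. -/
def weylPart (n : ℕ) : AffineWeylC n →* WeylSub n where
  toFun g := ⟨⟨g.π, g.s, 0⟩, rfl⟩
  map_one' := by
    apply Subtype.ext
    refine AffineWeylC.ext rfl rfl rfl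
  map_mul' g h := by
    apply Subtype.ext
    refine AffineWeylC.ext rfl rfl (funext fun i => ?_)
    simp

end AffineWeylC

/-- The commuting graph on a subset `X` of a group: the vertices are the
elements of `X`, and distinct vertices are adjacent iff they commute. -/
def commGraph {G : Type*} [Group G] (X : Set G) : SimpleGraph X where
  Adj x y := (x : G) ≠ (y : G) ∧ Commute (x : G) (y : G)
  symm := ⟨fun _ _ h => ⟨fun e => h.1 e.symm, h.2.symm⟩⟩
  loopless := ⟨fun _ h => h.1 rfl⟩

namespace AffineWeylC

variable {n : ℕ}

/-- The two elements have the same image, sign and label at the point `i`. -/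
def SameAt (x y : AffineWeylC n) (i : Fin n) : Prop :=
  x.π i = y.π i ∧ x.s i = y.s i ∧ x.v i = y.v i

lemma SameAt.symm {x y : AffineWeylC n} {i : Fin n} (h : SameAt x y i) : SameAt y x i :=
  ⟨h.1.symm, h.2.1.symm, h.2.2.symm⟩

lemma SameAt.trans {x y z : AffineWeylC n} {i : Fin n} (h : SameAt x y i) (h' : SameAt y z i) :
    SameAt x z i :=
  ⟨h.1.trans h'.1, h.2.1.trans h'.2.1, h.2.2.trans h'.2.2⟩

lemma eq_of_sameAt {x y : AffineWeylC n} (h : ∀ i, SameAt x y i) : x = y :=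
  AffineWeylC.ext (Equiv.ext fun i => (h i).1) (funext fun i => (h i).2.1)
    (funext fun i => (h i).2.2)

lemma mul_v_apply (x y : AffineWeylC n) (i : Fin n) :
    (x * y).v (y.π (x.π i)) =
      (y.s (x.π i) : ℤ) * x.v (x.π i) + y.v (y.π (x.π i)) := by
  simp [mul_v]

lemma mul_eq_mul_of {x y z w : AffineWeylC n}
    (h : ∀ i, y.π (x.π i) = w.π (z.π i) ∧ x.s i * y.s (x.π i) = z.s i * w.s (z.π i) ∧
      (y.s (x.π i) : ℤ) * x.v (x.π i) + y.v (y.π (x.π i)) =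
        (w.s (z.π i) : ℤ) * z.v (z.π i) + w.v (w.π (z.π i))) : x * y = z * w := by
  refine AffineWeylC.ext (Equiv.ext fun i => ?_) (funext fun i => ?_) (funext fun j => ?_)
  · simpa using (h i).1
  · simpa using (h i).2.1
  · obtain ⟨i, rfl⟩ : ∃ i, y.π (x.π i) = j := ⟨x.π.symm (y.π.symm j), by simp⟩
    rw [mul_v_apply, (h i).1, mul_v_apply, ← (h i).2.2, (h i).1]

/-- The commutation relation of two elements, evaluated at the point `i`. -/
def CommAt (x y : AffineWeylC n) (i : Fin n) : Prop :=
  y.π (x.π i) = x.π (y.π i) ∧ x.s i * y.s (x.π i) = y.s i * x.s (y.π i) ∧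
    (y.s (x.π i) : ℤ) * x.v (x.π i) + y.v (y.π (x.π i)) =
      (x.s (y.π i) : ℤ) * y.v (y.π i) + x.v (x.π (y.π i))

lemma commute_iff_commAt {x y : AffineWeylC n} : Commute x y ↔ ∀ i, CommAt x y i := by
  refine ⟨fun h i => ?_, fun h => mul_eq_mul_of h⟩
  have hp := congrArg (fun g => AffineWeylC.π g i) h.eq
  have hs := congrArg (fun g => AffineWeylC.s g i) h.eq
  have hv := congrArg (fun g => AffineWeylC.v g (y.π (x.π i))) h.eq
  simp only [mul_π, Equiv.Perm.mul_apply, mul_s] at hp hs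
  refine ⟨hp, hs, ?_⟩
  simp only [mul_v_apply] at hv
  rw [hv, hp, mul_v_apply]

/-- An involution without positive 1-cycles. -/
structure Full (x : AffineWeylC n) : Prop where
  invol : ∀ i, x.π (x.π i) = i
  sign : ∀ i, x.s (x.π i) = x.s i
  label : ∀ i, x.v (x.π i) = -(x.s i : ℤ) * x.v i
  neg : ∀ i, x.π i = i → x.s i = -1

/-- `i` is a 1-cycle of `x` whose label is congruent to `p` modulo 2. -/
def Sing (x : AffineWeylC n) (p : ℤ) (i : Fin n) : Prop := x.π i = i ∧ x.v i % 2 = p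

lemma full_of_mul_self {x : AffineWeylC n} (h : x * x = 1) (hn : ∀ i, x.π i = i → x.s i = -1) :
    Full x := by
  have hp : ∀ i, x.π (x.π i) = i := fun i => by
    simpa using congrArg (fun g => AffineWeylC.π g i) h
  have hs : ∀ i, x.s (x.π i) = x.s i := fun i => by
    have := congrArg (fun g => AffineWeylC.s g i) h
    simp only [mul_s, one_s] at this
    rcases Int.units_eq_one_or (x.s i) with h1 | h1 <;>
      rcases Int.units_eq_one_or (x.s (x.π i)) with h2 | h2 <;> simp_all
  refine ⟨hp, hs, fun i => ?_, hn⟩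
  have := congrArg (fun g => AffineWeylC.v g (x.π (x.π i))) h
  simp only [mul_v_apply, one_v] at this
  rw [hp, hs] at this
  rcases Int.units_eq_one_or (x.s i) with h1 | h1 <;> simp_all <;> omega

lemma Full.mul_self {x : AffineWeylC n} (h : Full x) : x * x = 1 := by
  have : x * x = 1 * 1 := mul_eq_mul_of fun i => by
    have := h.label i
    have h2 := h.sign i
    have h3 := h.invol i
    rcases Int.units_eq_one_or (x.s i) with h1 | h1 <;> simp_all
  simpa using this

lemma conj_fix (c x : AffineWeylC n) (i : Fin n) :
    (c * x * c⁻¹).π i = i ↔ x.π (c.π i) = c.π i := by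
  simp [Equiv.symm_apply_eq]

lemma conj_sign (c x : AffineWeylC n) (i : Fin n) (h : x.π (c.π i) = c.π i) :
    (c * x * c⁻¹).s i = x.s (c.π i) := by
  rcases Int.units_eq_one_or (c.s i) with h4 | h4 <;> simp [h, h4]

lemma conj_label (c x : AffineWeylC n) (i : Fin n) (h : x.π (c.π i) = c.π i)
    (hs : x.s (c.π i) = -1) : (c * x * c⁻¹).v i % 2 = x.v (c.π i) % 2 := by
  have h0 : (c⁻¹).π ((c * x).π i) = i := by simp [h]
  have h1 := mul_v_apply (c * x) c⁻¹ i
  rw [h0] at h1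
  have h2 := mul_v_apply c x i
  rw [h1]
  have h3 : (c * x).π i = c.π i := by simp [h]
  rw [h3]
  rw [h] at h2
  rw [h2, hs]
  rcases Int.units_eq_one_or (c.s i) with h4 | h4 <;> simp [h4] <;> omega

lemma Full.of_isConj {x y : AffineWeylC n} (hx : Full x) (h : IsConj x y) : Full y := by
  obtain ⟨c, rfl⟩ := isConj_iff.1 h
  refine full_of_mul_self ?_ fun i hi => ?_
  · have : c * x * c⁻¹ * (c * x * c⁻¹) = c * (x * x) * c⁻¹ := by group
    rw [this, hx.mul_self]; group
  · rw [conj_fix] at hi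
    rw [conj_sign c x i hi, hx.neg _ hi]

open Classical in
lemma card_sing_of_isConj {x y : AffineWeylC n} (hx : Full x) (h : IsConj x y) (p : ℤ) :
    (Finset.univ.filter (Sing y p)).card = (Finset.univ.filter (Sing x p)).card := by
  obtain ⟨c, rfl⟩ := isConj_iff.1 h
  refine Finset.card_equiv c.π fun i => ?_
  simp only [Finset.mem_filter, Finset.mem_univ, true_and, Sing, conj_fix]
  refine and_congr_right fun hi => ?_
  rw [conj_label c x i hi (hx.neg _ hi)]

/-- Commuting conjugate elements. -/
def Link (x y : AffineWeylC n) : Prop := Commute x y ∧ IsConj x y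

lemma Link.refl (x : AffineWeylC n) : Link x x := ⟨Commute.refl x, IsConj.refl x⟩

lemma Link.symm {x y : AffineWeylC n} (h : Link x y) : Link y x := ⟨h.1.symm, h.2.symm⟩

lemma Full.of_link {x y : AffineWeylC n} (hx : Full x) (h : Link x y) : Full y := hx.of_isConj h.2

/-- There is a chain of at most `N` links from `x` to `y`. -/
def Reach : ℕ → AffineWeylC n → AffineWeylC n → Prop
  | 0, x, y => x = y
  | N + 1, x, y => ∃ z, Link x z ∧ Reach N z y

lemma Reach.refl (N : ℕ) (x : AffineWeylC n) : Reach N x x := by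
  induction N with
  | zero => rfl
  | succ N ih => exact ⟨x, Link.refl x, ih⟩

lemma Link.reach {x y : AffineWeylC n} (h : Link x y) : Reach 1 x y := ⟨y, h, rfl⟩

lemma Reach.trans {N M : ℕ} {x y z : AffineWeylC n} (h : Reach N x y) (h' : Reach M y z) :
    Reach (N + M) x z := by
  induction N generalizing x with
  | zero => obtain rfl : x = y := h; simpa using h'
  | succ N ih =>
    obtain ⟨w, hw, hr⟩ := h
    rw [Nat.add_right_comm]
    exact ⟨w, hw, ih hr⟩

lemma Reach.symm {N : ℕ} {x y : AffineWeylC n} (h : Reach N x y) : Reach N y x := by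
  induction N generalizing x with
  | zero => exact Eq.symm h
  | succ N ih =>
    obtain ⟨w, hw, hr⟩ := h
    exact (ih hr).trans hw.symm.reach

lemma Reach.mono {N M : ℕ} {x y : AffineWeylC n} (h : Reach N x y) (hNM : N ≤ M) :
    Reach M x y := by
  obtain ⟨k, rfl⟩ := Nat.exists_eq_add_of_le hNM
  exact h.trans (Reach.refl k y)

lemma Reach.isConj {N : ℕ} {x y : AffineWeylC n} (h : Reach N x y) : IsConj x y := by
  induction N generalizing x with
  | zero => obtain rfl : x = y := h; exact IsConj.refl x
  | succ N ih =>
    obtain ⟨w, hw, hr⟩ := h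
    exact hw.2.trans (ih hr)

/-- A cycle of an involution: an edge `i – j` with sign and label, or a negative 1-cycle. -/
inductive Cyc (n : ℕ) : Type
  | edge (i j : Fin n) (s : ℤˣ) (c : ℤ)
  | sing (i : Fin n) (c : ℤ)

/-- The points moved or fixed by a cycle. -/
def Cyc.pts : Cyc n → Multiset (Fin n)
  | edge i j _ _ => {i, j}
  | sing i _ => {i}

/-- The given cycle is one of the cycles of `x`. -/
def Cyc.Holds (x : AffineWeylC n) : Cyc n → Prop
  | edge i j s c => x.π i = j ∧ x.π j = i ∧ x.s i = s ∧ x.s j = s ∧ x.v j = c ∧ x.v i = -(s : ℤ) * c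
  | sing i c => x.π i = i ∧ x.s i = -1 ∧ x.v i = c

/-- A single edge, as a multiset of cycles. -/
def ed (i j : Fin n) (s : ℤˣ) (c : ℤ) : Multiset (Cyc n) := {Cyc.edge i j s c}

/-- A single negative 1-cycle, as a multiset of cycles. -/
def sg (i : Fin n) (c : ℤ) : Multiset (Cyc n) := {Cyc.sing i c}

/-- The points covered by a multiset of cycles. -/
def pts (S : Multiset (Cyc n)) : Multiset (Fin n) := S.bind Cyc.pts

/-- All members of `S` are cycles of `x`. -/
def Holds (x : AffineWeylC n) (S : Multiset (Cyc n)) : Prop := ∀ c ∈ S, c.Holds x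

@[simp] lemma pts_add (S T : Multiset (Cyc n)) : pts (S + T) = pts S + pts T :=
  Multiset.add_bind S T Cyc.pts

@[simp] lemma pts_ed (i j : Fin n) (s : ℤˣ) (c : ℤ) : pts (ed i j s c) = {i, j} := by
  simp [pts, ed, Cyc.pts]

@[simp] lemma pts_sg (i : Fin n) (c : ℤ) : pts (sg i c) = {i} := by
  simp [pts, sg, Cyc.pts]

@[simp] lemma holds_add (x : AffineWeylC n) (S T : Multiset (Cyc n)) :
    Holds x (S + T) ↔ Holds x S ∧ Holds x T := by
  simp only [Holds, Multiset.mem_add, or_imp, forall_and]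

lemma holds_ed {x : AffineWeylC n} {i j : Fin n} {s : ℤˣ} {c : ℤ} :
    Holds x (ed i j s c) ↔
      x.π i = j ∧ x.π j = i ∧ x.s i = s ∧ x.s j = s ∧ x.v j = c ∧ x.v i = -(s : ℤ) * c := by
  simp [Holds, ed, Cyc.Holds]

lemma holds_sg {x : AffineWeylC n} {i : Fin n} {c : ℤ} :
    Holds x (sg i c) ↔ x.π i = i ∧ x.s i = -1 ∧ x.v i = c := by
  simp [Holds, sg, Cyc.Holds]

lemma Holds.π_mem {x : AffineWeylC n} {S : Multiset (Cyc n)} (h : Holds x S) {i : Fin n}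
    (hi : i ∈ pts S) : x.π i ∈ pts S := by
  obtain ⟨c, hc, hic⟩ := Multiset.mem_bind.1 hi
  have := h c hc
  refine Multiset.mem_bind.2 ⟨c, hc, ?_⟩
  cases c <;> simp [Cyc.pts, Cyc.Holds] at * <;> grind

lemma Holds.congr {x z : AffineWeylC n} {S : Multiset (Cyc n)} (h : Holds x S)
    (hz : ∀ i ∈ pts S, SameAt x z i) : Holds z S := by
  intro c hc
  have h1 := h c hc
  have h2 : ∀ i ∈ c.pts, SameAt x z i := fun i hi => hz i (Multiset.mem_bind.2 ⟨c, hc, hi⟩)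
  cases c <;> simp [Cyc.pts, Cyc.Holds, SameAt] at * <;> grind

lemma Holds.sameAt {x y : AffineWeylC n} {S : Multiset (Cyc n)} (h : Holds x S) (h' : Holds y S)
    {i : Fin n} (hi : i ∈ pts S) : SameAt x y i := by
  obtain ⟨c, hc, hic⟩ := Multiset.mem_bind.1 hi
  have h1 := h c hc
  have h2 := h' c hc
  cases c <;> simp [Cyc.pts, Cyc.Holds, SameAt] at * <;> grind

/-- Every element having the cycles `S` is joined by at most `N` links to an element having the
cycles `T` instead, and agreeing with the original one outside of the points of `S`. -/
def Move (N : ℕ) (S T : Multiset (Cyc n)) : Prop :=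
  pts S = pts T ∧ ∀ x, (pts S).Nodup → Holds x S →
    ∃ z, Reach N x z ∧ Holds z T ∧ ∀ i ∉ pts S, SameAt x z i

lemma Move.refl (S : Multiset (Cyc n)) : Move 0 S S :=
  ⟨rfl, fun x _ h => ⟨x, rfl, h, fun _ _ => ⟨rfl, rfl, rfl⟩⟩⟩

lemma Move.trans {N N' : ℕ} {S T T' U : Multiset (Cyc n)} (h : Move N S T) (h' : Move N' T' U)
    (e : T = T') : Move (N + N') S U := by
  subst e
  refine ⟨h.1.trans h'.1, fun x hx hS => ?_⟩
  obtain ⟨z, h1, h2, h3⟩ := h.2 x hx hS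
  obtain ⟨w, h4, h5, h6⟩ := h'.2 z (h.1 ▸ hx) h2
  exact ⟨w, h1.trans h4, h5, fun i hi => (h3 i hi).trans (h6 i (h.1 ▸ hi))⟩

lemma Move.of_eq {N : ℕ} {S S' T T' : Multiset (Cyc n)} (h : Move N S T) (e : S' = S)
    (e' : T = T') : Move N S' T' := by subst e; subst e'; exact h

lemma Move.mono {N M : ℕ} {S T : Multiset (Cyc n)} (h : Move N S T) (hN : N ≤ M) : Move M S T :=
  ⟨h.1, fun x hx hS => (h.2 x hx hS).imp fun _ hz => ⟨hz.1.mono hN, hz.2⟩⟩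

lemma Move.frame {N : ℕ} {S T : Multiset (Cyc n)} (h : Move N S T) (R : Multiset (Cyc n)) :
    Move N (S + R) (T + R) := by
  refine ⟨by rw [pts_add, pts_add, h.1], fun x hx hS => ?_⟩
  rw [pts_add, Multiset.nodup_add] at hx
  rw [holds_add] at hS
  obtain ⟨z, h1, h2, h3⟩ := h.2 x hx.1 hS.1
  refine ⟨z, h1, (holds_add _ _ _).2 ⟨h2, hS.2.congr fun i hi => h3 i fun hi' => ?_⟩,
    fun i hi => h3 i fun hi' => ?_⟩
  · exact Multiset.disjoint_left.1 hx.2.2 hi' hi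
  · exact hi (by simp [hi'])

lemma reach_one {x z : AffineWeylC n} : Reach 1 x z ↔ Link x z :=
  ⟨fun ⟨_, hw, e⟩ => (show _ = z from e) ▸ hw, Link.reach⟩

lemma Move.par {S T S' T' : Multiset (Cyc n)} (h : Move 1 S T) (h' : Move 1 S' T') :
    Move 1 (S + S') (T + T') := by
  refine ⟨by rw [pts_add, pts_add, h.1, h'.1], fun x hx hS => ?_⟩
  rw [pts_add, Multiset.nodup_add] at hx
  rw [holds_add] at hS
  have hd : ∀ i, i ∈ pts S → i ∉ pts S' := fun i h1 h2 => Multiset.disjoint_left.1 hx.2.2 h1 h2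
  obtain ⟨z, h1, h2, h3⟩ := h.2 x hx.1 hS.1
  obtain ⟨w, h4, h5, h6⟩ := h'.2 z hx.2.1 (hS.2.congr fun i hi => h3 i fun hi' => hd i hi' hi)
  rw [reach_one] at h1 h4
  have hw : Holds w T := h2.congr fun i hi => h6 i (hd i (h.1 ▸ hi))
  have hm : ∀ j, j ∈ pts S → z.π j ∈ pts S := fun j hj => by
    rw [h.1] at hj ⊢
    exact h2.π_mem hj
  refine ⟨w, reach_one.2 ⟨commute_iff_commAt.2 fun i => ?_, h1.2.trans h4.2⟩,
    (holds_add _ _ _).2 ⟨hw, h5⟩, fun i hi => ?_⟩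
  · by_cases hi : i ∈ pts S
    · have c := commute_iff_commAt.1 h1.1 i
      have e1 := h6 i (hd i hi)
      have e2 := h6 _ (hd _ (hS.1.π_mem hi))
      have e3 := h6 _ (hd _ (hm _ hi))
      have e4 := h6 _ (hd _ (hm _ (hS.1.π_mem hi)))
      simp only [CommAt, SameAt] at *
      grind
    · have hz : ∀ j, j ∉ pts S → z.π j ∉ pts S := by
        intro j hj hj'
        obtain ⟨k, hk, e⟩ : ∃ k ∈ pts S, z.π k = z.π j := by
          by_contra hc
          push Not at hc
          have : Function.Surjective (fun k : {k // k ∈ pts S} =>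
              (⟨z.π k.1, hm _ k.2⟩ : {k // k ∈ pts S})) := by
            have hinj : Function.Injective (fun k : {k // k ∈ pts S} =>
              (⟨z.π k.1, hm _ k.2⟩ : {k // k ∈ pts S})) := fun a b hab => by
                simpa [Subtype.ext_iff] using hab
            exact Finite.surjective_of_injective hinj
          obtain ⟨k, hk⟩ := this ⟨_, hj'⟩
          exact hc k.1 k.2 (by simpa using hk)
        exact hj (z.π.injective e ▸ hk)
      have hw' : ∀ j, j ∉ pts S → w.π j ∉ pts S := by
        intro j hj
        by_cases hj' : j ∈ pts S'
        · intro h7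
          exact hd _ h7 (h'.1 ▸ h5.π_mem (h'.1 ▸ hj'))
        · rw [← (h6 j hj').1]; exact hz j hj
      have c := commute_iff_commAt.1 h4.1 i
      have e1 := h3 i hi
      have e2 := h3 _ (hw' i hi)
      have e3 := h3 _ (hz _ hi)
      have e4 := h3 _ (hw' _ (hz _ hi))
      have e5 := h3 _ (hz _ (hw' _ hi))
      simp only [CommAt, SameAt] at *
      grind
  · rw [pts_add, Multiset.mem_add, not_or] at hi
    exact (h3 i hi.1).trans (h6 i hi.2)

lemma Move.edge_symm (i j : Fin n) (s : ℤˣ) (c : ℤ) :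
    Move 0 (ed i j s c) (ed j i s (-(s : ℤ) * c)) := by
  refine ⟨by simpa using Multiset.pair_comm i j, fun x _ h => ⟨x, rfl, ?_, fun _ _ => ⟨rfl, rfl, rfl⟩⟩⟩
  rw [holds_ed] at h ⊢
  rcases Int.units_eq_one_or s with rfl | rfl <;> simp_all

/-- Two multisets of cycles on the same points, together with the elements they describe. -/
lemma Move.reach {N : ℕ} {S T : Multiset (Cyc n)} (h : Move N S T) {x y : AffineWeylC n}
    (hd : (pts S).Nodup) (hx : Holds x S) (hy : Holds y T) (ho : ∀ i ∉ pts S, SameAt x y i) :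
    Reach N x y := by
  obtain ⟨z, h1, h2, h3⟩ := h.2 x hd hx
  rwa [show y = z from eq_of_sameAt fun i => ?_]
  by_cases hi : i ∈ pts S
  · exact hy.sameAt h2 (h.1 ▸ hi)
  · exact (ho i hi).symm.trans (h3 i hi)

lemma isConj_of_mul_eq {x y g : AffineWeylC n} (h : x * g = g * y) : IsConj x y :=
  isConj_iff.2 ⟨g⁻¹, by rw [inv_inv, mul_assoc, h, inv_mul_cancel_left]⟩

/-- An edge can change sign, with an arbitrary new label. -/
lemma Move.flip (i j : Fin n) (s : ℤˣ) (c d : ℤ) : Move 1 (ed i j s c) (ed i j (-s) d) := by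
  refine ⟨by simp, fun x hd h => ?_⟩
  simp only [pts_ed, Multiset.insert_eq_cons, Multiset.nodup_cons, Multiset.mem_singleton] at hd
  have hij := hd.1
  rw [holds_ed] at h
  obtain ⟨h1, h2, h3, h4, h5, h6⟩ := h
  have hi : ∀ t, t ≠ i → t ≠ j → x.π t ≠ i ∧ x.π t ≠ j := fun t ht ht' =>
    ⟨fun e => ht' (x.π.injective (e.trans h2.symm)), fun e => ht (x.π.injective (e.trans h1.symm))⟩
  let z : AffineWeylC n := ⟨x.π, fun t => if t = i then -s else if t = j then -s else x.s t,
    fun t => if t = i then (s : ℤ) * d else if t = j then d else x.v t⟩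
  let g : AffineWeylC n := ⟨1, fun t => if t = j then -1 else 1,
    fun t => if t = j then d + c else 0⟩
  refine ⟨z, reach_one.2 ⟨commute_iff_commAt.2 fun t => ?_,
    isConj_of_mul_eq (g := g) (mul_eq_mul_of fun t => ?_)⟩, ?_, fun t ht => ?_⟩
  · by_cases ti : t = i
    · subst ti
      rcases Int.units_eq_one_or s with rfl | rfl <;>
        simp [CommAt, z, h1, h2, h3, h4, h5, h6, Ne.symm hij, add_comm]
    by_cases tj : t = j
    · subst tj
      rcases Int.units_eq_one_or s with rfl | rfl <;>
        simp [CommAt, z, h1, h2, h3, h4, h5, h6, Ne.symm hij, add_comm]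
    have a1 := hi t ti tj
    have a2 := hi _ a1.1 a1.2
    simp [CommAt, z, ti, tj, a1, a2]
  · by_cases ti : t = i
    · subst ti
      rcases Int.units_eq_one_or s with rfl | rfl <;>
        simp [g, z, h1, h3, h5, hij, Ne.symm hij, add_comm]
    by_cases tj : t = j
    · subst tj
      rcases Int.units_eq_one_or s with rfl | rfl <;>
        simp [g, z, h2, h4, h6, hij, Ne.symm hij, add_comm]
    have a1 := hi t ti tj
    simp [g, z, ti, tj, a1]
  · rw [holds_ed]
    simp [z, h1, h2, Ne.symm hij]
  · simp only [pts_ed, Multiset.insert_eq_cons, Multiset.mem_cons, Multiset.mem_singleton,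
      not_or] at ht
    simp [SameAt, z, ht.1, ht.2]

/-- An edge and two 1-cycles with labels of the same parity exchange their places. -/
lemma Move.exch (i j k l : Fin n) (s s' : ℤˣ) (c μ ν α β lam : ℤ) (hα : α % 2 = μ % 2)
    (hβ : β = s * α + 2 * c) (hl : 2 * lam = ν - s' * μ) :
    Move 1 (ed i j s c + sg k μ + sg l ν) (ed k l s' lam + sg i α + sg j β) := by
  refine ⟨?_, fun x hd h => ?_⟩
  · simp only [pts_add, pts_ed, pts_sg, Multiset.insert_eq_cons, ← Multiset.singleton_add]
    abel
  simp only [pts_add, pts_ed, pts_sg, Multiset.insert_eq_cons, Multiset.nodup_cons,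
    Multiset.mem_singleton, Multiset.cons_add, Multiset.singleton_add, Multiset.mem_cons,
    not_or] at hd
  obtain ⟨⟨ij, ik, il⟩, ⟨jk, jl⟩, kl, -⟩ := hd
  simp only [holds_add, holds_ed, holds_sg] at h
  obtain ⟨⟨⟨h1, h2, h3, h4, h5, h6⟩, h7, h8, h9⟩, h10, h11, h12⟩ := h
  have hi : ∀ t, t ≠ i → t ≠ j → t ≠ k → t ≠ l →
      x.π t ≠ i ∧ x.π t ≠ j ∧ x.π t ≠ k ∧ x.π t ≠ l := fun t ti tj tk tl =>
    ⟨fun e => tj (x.π.injective (e.trans h2.symm)), fun e => ti (x.π.injective (e.trans h1.symm)),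
      fun e => tk (x.π.injective (e.trans h7.symm)), fun e => tl (x.π.injective (e.trans h10.symm))⟩
  obtain ⟨A, hA⟩ : ∃ A, 2 * A = α - μ := ⟨(α - μ) / 2, by omega⟩
  obtain ⟨B, hB⟩ : ∃ B, 2 * B = β - ν := ⟨(β - ν) / 2, by
    rcases Int.units_eq_one_or s with rfl | rfl <;>
      rcases Int.units_eq_one_or s' with rfl | rfl <;> simp at hβ hl <;> omega⟩
  let z : AffineWeylC n := ⟨x.π * (Equiv.swap i j * Equiv.swap k l),
    fun t => if t = i ∨ t = j then -1 else if t = k ∨ t = l then s' else x.s t,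
    fun t => if t = i then α else if t = j then β else if t = k then -s' * lam
      else if t = l then lam else x.v t⟩
  let g : AffineWeylC n := ⟨Equiv.swap i k * Equiv.swap j l, fun t => if t = j then s * s' else 1,
    fun t => if t = i then A else if t = j then B else if t = l then lam - s * s' * c else 0⟩
  have ji := Ne.symm ij
  have ki := Ne.symm ik
  have li := Ne.symm il
  have kj := Ne.symm jk
  have lj := Ne.symm jl
  have lk := Ne.symm kl
  have zi : z.π i = i := by simp [z, Equiv.swap_apply_of_ne_of_ne, ik, il, h2]
  have zj : z.π j = j := by simp [z, Equiv.swap_apply_of_ne_of_ne, jk, jl, h1]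
  have zk : z.π k = l := by simp [z, Equiv.swap_apply_of_ne_of_ne, li, lj, h10]
  have zl : z.π l = k := by simp [z, Equiv.swap_apply_of_ne_of_ne, ki, kj, h7]
  have gi : g.π i = k := by simp [g, Equiv.swap_apply_of_ne_of_ne, ij, il]
  have gj : g.π j = l := by simp [g, Equiv.swap_apply_of_ne_of_ne, li, lk]
  have gk : g.π k = i := by simp [g, Equiv.swap_apply_of_ne_of_ne, kj, kl]
  have gl : g.π l = j := by simp [g, Equiv.swap_apply_of_ne_of_ne, ji, jk]
  have zt : ∀ t, t ≠ i → t ≠ j → t ≠ k → t ≠ l → z.π t = x.π t := fun t ti tj tk tl => by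
    simp [z, Equiv.swap_apply_of_ne_of_ne, *]
  have gt : ∀ t, t ≠ i → t ≠ j → t ≠ k → t ≠ l → g.π t = t := fun t ti tj tk tl => by
    simp [g, Equiv.swap_apply_of_ne_of_ne, *]
  have zs : ∀ t, z.s t = if t = i ∨ t = j then -1 else if t = k ∨ t = l then s' else x.s t :=
    fun _ => rfl
  have zv : ∀ t, z.v t = if t = i then α else if t = j then β else if t = k then -s' * lam
      else if t = l then lam else x.v t := fun _ => rfl
  have gs : ∀ t, g.s t = if t = j then s * s' else 1 := fun _ => rfl
  have gv : ∀ t, g.v t = if t = i then A else if t = j then B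
      else if t = l then lam - s * s' * c else 0 := fun _ => rfl
  clear_value z g
  refine ⟨z, reach_one.2 ⟨commute_iff_commAt.2 fun t => ?_,
    isConj_of_mul_eq (g := g) (mul_eq_mul_of fun t => ?_)⟩, ?_, fun t ht => ?_⟩
  · by_cases ht : t = i ∨ t = j ∨ t = k ∨ t = l
    · rcases ht with rfl | rfl | rfl | rfl <;> rcases Int.units_eq_one_or s with rfl | rfl <;>
        rcases Int.units_eq_one_or s' with rfl | rfl <;>
        simp [CommAt, *] at * <;> omega
    · simp only [not_or] at ht
      obtain ⟨ti, tj, tk, tl⟩ := ht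
      obtain ⟨a1, a2, a3, a4⟩ := hi t ti tj tk tl
      obtain ⟨b1, b2, b3, b4⟩ := hi _ a1 a2 a3 a4
      simp [CommAt, *]
  · by_cases ht : t = i ∨ t = j ∨ t = k ∨ t = l
    · rcases ht with rfl | rfl | rfl | rfl <;> rcases Int.units_eq_one_or s with rfl | rfl <;>
        rcases Int.units_eq_one_or s' with rfl | rfl <;>
        simp [*] at * <;> omega
    · simp only [not_or] at ht
      obtain ⟨ti, tj, tk, tl⟩ := ht
      obtain ⟨a1, a2, a3, a4⟩ := hi t ti tj tk tl
      simp [*]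
  · simp [holds_ed, holds_sg, *]
  · simp at ht
    simp [SameAt, *]

set_option maxHeartbeats 1600000 in
/-- Two edges are rearranged into two edges across them; the sign and label of the first new edge
are arbitrary. -/
lemma Move.cross (i j k l : Fin n) (s t u w : ℤˣ) (c e d f : ℤ) (hw : w = t * u * s)
    (hf : f = t * d + e - w * c) :
    Move 1 (ed i j s c + ed k l t e) (ed i k u d + ed j l w f) := by
  refine ⟨?_, fun x hd h => ?_⟩
  · simp only [pts_add, pts_ed, Multiset.insert_eq_cons, ← Multiset.singleton_add]
    abel
  simp only [pts_add, pts_ed, Multiset.insert_eq_cons, Multiset.nodup_cons,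
    Multiset.mem_singleton, Multiset.cons_add, Multiset.singleton_add, Multiset.mem_cons,
    not_or] at hd
  obtain ⟨⟨ij, ik, il⟩, ⟨jk, jl⟩, kl, -⟩ := hd
  simp only [holds_add, holds_ed] at h
  obtain ⟨⟨h1, h2, h3, h4, h5, h6⟩, h7, h8, h9, h10, h11, h12⟩ := h
  have hi : ∀ t, t ≠ i → t ≠ j → t ≠ k → t ≠ l →
      x.π t ≠ i ∧ x.π t ≠ j ∧ x.π t ≠ k ∧ x.π t ≠ l := fun t ti tj tk tl =>
    ⟨fun e => tj (x.π.injective (e.trans h2.symm)), fun e => ti (x.π.injective (e.trans h1.symm)),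
      fun e => tl (x.π.injective (e.trans h8.symm)), fun e => tk (x.π.injective (e.trans h7.symm))⟩
  let z : AffineWeylC n := ⟨x.π * (Equiv.swap i l * Equiv.swap j k),
    fun t => if t = i ∨ t = k then u else if t = j ∨ t = l then w else x.s t,
    fun t => if t = i then -u * d else if t = k then d else if t = j then -w * f
      else if t = l then f else x.v t⟩
  let g : AffineWeylC n := ⟨Equiv.swap j k,
    fun r => if r = j then u * s else if r = l then w * t else 1,
    fun r => if r = k then d - u * s * c else if r = l then f - w * t * e else 0⟩
  have ji := Ne.symm ij
  have ki := Ne.symm ik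
  have li := Ne.symm il
  have kj := Ne.symm jk
  have lj := Ne.symm jl
  have lk := Ne.symm kl
  have zi : z.π i = k := by simp [z, Equiv.swap_apply_of_ne_of_ne, ij, ik, h8]
  have zj : z.π j = l := by simp [z, Equiv.swap_apply_of_ne_of_ne, ki, kl, h7]
  have zk : z.π k = i := by simp [z, Equiv.swap_apply_of_ne_of_ne, ji, jl, h2]
  have zl : z.π l = j := by simp [z, Equiv.swap_apply_of_ne_of_ne, lj, lk, h1]
  have gi : g.π i = i := by simp [g, Equiv.swap_apply_of_ne_of_ne, ij, ik]
  have gj : g.π j = k := by simp [g]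
  have gk : g.π k = j := by simp [g]
  have gl : g.π l = l := by simp [g, Equiv.swap_apply_of_ne_of_ne, lj, lk]
  have zt : ∀ t, t ≠ i → t ≠ j → t ≠ k → t ≠ l → z.π t = x.π t := fun t ti tj tk tl => by
    simp [z, Equiv.swap_apply_of_ne_of_ne, *]
  have gt : ∀ t, t ≠ i → t ≠ j → t ≠ k → t ≠ l → g.π t = t := fun t ti tj tk tl => by
    simp [g, Equiv.swap_apply_of_ne_of_ne, *]
  have zs : ∀ t, z.s t = if t = i ∨ t = k then u else if t = j ∨ t = l then w else x.s t :=
    fun _ => rfl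
  have zv : ∀ t, z.v t = if t = i then -u * d else if t = k then d else if t = j then -w * f
      else if t = l then f else x.v t := fun _ => rfl
  have gs : ∀ r, g.s r = if r = j then u * s else if r = l then w * t else 1 := fun _ => rfl
  have gv : ∀ r, g.v r = if r = k then d - u * s * c else if r = l then f - w * t * e else 0 :=
    fun _ => rfl
  clear_value z g
  refine ⟨z, reach_one.2 ⟨commute_iff_commAt.2 fun r => ?_,
    isConj_of_mul_eq (g := g) (mul_eq_mul_of fun r => ?_)⟩, ?_, fun r hr => ?_⟩
  · by_cases ht : r = i ∨ r = j ∨ r = k ∨ r = l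
    · rcases ht with rfl | rfl | rfl | rfl <;> rcases Int.units_eq_one_or s with rfl | rfl <;>
        rcases Int.units_eq_one_or t with rfl | rfl <;>
        rcases Int.units_eq_one_or u with rfl | rfl <;>
        simp [CommAt, *] at * <;> omega
    · simp only [not_or] at ht
      obtain ⟨ti, tj, tk, tl⟩ := ht
      obtain ⟨a1, a2, a3, a4⟩ := hi r ti tj tk tl
      obtain ⟨b1, b2, b3, b4⟩ := hi _ a1 a2 a3 a4
      simp [CommAt, *]
  · by_cases ht : r = i ∨ r = j ∨ r = k ∨ r = l
    · rcases ht with rfl | rfl | rfl | rfl <;> rcases Int.units_eq_one_or s with rfl | rfl <;>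
        rcases Int.units_eq_one_or t with rfl | rfl <;>
        rcases Int.units_eq_one_or u with rfl | rfl <;>
        simp [*] at * <;> omega
    · simp only [not_or] at ht
      obtain ⟨ti, tj, tk, tl⟩ := ht
      obtain ⟨a1, a2, a3, a4⟩ := hi r ti tj tk tl
      simp [*]
  · simp [holds_ed, *]
  · simp at hr
    simp [SameAt, *]

lemma exists_half_add (s : ℤˣ) {a b : ℤ} (h : a % 2 = b % 2) : ∃ c, 2 * c = a + s * b := by
  rcases Int.units_eq_one_or s with rfl | rfl
  · exact ⟨(a + b) / 2, by simp; omega⟩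
  · exact ⟨(a - b) / 2, by simp; omega⟩

lemma exists_half_sub (s : ℤˣ) {a b : ℤ} (h : a % 2 = b % 2) : ∃ c, 2 * c = a - s * b := by
  obtain ⟨c, hc⟩ := exists_half_add (-s) h
  exact ⟨c, by rw [hc]; simp; ring⟩

lemma sign_mul_emod (s : ℤˣ) (a : ℤ) : (s * a : ℤ) % 2 = a % 2 := by
  rcases Int.units_eq_one_or s with rfl | rfl <;> simp

lemma sign_mul_add_emod (s : ℤˣ) (a c : ℤ) : (s * a + 2 * c : ℤ) % 2 = a % 2 := by
  have := sign_mul_emod s a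
  omega

lemma sign_mul_sign_mul (s : ℤˣ) (a : ℤ) : (s * (s * a) : ℤ) = a := by
  rcases Int.units_eq_one_or s with rfl | rfl <;> simp

/-- Exchange an edge with two 1-cycles, prescribing the new label of the first endpoint. -/
lemma Move.exch_left (i j k l : Fin n) (s s' : ℤˣ) (c μ ν α : ℤ) (hα : α % 2 = μ % 2)
    (hν : ν % 2 = μ % 2) :
    ∃ β lam : ℤ, β % 2 = μ % 2 ∧ β = s * α + 2 * c ∧ 2 * lam = ν - s' * μ ∧
      Move 1 (ed i j s c + sg k μ + sg l ν) (ed k l s' lam + sg i α + sg j β) := by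
  obtain ⟨lam, hl⟩ := exists_half_sub s' hν
  exact ⟨_, lam, (sign_mul_add_emod s α c).trans hα, rfl, hl, Move.exch _ _ _ _ _ _ _ _ _ _ _ _ hα rfl hl⟩

/-- Exchange an edge with two 1-cycles, prescribing the new label of the second endpoint. -/
lemma Move.exch_right (i j k l : Fin n) (s s' : ℤˣ) (c μ ν β : ℤ) (hβ : β % 2 = μ % 2)
    (hν : ν % 2 = μ % 2) :
    ∃ α lam : ℤ, α % 2 = μ % 2 ∧ β = s * α + 2 * c ∧ 2 * lam = ν - s' * μ ∧
      Move 1 (ed i j s c + sg k μ + sg l ν) (ed k l s' lam + sg i α + sg j β) := by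
  obtain ⟨lam, hl⟩ := exists_half_sub s' hν
  have h1 : (s * (β - 2 * c) : ℤ) % 2 = μ % 2 := by rw [sign_mul_emod]; omega
  have h2 : β = s * (s * (β - 2 * c)) + 2 * c := by rw [sign_mul_sign_mul]; ring
  exact ⟨_, lam, h1, h2, hl, Move.exch _ _ _ _ _ _ _ _ _ _ _ _ h1 h2 hl⟩

/-- Exchange an edge with two 1-cycles, prescribing both new labels of the endpoints. -/
lemma Move.exch_both (i j k l : Fin n) (s s' : ℤˣ) (c μ ν α β : ℤ) (hα : α % 2 = μ % 2)
    (hβ : β % 2 = μ % 2) (hν : ν % 2 = μ % 2) :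
    ∃ lam : ℤ, 2 * lam = ν - s' * μ ∧
      Move 2 (ed i j s c + sg k μ + sg l ν) (ed k l s' lam + sg i α + sg j β) := by
  obtain ⟨lam, hl⟩ := exists_half_sub s' hν
  obtain ⟨d, hd⟩ := exists_half_add s (hβ.trans hα.symm)
  have h1 := (Move.flip i j s c d).frame (sg k μ + sg l ν)
  have h2 := Move.exch i j k l (-s) s' d μ ν α β lam hα (by rw [hd]; simp) hl
  exact ⟨lam, hl, (h1.trans h2 (by abel)).of_eq (by abel) rfl⟩

/-- Exchange an edge with two 1-cycles, prescribing the new edge, when the old edge is such that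
the labels of its endpoints can be obtained. -/
lemma Move.exch_edge (i j k l : Fin n) (s t : ℤˣ) (c e μ ν α β : ℤ) (hα : α % 2 = μ % 2)
    (hβ : β = s * α + 2 * c) (hν : ν % 2 = μ % 2) :
    Move 2 (ed i j s c + sg k μ + sg l ν) (ed k l t e + sg i α + sg j β) := by
  obtain ⟨lam, hl⟩ := exists_half_sub (-t) hν
  have h1 := Move.exch i j k l s (-t) c μ ν α β lam hα hβ hl
  have h2 := (Move.flip k l (-t) lam e).frame (sg i α + sg j β)
  rw [neg_neg] at h2
  exact (h1.trans h2 (by abel)).of_eq rfl (by abel)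

/-- Exchange an edge with two 1-cycles, with prescribed result. -/
lemma Move.exch_all (i j k l : Fin n) (s t : ℤˣ) (c e μ ν α β : ℤ) (hα : α % 2 = μ % 2)
    (hβ : β % 2 = μ % 2) (hν : ν % 2 = μ % 2) :
    Move 3 (ed i j s c + sg k μ + sg l ν) (ed k l t e + sg i α + sg j β) := by
  obtain ⟨lam, hl, h1⟩ := Move.exch_both i j k l s (-t) c μ ν α β hα hβ hν
  have h2 := (Move.flip k l (-t) lam e).frame (sg i α + sg j β)
  rw [neg_neg] at h2
  exact (h1.trans h2 (by abel)).of_eq rfl (by abel)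

/-- Change an edge and two 1-cycles on the same points. -/
lemma Move.relabel (i j k l : Fin n) (s t : ℤˣ) (c e μ ν α β : ℤ) (hα : α % 2 = μ % 2)
    (hβ : β % 2 = μ % 2) (hν : ν % 2 = μ % 2) :
    Move 4 (ed i j s c + sg k μ + sg l ν) (ed i j t e + sg k α + sg l β) := by
  obtain ⟨ρ, lam, hρ, -, -, h1⟩ := Move.exch_left i j k l s 1 c μ ν μ rfl hν
  have h2 := Move.exch_all k l i j 1 t lam e μ ρ α β hα hβ hρ
  exact h1.trans h2 rfl

/-- Move an edge to an overlapping place, using three 1-cycles. -/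
lemma Move.shift (a b k l m : Fin n) (s t : ℤˣ) (c e μ ν ρ β δ ε : ℤ) (hν : ν % 2 = μ % 2)
    (hρ : ρ % 2 = μ % 2) (hβ : β % 2 = μ % 2) (hδ : δ % 2 = μ % 2) (hε : ε % 2 = μ % 2) :
    Move 4 (ed a b s c + sg k μ + sg l ν + sg m ρ) (ed a k t e + sg b β + sg l δ + sg m ε) := by
  obtain ⟨α, lam, hα, -, -, h1⟩ := Move.exch_right a b l m s 1 c ν ρ β (by omega) (by omega)
  have h2 := Move.exch_all l m a k 1 t lam e α μ δ ε (by omega) (by omega) (by omega)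
  exact ((h1.frame (sg k μ)).trans (h2.frame (sg b β)) (by abel)).of_eq (by abel) (by abel)

/-- Move an edge to a disjoint place, using three 1-cycles. -/
lemma Move.jump (a b k l m : Fin n) (s t : ℤˣ) (c e μ ν ρ α β ε : ℤ) (hν : ν % 2 = μ % 2)
    (hρ : ρ % 2 = μ % 2) (hα : α % 2 = μ % 2) (hβ : β % 2 = μ % 2) (hε : ε % 2 = μ % 2) :
    Move 5 (ed a b s c + sg k μ + sg l ν + sg m ρ) (ed k l t e + sg a α + sg b β + sg m ε) := by
  obtain ⟨γ, lam, hγ, -, -, h1⟩ := Move.exch_right a b k l s 1 c μ ν β (by omega) (by omega)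
  have h2 := Move.relabel k l a m 1 t lam e γ ρ α ε (by omega) (by omega) (by omega)
  exact ((h1.frame (sg m ρ)).trans (h2.frame (sg b β)) (by abel)).of_eq (by abel) (by abel)

/-- Change an edge and three 1-cycles on the same points. -/
lemma Move.relabel₃ (i j k l m : Fin n) (s t : ℤˣ) (c e μ ν ρ α β ε : ℤ) (hν : ν % 2 = μ % 2)
    (hρ : ρ % 2 = μ % 2) (hα : α % 2 = μ % 2) (hβ : β % 2 = μ % 2) (hε : ε % 2 = μ % 2) :
    Move 6 (ed i j s c + sg k μ + sg l ν + sg m ρ) (ed i j t e + sg k α + sg l β + sg m ε) := by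
  obtain ⟨γ, lam, hγ, -, -, h1⟩ := Move.exch_left i j k l s 1 c μ ν μ rfl hν
  have h2 := Move.jump k l i j m 1 t lam e μ γ ρ α β ε (by omega) (by omega) (by omega) (by omega)
    (by omega)
  exact ((h1.frame (sg m ρ)).trans h2 (by abel)).of_eq (by abel) (by abel)

/-- The shape of `x` on the set `A`: the points of `T` lie on edges inside `T`, the points of `P`
are 1-cycles with labels of parity `p`, all other points of `A` are 1-cycles with labels of the
other parity. -/
structure Desc (A T P : Finset (Fin n)) (p : ℤ) (x : AffineWeylC n) : Prop where
  full : Full x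
  sub : T ⊆ A
  subP : P ⊆ A
  disj : ∀ i ∈ T, i ∉ P
  edge : ∀ i ∈ T, x.π i ∈ T ∧ x.π i ≠ i
  singP : ∀ i ∈ P, Sing x p i
  singQ : ∀ i ∈ A, i ∉ T → i ∉ P → Sing x (1 - p) i

lemma Desc.swap {A T P : Finset (Fin n)} {p : ℤ} {x : AffineWeylC n} (h : Desc A T P p x) :
    Desc A T ((A \ T) \ P) (1 - p) x where
  full := h.full
  sub := h.sub
  subP := by grind
  disj := by grind
  edge := h.edge
  singP i hi := by
    simp only [Finset.mem_sdiff] at hi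
    exact h.singQ i hi.1.1 hi.1.2 hi.2
  singQ i hi hT hP := by
    rw [sub_sub_cancel]
    exact h.singP i (by grind)

lemma Desc.erase {A T P : Finset (Fin n)} {p : ℤ} {x : AffineWeylC n} (h : Desc A T P p x)
    {a : Fin n} (ha : a ∉ T) : Desc (A.erase a) T (P.erase a) p x where
  full := h.full
  sub i hi := Finset.mem_erase.2 ⟨fun e => ha (e ▸ hi), h.sub hi⟩
  subP := Finset.erase_subset_erase _ h.subP
  disj i hi hP := h.disj i hi (Finset.mem_of_mem_erase hP)
  edge := h.edge
  singP i hi := h.singP i (Finset.mem_of_mem_erase hi)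
  singQ i hi hT hP := h.singQ i (Finset.mem_of_mem_erase hi) hT (by grind)

lemma Desc.holds_ed {A T P : Finset (Fin n)} {p : ℤ} {x : AffineWeylC n} (h : Desc A T P p x)
    {a b : Fin n} (hab : x.π a = b) : Holds x (ed a b (x.s a) (x.v b)) := by
  subst hab
  have h1 := h.full.invol a
  have h2 := h.full.sign a
  have h3 := h.full.label a
  rw [AffineWeylC.holds_ed]
  rcases Int.units_eq_one_or (x.s a) with h4 | h4 <;> simp_all

lemma Desc.holds_sg {A T P : Finset (Fin n)} {p q : ℤ} {x : AffineWeylC n} (h : Desc A T P p x)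
    {a : Fin n} (ha : Sing x q a) : Holds x (sg a (x.v a)) := by
  rw [AffineWeylC.holds_sg]
  exact ⟨ha.1, h.full.neg a ha.1, rfl⟩

lemma Desc.exists_pair {A T P : Finset (Fin n)} {p : ℤ} {x : AffineWeylC n} (h : Desc A T P p x)
    (hT : T.card = 2) {a : Fin n} (ha : a ∈ T) :
    ∃ b, a ≠ b ∧ T = {a, b} ∧ x.π a = b ∧ x.π b = a := by
  refine ⟨x.π a, (h.edge a ha).2.symm, ?_, rfl, h.full.invol a⟩
  refine (Finset.eq_of_subset_of_card_le ?_ ?_).symm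
  · intro i hi
    simp only [Finset.mem_insert, Finset.mem_singleton] at hi
    rcases hi with rfl | rfl
    exacts [ha, (h.edge _ ha).1]
  · rw [hT, Finset.card_pair (h.edge a ha).2.symm]

lemma Desc.exch {A T P : Finset (Fin n)} {p : ℤ} {x : AffineWeylC n} (h : Desc A T P p x)
    {a b g k : Fin n} (ha : a ∈ T) (hab : x.π a = b) (hg : g ∈ P) (hk : k ∈ P) (hgk : g ≠ k) {α : ℤ}
    (hα : α % 2 = p) : ∃ z, Link x z ∧
      Desc A ((T \ {a, b}) ∪ {g, k}) ((P \ {g, k}) ∪ {a, b}) p z ∧ z.v a = α ∧ z.π g = k ∧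
      ∀ i, i ≠ a → i ≠ b → i ≠ g → i ≠ k → SameAt x z i := by
  have hb := h.edge a ha
  rw [hab] at hb
  have hba : x.π b = a := hab ▸ h.full.invol a
  have hag : a ≠ g := fun e => h.disj a ha (e ▸ hg)
  have hak : a ≠ k := fun e => h.disj a ha (e ▸ hk)
  have hbg : b ≠ g := fun e => h.disj b hb.1 (e ▸ hg)
  have hbk : b ≠ k := fun e => h.disj b hb.1 (e ▸ hk)
  have sg1 := h.singP g hg
  have sk1 := h.singP k hk
  obtain ⟨β, lam, hβ, -, -, m⟩ := Move.exch_left a b g k (x.s a) 1 (x.v b) (x.v g) (x.v k) α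
    (hα.trans sg1.2.symm) (sk1.2.trans sg1.2.symm)
  obtain ⟨z, h1, h2, h3⟩ := m.2 x (by simp; grind)
    (by simp [h.holds_ed hab, h.holds_sg sg1, h.holds_sg sk1])
  rw [reach_one] at h1
  have hz := h.full.of_link h1
  simp only [pts_add, pts_ed, pts_sg] at h3
  simp only [holds_add, AffineWeylC.holds_ed, AffineWeylC.holds_sg] at h2
  have h4 : ∀ i, i ≠ a → i ≠ b → i ≠ g → i ≠ k → SameAt x z i := fun i _ _ _ _ =>
    h3 i (by simp; grind)
  have hP := h.subP
  have hTA := h.sub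
  have hd := h.disj
  have he := h.edge
  have hs := h.singP
  have hq := h.singQ
  have hi := h.full.invol
  clear m h3 h
  refine ⟨z, h1, ⟨hz, by grind, by grind, by grind, ?_, ?_, ?_⟩, h2.1.2.2.2, h2.1.1.1, h4⟩
  · intro i hi
    simp only [SameAt] at h4
    grind
  · intro i hi
    simp only [SameAt, Sing] at *
    grind
  · intro i hi
    simp only [SameAt, Sing] at *
    grind

/-- The two elements coincide at all points outside of `A`. -/
def Agree (A : Finset (Fin n)) (x y : AffineWeylC n) : Prop := ∀ i ∉ A, SameAt x y i

lemma Agree.symm {A : Finset (Fin n)} {x y : AffineWeylC n} (h : Agree A x y) : Agree A y x :=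
  fun i hi => (h i hi).symm

lemma Desc.exists_edge {A T P : Finset (Fin n)} {p : ℤ} {x : AffineWeylC n} (h : Desc A T P p x)
    (hT : T.card = 2) : ∃ a b, a ≠ b ∧ T = {a, b} ∧ x.π a = b ∧ x.π b = a := by
  obtain ⟨a, ha⟩ := Finset.card_pos.1 (by omega : 0 < T.card)
  exact ⟨a, h.exists_pair hT ha⟩

section Solo

variable {A T T' : Finset (Fin n)} {p : ℤ} {x y : AffineWeylC n}

lemma solo_four_disjoint (hx : Desc A T (A \ T) p x) (hy : Desc A T' (A \ T') p y)
    (ho : Agree A x y) (hT : T.card = 2) (hT' : T'.card = 2) (hA : A.card = 4)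
    (hd : Disjoint T T') : Reach 3 x y := by
  have hA' : T ∪ T' = A := Finset.eq_of_subset_of_card_le
    (Finset.union_subset hx.sub hy.sub) (by rw [Finset.card_union_of_disjoint hd]; omega)
  obtain ⟨a, b, ab, rfl, hab, -⟩ := hx.exists_edge hT
  obtain ⟨c, d, cd, rfl, hcd, -⟩ := hy.exists_edge hT'
  have dj := Finset.disjoint_left.1 hd
  simp only [Finset.mem_insert, Finset.mem_singleton, not_or] at dj
  have ac := dj (.inl rfl)
  have bc := dj (.inr rfl)
  subst hA'
  clear hT hT' hA hd dj
  have xc := hx.singP c (by grind)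
  have xd := hx.singP d (by grind)
  have ya := hy.singP a (by grind)
  have yb := hy.singP b (by grind)
  refine (Move.exch_all a b c d (x.s a) (y.s c) (x.v b) (y.v d) (x.v c) (x.v d) (y.v a) (y.v b)
    (ya.2.trans xc.2.symm) (yb.2.trans xc.2.symm) (xd.2.trans xc.2.symm)).reach ?_ ?_ ?_ ?_
  · simp; grind
  · simp [hx.holds_ed hab, hx.holds_sg xc, hx.holds_sg xd]
  · simp [hy.holds_ed hcd, hy.holds_sg ya, hy.holds_sg yb]
  · exact fun i hi => ho i (by simp at hi; grind)

lemma solo_four_eq (hx : Desc A T (A \ T) p x) (hy : Desc A T (A \ T) p y)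
    (ho : Agree A x y) (hT : T.card = 2) (hA : A.card = 4) : Reach 4 x y := by
  have hS : (A \ T).card = 2 := by rw [Finset.card_sdiff_of_subset hx.sub]; omega
  obtain ⟨a, b, ab, rfl, hab, -⟩ := hx.exists_edge hT
  obtain ⟨c, d, cd, hcd⟩ := Finset.card_eq_two.1 hS
  have yab : y.π a = b := by have := hy.edge a (by simp); grind
  have mc : c ∈ A \ {a, b} := by simp [hcd]
  have md : d ∈ A \ {a, b} := by simp [hcd]
  obtain rfl : A = {a, b, c, d} := by
    rw [← Finset.union_sdiff_of_subset hx.sub, hcd]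
    grind
  clear hT hS hcd hA
  have xc := hx.singP c (by grind)
  have xd := hx.singP d (by grind)
  have yc := hy.singP c (by grind)
  have yd := hy.singP d (by grind)
  refine (Move.relabel a b c d (x.s a) (y.s a) (x.v b) (y.v b) (x.v c) (x.v d) (y.v c) (y.v d)
    (yc.2.trans xc.2.symm) (yd.2.trans xc.2.symm) (xd.2.trans xc.2.symm)).reach ?_ ?_ ?_ ?_
  · simp; grind
  · simp [hx.holds_ed hab, hx.holds_sg xc, hx.holds_sg xd]
  · simp [hy.holds_ed yab, hy.holds_sg yc, hy.holds_sg yd]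
  · exact fun i hi => ho i (by simp at hi; grind)

lemma solo_five_eq (hx : Desc A T (A \ T) p x) (hy : Desc A T (A \ T) p y)
    (ho : Agree A x y) (hT : T.card = 2) (hA : A.card = 5) : Reach 6 x y := by
  have hS : (A \ T).card = 3 := by rw [Finset.card_sdiff_of_subset hx.sub]; omega
  obtain ⟨a, b, ab, rfl, hab, -⟩ := hx.exists_edge hT
  obtain ⟨c, d, e, cd, ce, de, hcd⟩ := Finset.card_eq_three.1 hS
  have yab : y.π a = b := by have := hy.edge a (by simp); grind
  have mc : c ∈ A \ {a, b} := by simp [hcd]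
  have md : d ∈ A \ {a, b} := by simp [hcd]
  have me : e ∈ A \ {a, b} := by simp [hcd]
  obtain rfl : A = {a, b, c, d, e} := by
    rw [← Finset.union_sdiff_of_subset hx.sub, hcd]
    grind
  clear hT hS hcd hA
  have xc := hx.singP c (by grind)
  have xd := hx.singP d (by grind)
  have xe := hx.singP e (by grind)
  have yc := hy.singP c (by grind)
  have yd := hy.singP d (by grind)
  have ye := hy.singP e (by grind)
  refine (Move.relabel₃ a b c d e (x.s a) (y.s a) (x.v b) (y.v b) (x.v c) (x.v d) (x.v e)
    (y.v c) (y.v d) (y.v e) (xd.2.trans xc.2.symm) (xe.2.trans xc.2.symm) (yc.2.trans xc.2.symm)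
    (yd.2.trans xc.2.symm) (ye.2.trans xc.2.symm)).reach ?_ ?_ ?_ ?_
  · simp; grind
  · simp [hx.holds_ed hab, hx.holds_sg xc, hx.holds_sg xd, hx.holds_sg xe]
  · simp [hy.holds_ed yab, hy.holds_sg yc, hy.holds_sg yd, hy.holds_sg ye]
  · exact fun i hi => ho i (by simp at hi; grind)

lemma solo_five_disjoint (hx : Desc A T (A \ T) p x) (hy : Desc A T' (A \ T') p y)
    (ho : Agree A x y) (hT : T.card = 2) (hT' : T'.card = 2) (hA : A.card = 5)
    (hd : Disjoint T T') : Reach 5 x y := by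
  have hS : (A \ (T ∪ T')).card = 1 := by
    rw [Finset.card_sdiff_of_subset (Finset.union_subset hx.sub hy.sub),
      Finset.card_union_of_disjoint hd]; omega
  obtain ⟨e, he⟩ := Finset.card_eq_one.1 hS
  obtain ⟨a, b, ab, rfl, hab, -⟩ := hx.exists_edge hT
  obtain ⟨c, d, cd, rfl, hcd, -⟩ := hy.exists_edge hT'
  have dj := Finset.disjoint_left.1 hd
  simp only [Finset.mem_insert, Finset.mem_singleton, not_or] at dj
  have ac := dj (.inl rfl)
  have bc := dj (.inr rfl)
  have me : e ∈ A \ ({a, b} ∪ {c, d}) := he ▸ Finset.mem_singleton_self e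
  obtain rfl : A = {a, b} ∪ {c, d} ∪ {e} := by
    rw [← Finset.union_sdiff_of_subset (Finset.union_subset hx.sub hy.sub), he]
  clear hT hT' hS hA hd dj he
  have xc := hx.singP c (by grind)
  have xd := hx.singP d (by grind)
  have xe := hx.singP e (by grind)
  have ya := hy.singP a (by grind)
  have yb := hy.singP b (by grind)
  have ye := hy.singP e (by grind)
  refine (Move.jump a b c d e (x.s a) (y.s c) (x.v b) (y.v d) (x.v c) (x.v d) (x.v e)
    (y.v a) (y.v b) (y.v e) (xd.2.trans xc.2.symm) (xe.2.trans xc.2.symm) (ya.2.trans xc.2.symm)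
    (yb.2.trans xc.2.symm) (ye.2.trans xc.2.symm)).reach ?_ ?_ ?_ ?_
  · simp; grind
  · simp [hx.holds_ed hab, hx.holds_sg xc, hx.holds_sg xd, hx.holds_sg xe]
  · simp [hy.holds_ed hcd, hy.holds_sg ya, hy.holds_sg yb, hy.holds_sg ye]
  · exact fun i hi => ho i (by simp at hi; grind)

/-- Prescribe the label at one endpoint of an edge and remove that point. -/
lemma Desc.exch_erase {P : Finset (Fin n)} (h : Desc A T P p x) (ho : Agree A x y)
    {a b g k : Fin n} (ha : a ∈ T) (hab : x.π a = b) (hg : g ∈ P) (hk : k ∈ P) (hgk : g ≠ k)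
    (hy : Full y) (hya : Sing y p a) : ∃ z, Link x z ∧
      Desc (A.erase a) ((T \ {a, b}) ∪ {g, k}) ((P \ {g, k}) ∪ {b}) p z ∧
      Agree (A.erase a) z y ∧ z.π g = k ∧
      ∀ i, i ≠ a → i ≠ b → i ≠ g → i ≠ k → SameAt x z i := by
  obtain ⟨z, hl, hz, hv, hπ, hs⟩ := h.exch ha hab hg hk hgk hya.2
  have hag : a ≠ g := fun e => h.disj a ha (e ▸ hg)
  have hak : a ≠ k := fun e => h.disj a ha (e ▸ hk)
  have hb := h.edge a ha
  rw [hab] at hb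
  have hz' := hz.erase (a := a) (by grind)
  refine ⟨z, hl, ?_, ?_, hπ, hs⟩
  · have haP := h.disj a ha
    rwa [show ((P \ {g, k}) ∪ {a, b}).erase a = (P \ {g, k}) ∪ {b} by grind] at hz'
  · intro i hi
    by_cases hia : i = a
    · subst hia
      have h1 := hz.singP i (by simp)
      exact ⟨h1.1.trans hya.1.symm, (hz.full.neg i h1.1).trans (hy.neg i hya.1).symm, hv⟩
    · have hiA : i ∉ A := fun h' => hi (Finset.mem_erase.2 ⟨hia, h'⟩)
      have h1 := h.sub
      have h2 := h.subP
      exact (hs i hia (by grind) (by grind) (by grind)).symm.trans (ho i hiA)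

lemma solo_overlap (k : ℕ) : ∀ {A T T' : Finset (Fin n)} {p : ℤ} {x y : AffineWeylC n},
    Desc A T (A \ T) p x → Desc A T' (A \ T') p y → Agree A x y → T.card = 2 → T'.card = 2 →
    A.card = k + 5 → (T ∩ T').card = 1 → Reach (k + 4) x y := by
  induction k with
  | zero =>
    intro A T T' p x y hx hy ho hT hT' hA hi
    obtain ⟨a, ha⟩ := Finset.card_eq_one.1 hi
    have haT : a ∈ T ∩ T' := by simp [ha]
    rw [Finset.mem_inter] at haT
    obtain ⟨b, ab, rfl, hab, -⟩ := hx.exists_pair hT haT.1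
    obtain ⟨c, ac, rfl, hac, -⟩ := hy.exists_pair hT' haT.2
    have hc : c ≠ b := by
      rintro rfl
      rw [Finset.inter_self, Finset.card_pair ab] at hi
      omega
    have hS : (A \ {a, b, c}).card = 2 := by
      rw [Finset.card_sdiff_of_subset, Finset.card_eq_three.2 ⟨a, b, c, ab, ac, hc.symm, rfl⟩, hA]
      have h1 := hx.sub
      have h2 := hy.sub
      grind
    obtain ⟨d, e, de, hde⟩ := Finset.card_eq_two.1 hS
    have md : d ∈ A \ {a, b, c} := by simp [hde]
    have me : e ∈ A \ {a, b, c} := by simp [hde]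
    obtain rfl : A = {a, b, c} ∪ {d, e} := by
      rw [← hde, Finset.union_sdiff_of_subset]
      have h1 := hx.sub
      have h2 := hy.sub
      grind
    clear hT hT' hS hA hi ha haT hde
    have xc := hx.singP c (by grind)
    have xd := hx.singP d (by grind)
    have xe := hx.singP e (by grind)
    have yb := hy.singP b (by grind)
    have yd := hy.singP d (by grind)
    have ye := hy.singP e (by grind)
    refine (Move.shift a b c d e (x.s a) (y.s a) (x.v b) (y.v c) (x.v c) (x.v d) (x.v e)
      (y.v b) (y.v d) (y.v e) (xd.2.trans xc.2.symm) (xe.2.trans xc.2.symm)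
      (yb.2.trans xc.2.symm) (yd.2.trans xc.2.symm) (ye.2.trans xc.2.symm)).reach ?_ ?_ ?_ ?_
    · simp; grind
    · simp [hx.holds_ed hab, hx.holds_sg xc, hx.holds_sg xd, hx.holds_sg xe]
    · simp [hy.holds_ed hac, hy.holds_sg yb, hy.holds_sg yd, hy.holds_sg ye]
    · exact fun i hi => ho i (by simp at hi; grind)
  | succ k ih =>
    intro A T T' p x y hx hy ho hT hT' hA hi
    obtain ⟨a, ha⟩ := Finset.card_eq_one.1 hi
    have haT : a ∈ T ∩ T' := by simp [ha]
    rw [Finset.mem_inter] at haT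
    obtain ⟨b, ab, rfl, hab, hba⟩ := hx.exists_pair hT haT.1
    obtain ⟨c, ac, rfl, hac, -⟩ := hy.exists_pair hT' haT.2
    have hc : c ≠ b := by
      rintro rfl
      rw [Finset.inter_self, Finset.card_pair ab] at hi
      omega
    have h1 := hx.sub
    have h2 := hy.sub
    obtain ⟨d, hd⟩ : ∃ d, d ∈ A \ {a, b, c} := by
      refine Finset.card_pos.1 ?_
      rw [Finset.card_sdiff_of_subset (by grind),
        Finset.card_eq_three.2 ⟨a, b, c, ab, ac, hc.symm, rfl⟩, hA]
      omega
    clear hT hi ha haT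
    have yb := hy.singP b (by grind)
    obtain ⟨z, hl, hz, hzo, -, -⟩ := hx.exch_erase ho (a := b) (b := a) (g := c) (k := d)
      (by simp) hba (by grind) (by grind) (by grind) hy.full yb
    rw [show ({a, b} : Finset (Fin n)) \ {b, a} ∪ {c, d} = {c, d} by grind,
      show (A \ {a, b}) \ {c, d} ∪ {a} = A.erase b \ {c, d} by grind] at hz
    have hy' := hy.erase (a := b) (by grind)
    rw [show (A \ {a, c}).erase b = A.erase b \ {a, c} by grind] at hy'
    refine ⟨z, hl, ih hz hy' hzo (Finset.card_pair (by grind)) hT' ?_ ?_⟩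
    · rw [Finset.card_erase_of_mem (by grind)]; omega
    · have da : d ≠ a := by grind
      clear hy hz hx hy' hT' hA hd
      exact Finset.card_eq_one.2 ⟨c, by grind⟩

lemma solo_disjoint (hx : Desc A T (A \ T) p x) (hy : Desc A T' (A \ T') p y)
    (ho : Agree A x y) (hT : T.card = 2) (hT' : T'.card = 2) (k : ℕ) (hA : A.card = k + 6)
    (hd : Disjoint T T') : Reach (k + 5) x y := by
  obtain ⟨a, b, ab, rfl, hab, -⟩ := hx.exists_edge hT
  obtain ⟨c, d, cd, rfl, hcd, -⟩ := hy.exists_edge hT'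
  have := Finset.disjoint_left.1 hd
  have h1 := hx.sub
  have h2 := hy.sub
  obtain ⟨e, he⟩ : ∃ e, e ∈ A \ ({a, b} ∪ {c, d}) := by
    refine Finset.card_pos.1 ?_
    rw [Finset.card_sdiff_of_subset (Finset.union_subset h1 h2),
      Finset.card_union_of_disjoint hd]
    omega
  have ya := hy.singP a (by grind)
  obtain ⟨z, hl, hz, hzo, -, -⟩ := hx.exch_erase ho (a := a) (b := b) (g := c) (k := e)
    (by simp) hab (by grind) (by grind) (by grind) hy.full ya
  rw [show ({a, b} : Finset (Fin n)) \ {a, b} ∪ {c, e} = {c, e} by grind,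
    show (A \ {a, b}) \ {c, e} ∪ {b} = A.erase a \ {c, e} by grind] at hz
  have hy' := hy.erase (a := a) (by grind)
  rw [show (A \ {c, d}).erase a = A.erase a \ {c, d} by grind] at hy'
  refine ⟨z, hl, solo_overlap k hz hy' hzo (Finset.card_pair (by grind)) hT' ?_ ?_⟩
  · rw [Finset.card_erase_of_mem (by grind)]; omega
  · rw [Finset.card_eq_one]; exact ⟨c, by grind⟩

lemma solo_eq (hx : Desc A T (A \ T) p x) (hy : Desc A T (A \ T) p y)
    (ho : Agree A x y) (hT : T.card = 2) (k : ℕ) (hA : A.card = k + 6) : Reach (k + 6) x y := by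
  obtain ⟨a, b, ab, rfl, hab, -⟩ := hx.exists_edge hT
  have h1 := hx.sub
  have hS : (A \ {a, b}).card = k + 4 := by rw [Finset.card_sdiff_of_subset h1]; omega
  obtain ⟨g, hg, h, hh, hgh⟩ := Finset.one_lt_card.1 (by omega : 1 < (A \ {a, b}).card)
  obtain ⟨z, hl, hz, -, -, hs⟩ := hx.exch (a := a) (by simp) hab hg hh hgh
    (α := x.v g) (hx.singP g hg).2
  rw [show ({a, b} : Finset (Fin n)) \ {a, b} ∪ {g, h} = {g, h} by grind,
    show (A \ {a, b}) \ {g, h} ∪ {a, b} = A \ {g, h} by grind] at hz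
  refine ⟨z, hl, solo_disjoint hz hy (fun i hi => ?_) (Finset.card_pair hgh) hT k hA ?_⟩
  · exact (hs i (by grind) (by grind) (by grind) (by grind)).symm.trans (ho i hi)
  · rw [Finset.disjoint_left]; grind

end Solo

lemma Desc.move {A T P T' P' : Finset (Fin n)} {p : ℤ} {x : AffineWeylC n} (h : Desc A T P p x)
    {N : ℕ} {S S' : Multiset (Cyc n)} (m : Move N S S') (hd : (pts S).Nodup) (hS : Holds x S)
    (hA : ∀ i ∈ pts S, i ∈ A)
    (hT' : ∀ i ∉ pts S, (i ∈ T' ↔ i ∈ T)) (hP' : ∀ i ∉ pts S, (i ∈ P' ↔ i ∈ P))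
    (hz : ∀ z, Holds z S' → ∀ i ∈ pts S, (i ∈ T' → i ∉ P' ∧ z.π i ∈ T' ∧ z.π i ≠ i) ∧
      (i ∈ P' → Sing z p i) ∧ (i ∉ T' → i ∉ P' → Sing z (1 - p) i))
    (sub : T' ⊆ A) (subP : P' ⊆ A) :
    ∃ z, Reach N x z ∧ Holds z S' ∧ Desc A T' P' p z ∧ ∀ i ∉ pts S, SameAt x z i := by
  obtain ⟨z, h1, h2, h3⟩ := m.2 x hd hS
  have hz := hz z h2
  refine ⟨z, h1, h2, ⟨h.full.of_isConj h1.isConj, sub, subP, fun i hi hi' => ?_, fun i hi => ?_,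
    fun i hi => ?_, fun i hi hi1 hi2 => ?_⟩, h3⟩
  · by_cases hi2 : i ∈ pts S
    · exact ((hz i hi2).1 hi).1 hi'
    · exact h.disj i ((hT' i hi2).1 hi) ((hP' i hi2).1 hi')
  · by_cases hi2 : i ∈ pts S
    · exact ((hz i hi2).1 hi).2
    · have h4 := h.edge i ((hT' i hi2).1 hi)
      rw [← (h3 i hi2).1]
      refine ⟨(hT' _ fun h5 => hi2 ?_).2 h4.1, h4.2⟩
      have := hS.π_mem h5
      rwa [h.full.invol] at this
  · by_cases hi2 : i ∈ pts S
    · exact (hz i hi2).2.1 hi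
    · have h4 := h.singP i ((hP' i hi2).1 hi)
      have h5 := h3 i hi2
      exact ⟨h5.1 ▸ h4.1, h5.2.2 ▸ h4.2⟩
  · by_cases hi3 : i ∈ pts S
    · exact (hz i hi3).2.2 hi1 hi2
    · have h4 := h.singQ i hi (fun h' => hi1 ((hT' i hi3).2 h')) (fun h' => hi2 ((hP' i hi3).2 h'))
      have h5 := h3 i hi3
      exact ⟨h5.1 ▸ h4.1, h5.2.2 ▸ h4.2⟩

/-- Remove points on which `z` and `y` agree, among them all 1-cycles of colour `p`. -/
lemma Desc.restrict {A T T' P E : Finset (Fin n)} {p : ℤ} {z y : AffineWeylC n}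
    (hz : Desc A T P p z) (hy : Desc A T' P p y) (ho : Agree A z y) (hP : P ⊆ E)
    (hT : Disjoint T E) (hT' : Disjoint T' E) (hv : ∀ i ∈ E, z.v i = y.v i) (hE : E ⊆ A) :
    Desc (A \ E) T ((A \ E) \ T) (1 - p) z ∧ Desc (A \ E) T' ((A \ E) \ T') (1 - p) y ∧
      Agree (A \ E) z y := by
  rw [Finset.disjoint_left] at hT hT'
  refine ⟨⟨hz.full, ?_, ?_, ?_, hz.edge, ?_, ?_⟩, ⟨hy.full, ?_, ?_, ?_, hy.edge, ?_, ?_⟩, ?_⟩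
  · exact fun i hi => Finset.mem_sdiff.2 ⟨hz.sub hi, hT hi⟩
  · exact Finset.sdiff_subset
  · simp +contextual
  · intro i hi
    simp only [Finset.mem_sdiff] at hi
    exact hz.singQ i hi.1.1 hi.2 fun h => hi.1.2 (hP h)
  · intro i hi h1 h2
    exact absurd (Finset.mem_sdiff.2 ⟨hi, h1⟩) h2
  · exact fun i hi => Finset.mem_sdiff.2 ⟨hy.sub hi, hT' hi⟩
  · exact Finset.sdiff_subset
  · simp +contextual
  · intro i hi
    simp only [Finset.mem_sdiff] at hi
    exact hy.singQ i hi.1.1 hi.2 fun h => hi.1.2 (hP h)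
  · intro i hi h1 h2
    exact absurd (Finset.mem_sdiff.2 ⟨hi, h1⟩) h2
  · intro i hi
    by_cases hiE : i ∈ E
    · have h1 : z.π i = i := by
        by_cases h : i ∈ P
        · exact (hz.singP i h).1
        · exact (hz.singQ i (hE hiE) (fun h => hT h hiE) h).1
      have h2 : y.π i = i := by
        by_cases h : i ∈ P
        · exact (hy.singP i h).1
        · exact (hy.singQ i (hE hiE) (fun h => hT' h hiE) h).1
      exact ⟨h1.trans h2.symm, (hz.full.neg i h1).trans (hy.full.neg i h2).symm, hv i hiE⟩
    · exact ho i fun h => hi (Finset.mem_sdiff.2 ⟨h, hiE⟩)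

section SoloBounds

variable {A T T' : Finset (Fin n)} {p : ℤ} {x y : AffineWeylC n}

lemma solo_ne (hx : Desc A T (A \ T) p x) (hy : Desc A T' (A \ T') p y)
    (ho : Agree A x y) (hT : T.card = 2) (hT' : T'.card = 2) (hA : 5 ≤ A.card)
    (hTT : T ≠ T') (h5 : A.card = 5 → ¬ Disjoint T T') : Reach (A.card - 1) x y := by
  have h1 : (T ∩ T').card ≠ 2 := fun h => hTT <| by
    rw [← Finset.eq_of_subset_of_card_le Finset.inter_subset_left (by omega : T.card ≤ (T ∩ T').card)]
    exact Finset.eq_of_subset_of_card_le Finset.inter_subset_right (by omega)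
  have h2 : (T ∩ T').card ≤ 2 := hT ▸ Finset.card_le_card Finset.inter_subset_left
  by_cases h0 : (T ∩ T').card = 0
  · rw [Finset.card_eq_zero, ← Finset.disjoint_iff_inter_eq_empty] at h0
    obtain ⟨k, hk⟩ := Nat.exists_eq_add_of_le' (show 6 ≤ A.card by grind)
    exact (solo_disjoint hx hy ho hT hT' k hk h0).mono (by omega)
  · obtain ⟨k, hk⟩ := Nat.exists_eq_add_of_le' hA
    exact (solo_overlap k hx hy ho hT hT' hk (by omega)).mono (by omega)

lemma solo_ne' (hx : Desc A T (A \ T) p x) (hy : Desc A T' (A \ T') p y)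
    (ho : Agree A x y) (hT : T.card = 2) (hT' : T'.card = 2) (hA : 5 ≤ A.card)
    (hTT : T ≠ T') : Reach A.card x y := by
  by_cases h : A.card = 5 ∧ Disjoint T T'
  · exact (solo_five_disjoint hx hy ho hT hT' h.1 h.2).mono h.1.ge
  · exact (solo_ne hx hy ho hT hT' hA hTT (by tauto)).mono (by omega)

lemma solo_any (hx : Desc A T (A \ T) p x) (hy : Desc A T' (A \ T') p y)
    (ho : Agree A x y) (hT : T.card = 2) (hT' : T'.card = 2) (hA : 5 ≤ A.card)
    (h5 : A.card = 5 → T ≠ T') : Reach A.card x y := by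
  by_cases h : T = T'
  · subst h
    obtain ⟨k, hk⟩ := Nat.exists_eq_add_of_le' (show 6 ≤ A.card by grind)
    exact (solo_eq hx hy ho hT k hk).mono (by omega)
  · exact solo_ne' hx hy ho hT hT' hA h

lemma solo_any' (hx : Desc A T (A \ T) p x) (hy : Desc A T' (A \ T') p y)
    (ho : Agree A x y) (hT : T.card = 2) (hT' : T'.card = 2) (hA : 5 ≤ A.card) :
    Reach (A.card + 1) x y := by
  by_cases h : A.card = 5 ∧ T = T'
  · obtain ⟨h1, rfl⟩ := h
    exact (solo_five_eq hx hy ho hT h1).mono (by omega)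
  · exact (solo_any hx hy ho hT hT' hA (by tauto)).mono (by omega)

end SoloBounds

/-- Carry an edge away through two 1-cycles `k`, `l` of the other colour, setting their labels. -/
lemma Move.visit (a b g h k l : Fin n) (s : ℤˣ) (c μ ν κ l' γ δ α : ℤ) (hν : ν % 2 = μ % 2)
    (hα : α % 2 = μ % 2) (hκ : κ % 2 = γ % 2) (hl : l' % 2 = γ % 2) (hδ : δ % 2 = γ % 2) :
    ∃ β t e, β % 2 = μ % 2 ∧ Move 3 (ed a b s c + sg k μ + sg l ν + sg g γ + sg h δ)
      (ed g h t e + sg k κ + sg l l' + sg a α + sg b β) := by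
  obtain ⟨β, lam, hβ, -, -, h1⟩ := Move.exch_left a b k l s 1 c μ ν α hα hν
  obtain ⟨e, -, h2⟩ := Move.exch_both k l g h 1 1 lam γ δ κ l' hκ hl hδ
  exact ⟨β, 1, e, hβ, ((h1.frame (sg g γ + sg h δ)).trans (h2.frame (sg a α + sg b β))
    (by abel)).of_eq (by abel) (by abel)⟩

/-- Carry an edge at `k`, `d` through `u`, `v` and `k`, `l` to `g`, `h`, setting the labels
of `k`, `l` and `u`. -/
lemma Move.turn (k d u v l g h : Fin n) (s : ℤˣ) (c μ ν lam γ δ κ l' α : ℤ) (hν : ν % 2 = μ % 2)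
    (hlam : lam % 2 = μ % 2) (hα : α % 2 = μ % 2) (hκ : κ % 2 = γ % 2) (hl : l' % 2 = γ % 2)
    (hδ : δ % 2 = γ % 2) :
    ∃ β ε t e, β % 2 = μ % 2 ∧ ε % 2 = μ % 2 ∧
      Move 3 (ed k d s c + sg u μ + sg v ν + sg l lam + sg g γ + sg h δ)
        (ed g h t e + sg k κ + sg l l' + sg u α + sg v β + sg d ε) := by
  obtain ⟨ε, f, hε, -, -, h1⟩ := Move.exch_left k d u v s 1 c μ ν (κ + lam - l') (by omega) hν
  obtain ⟨β, f', hβ, -, hf', h2⟩ := Move.exch_left u v k l 1 1 f (κ + lam - l') lam α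
    (by omega) (by omega)
  obtain ⟨e, he⟩ := exists_half_sub 1 hδ
  have h3 := Move.exch k l g h 1 1 f' γ δ κ l' e hκ
    (by simp only [Units.val_one, one_mul] at hf' ⊢; omega) he
  exact ⟨β, ε, 1, e, by omega, hε, (((h1.frame (sg l lam + sg g γ + sg h δ)).trans
    (h2.frame (sg d ε + sg g γ + sg h δ)) (by abel)).trans
    (h3.frame (sg u α + sg v β + sg d ε)) (by abel)).of_eq (by abel) (by abel)⟩

/-- As `Move.turn`, setting also the label of `d` with one more step. -/
lemma Move.turn_left (k d u v l g h : Fin n) (s : ℤˣ) (c μ ν lam γ δ κ l' α ε : ℤ)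
    (hν : ν % 2 = μ % 2) (hlam : lam % 2 = μ % 2) (hα : α % 2 = μ % 2) (hκ : κ % 2 = γ % 2)
    (hl : l' % 2 = γ % 2) (hδ : δ % 2 = γ % 2) (hε : ε % 2 = μ % 2) :
    ∃ β t e, β % 2 = μ % 2 ∧
      Move 4 (ed k d s c + sg u μ + sg v ν + sg l lam + sg g γ + sg h δ)
        (ed g h t e + sg k κ + sg l l' + sg u α + sg v β + sg d ε) := by
  obtain ⟨f, -, h1⟩ := Move.exch_both k d u v s 1 c μ ν (κ + lam - l') ε (by omega) hε hν
  obtain ⟨β, f', hβ, -, hf', h2⟩ := Move.exch_left u v k l 1 1 f (κ + lam - l') lam α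
    (by omega) (by omega)
  obtain ⟨e, he⟩ := exists_half_sub 1 hδ
  have h3 := Move.exch k l g h 1 1 f' γ δ κ l' e hκ
    (by simp only [Units.val_one, one_mul] at hf' ⊢; omega) he
  exact ⟨β, 1, e, by omega, (((h1.frame (sg l lam + sg g γ + sg h δ)).trans
    (h2.frame (sg d ε + sg g γ + sg h δ)) (by abel)).trans
    (h3.frame (sg u α + sg v β + sg d ε)) (by abel)).of_eq (by abel) (by abel)⟩

/-- As `Move.turn`, setting also the label of `v` with one more step. -/
lemma Move.turn_right (k d u v l g h : Fin n) (s : ℤˣ) (c μ ν lam γ δ κ l' α β : ℤ)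
    (hν : ν % 2 = μ % 2) (hlam : lam % 2 = μ % 2) (hα : α % 2 = μ % 2) (hκ : κ % 2 = γ % 2)
    (hl : l' % 2 = γ % 2) (hδ : δ % 2 = γ % 2) (hβ : β % 2 = μ % 2) :
    ∃ ε t e, ε % 2 = μ % 2 ∧
      Move 4 (ed k d s c + sg u μ + sg v ν + sg l lam + sg g γ + sg h δ)
        (ed g h t e + sg k κ + sg l l' + sg u α + sg v β + sg d ε) := by
  obtain ⟨ε, f, hε, -, -, h1⟩ := Move.exch_left k d u v s 1 c μ ν (κ + lam - l') (by omega) hν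
  obtain ⟨f', hf', h2⟩ := Move.exch_both u v k l 1 1 f (κ + lam - l') lam α β
    (by omega) (by omega) (by omega)
  obtain ⟨e, he⟩ := exists_half_sub 1 hδ
  have h3 := Move.exch k l g h 1 1 f' γ δ κ l' e hκ
    (by simp only [Units.val_one, one_mul] at hf' ⊢; omega) he
  exact ⟨ε, 1, e, hε, (((h1.frame (sg l lam + sg g γ + sg h δ)).trans
    (h2.frame (sg d ε + sg g γ + sg h δ)) (by abel)).trans
    (h3.frame (sg u α + sg v β + sg d ε)) (by abel)).of_eq (by abel) (by abel)⟩

lemma Agree.of_frame {A : Finset (Fin n)} {S : Multiset (Cyc n)} {x y z : AffineWeylC n}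
    (ho : Agree A x y) (hA : ∀ i ∈ pts S, i ∈ A) (hs : ∀ i ∉ pts S, SameAt x z i) : Agree A z y :=
  fun i hi => (hs i fun h => hi (hA i h)).symm.trans (ho i hi)

section Stages

variable {A : Finset (Fin n)} {p : ℤ} {x : AffineWeylC n} {a b k l d u v g h : Fin n}

lemma Desc.stage_out (hx : Desc A {k, l} {g, h} p x) (hkl : k ≠ l) (hgh : g ≠ h)
    {κ l' : ℤ} (hκ : κ % 2 = p) (hl' : l' % 2 = p) :
    ∃ z, Reach 2 x z ∧ Desc A {g, h} {k, l} p z ∧ z.v k = κ ∧ z.v l = l' ∧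
      ∀ y, Agree A x y → Agree A z y := by
  have hd := hx.disj
  simp only [Finset.mem_insert, Finset.mem_singleton, forall_eq_or_imp, forall_eq, not_or] at hd
  have h1 := hx.sub
  have h2 := hx.subP
  have xg := hx.singP g (by simp)
  have xh := hx.singP h (by simp)
  have xk : x.π k = l := by have := hx.edge k (by simp); grind
  obtain ⟨e, -, m⟩ := Move.exch_both k l g h (x.s k) 1 (x.v l) (x.v g) (x.v h) κ l'
    (hκ.trans xg.2.symm) (hl'.trans xg.2.symm) (xh.2.trans xg.2.symm)
  have hA : ∀ i ∈ pts (ed k l (x.s k) (x.v l) + sg g (x.v g) + sg h (x.v h)), i ∈ A := by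
    simp; grind
  obtain ⟨z, hz, hzS, hzD, hs⟩ := hx.move m (T' := {g, h}) (P' := {k, l}) (by simp; grind)
    (by simp [hx.holds_ed xk, hx.holds_sg xg, hx.holds_sg xh]) hA (by simp; grind) (by simp; grind)
    (by
      clear m hA
      simp only [holds_add, AffineWeylC.holds_ed, AffineWeylC.holds_sg, pts_add, pts_ed, pts_sg,
        Sing]
      simp
      grind) (by grind) (by grind)
  simp only [holds_add, AffineWeylC.holds_ed, AffineWeylC.holds_sg] at hzS
  exact ⟨z, hz, hzD, hzS.1.2.2.2, hzS.2.2.2, fun y hy => hy.of_frame hA hs⟩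

lemma Desc.stage_through (hx : Desc A {a, b} {g, h} p x) (hab : a ≠ b) (hkl : k ≠ l) (hgh : g ≠ h)
    (hk : k ∈ A) (hka : k ∉ ({a, b} : Finset (Fin n))) (hkg : k ∉ ({g, h} : Finset (Fin n)))
    (hl : l ∈ A) (hla : l ∉ ({a, b} : Finset (Fin n))) (hlg : l ∉ ({g, h} : Finset (Fin n)))
    {κ l' α : ℤ} (hκ : κ % 2 = p) (hl' : l' % 2 = p) (hα : α % 2 = 1 - p) :
    ∃ z, Reach 3 x z ∧ Desc A {g, h} {k, l} p z ∧ z.v k = κ ∧ z.v l = l' ∧ z.v a = α ∧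
      ∀ y, Agree A x y → Agree A z y := by
  have hd := hx.disj
  simp only [Finset.mem_insert, Finset.mem_singleton, forall_eq_or_imp, forall_eq, not_or] at hd
  have h1 := hx.sub
  have h2 := hx.subP
  have xg := hx.singP g (by simp)
  have xh := hx.singP h (by simp)
  have xk := hx.singQ k hk hka hkg
  have xl := hx.singQ l hl hla hlg
  have xa : x.π a = b := by have := hx.edge a (by simp); grind
  obtain ⟨β, t, e, hβ, m⟩ := Move.visit a b g h k l (x.s a) (x.v b) (x.v k) (x.v l) κ l' (x.v g)
    (x.v h) α (xl.2.trans xk.2.symm) (hα.trans xk.2.symm)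
    (hκ.trans xg.2.symm) (hl'.trans xg.2.symm) (xh.2.trans xg.2.symm)
  have hA : ∀ i ∈ pts (ed a b (x.s a) (x.v b) + sg k (x.v k) + sg l (x.v l) + sg g (x.v g)
    + sg h (x.v h)), i ∈ A := by
    simp; grind
  rw [xk.2] at hβ
  obtain ⟨z, hz, hzS, hzD, hs⟩ := hx.move m (T' := {g, h}) (P' := {k, l}) (by simp; grind)
    (by simp [hx.holds_ed xa, hx.holds_sg xg, hx.holds_sg xh, hx.holds_sg xk, hx.holds_sg xl])
    hA (by simp; grind) (by simp; grind)
    (by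
      clear m hA
      simp only [holds_add, AffineWeylC.holds_ed, AffineWeylC.holds_sg, pts_add, pts_ed, pts_sg,
        Sing]
      simp
      grind) (by grind) (by grind)
  simp only [holds_add, AffineWeylC.holds_ed, AffineWeylC.holds_sg] at hzS
  exact ⟨z, hz, hzD, hzS.1.1.1.2.2.2, hzS.1.1.2.2.2, hzS.1.2.2.2, fun y hy => hy.of_frame hA hs⟩

lemma Desc.stage_relabel (hx : Desc A {a, b} {k, l} p x) (hab : a ≠ b) (hkl : k ≠ l)
    {κ l' : ℤ} (hκ : κ % 2 = p) (hl' : l' % 2 = p) :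
    ∃ z, Reach 3 x z ∧ Desc A {a, b} {k, l} p z ∧ z.v k = κ ∧ z.v l = l' ∧
      ∀ y, Agree A x y → Agree A z y := by
  have xa : x.π a = b := by have := hx.edge a (by simp); grind
  obtain ⟨w, hw, hwD, -, -, hs⟩ := hx.exch (a := a) (by simp) xa (g := k) (k := l) (by simp)
    (by simp) hkl hκ
  rw [show ({a, b} : Finset (Fin n)) \ {a, b} ∪ {k, l} = {k, l} by grind,
    show ({k, l} : Finset (Fin n)) \ {k, l} ∪ {a, b} = {a, b} by grind] at hwD
  obtain ⟨z, hz, hzD, h1, h2, h3⟩ := hwD.stage_out hkl hab hκ hl'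
  refine ⟨z, ((reach_one.2 hw).trans hz).mono (by omega), hzD, h1, h2, fun y hy => h3 y ?_⟩
  have h4 := hx.sub
  have h5 := hx.subP
  exact fun i hi => (hs i (by grind) (by grind) (by grind) (by grind)).symm.trans (hy i hi)

lemma Desc.stage_turn (hx : Desc A {k, d} {g, h} p x) (hkd : k ≠ d) (hgh : g ≠ h)
    (hu : u ∈ A) (hv : v ∈ A) (hl : l ∈ A)
    (hu' : u ∉ ({k, d, g, h, v, l} : Finset (Fin n))) (hv' : v ∉ ({k, d, g, h, l} : Finset (Fin n)))
    (hl' : l ∉ ({k, d, g, h} : Finset (Fin n))) {κ ll α β ε e : ℤ} {t : ℤˣ} {N : ℕ}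
    (hκ : κ % 2 = p) (hll : ll % 2 = p) (hα : α % 2 = 1 - p) (hβ : β % 2 = x.v u % 2)
    (hε : ε % 2 = x.v u % 2)
    (m : Move N (ed k d (x.s k) (x.v d) + sg u (x.v u) + sg v (x.v v) + sg l (x.v l) + sg g (x.v g)
        + sg h (x.v h))
      (ed g h t e + sg k κ + sg l ll + sg u α + sg v β + sg d ε)) :
    ∃ z, Reach N x z ∧ Desc A {g, h} {k, l} p z ∧ z.v k = κ ∧ z.v l = ll ∧ z.v u = α ∧ z.v v = β ∧
      z.v d = ε ∧ ∀ y, Agree A x y → Agree A z y := by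
  have hd := hx.disj
  simp only [Finset.mem_insert, Finset.mem_singleton, forall_eq_or_imp, forall_eq, not_or] at hd
  have h1 := hx.sub
  have h2 := hx.subP
  have xg := hx.singP g (by simp)
  have xh := hx.singP h (by simp)
  have xu := hx.singQ u hu (by grind) (by grind)
  have xv := hx.singQ v hv (by grind) (by grind)
  have xl := hx.singQ l hl (by grind) (by grind)
  have xk : x.π k = d := by have := hx.edge k (by simp); grind
  have hA : ∀ i ∈ pts (ed k d (x.s k) (x.v d) + sg u (x.v u) + sg v (x.v v) + sg l (x.v l)
    + sg g (x.v g) + sg h (x.v h)), i ∈ A := by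
    simp; grind
  rw [xu.2] at hβ hε
  obtain ⟨z, hz, hzS, hzD, hs⟩ := hx.move m (T' := {g, h}) (P' := {k, l}) (by simp; grind)
    (by simp [hx.holds_ed xk, hx.holds_sg xg, hx.holds_sg xh, hx.holds_sg xu, hx.holds_sg xl,
      hx.holds_sg xv])
    hA (by simp; grind) (by simp; grind)
    (by
      clear m hA
      simp only [holds_add, AffineWeylC.holds_ed, AffineWeylC.holds_sg, pts_add, pts_ed, pts_sg,
        Sing]
      simp
      grind) (by grind) (by grind)
  simp only [holds_add, AffineWeylC.holds_ed, AffineWeylC.holds_sg] at hzS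
  exact ⟨z, hz, hzD, hzS.1.1.1.1.2.2.2, hzS.1.1.1.2.2.2, hzS.1.1.2.2.2, hzS.1.2.2.2, hzS.2.2.2,
    fun y hy => hy.of_frame hA hs⟩

end Stages

section TwoSingles

variable {A T' E : Finset (Fin n)} {p : ℤ} {x y : AffineWeylC n} {a b k l d u v g h : Fin n}

lemma Desc.exists_label (hy : Desc A T' {k, l} p y) (hu : u ∈ A)
    (hu' : u ∉ ({k, l} : Finset (Fin n))) (hE : Disjoint T' E) :
    ∃ α : ℤ, α % 2 = 1 - p ∧ (u ∈ E → α = y.v u) := by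
  by_cases h : u ∈ E
  · exact ⟨y.v u, (hy.singQ u hu (fun h' => Finset.disjoint_left.1 hE h' h) hu').2, fun _ => rfl⟩
  · have := (hy.singP k (by simp)).2
    exact ⟨1 - p, by omega, fun h' => absurd h' h⟩

lemma Desc.turn_restrict (hx : Desc A {k, d} {g, h} p x) (hy : Desc A T' {k, l} p y)
    (ho : Agree A x y) (hkd : k ≠ d) (hgh : g ≠ h)
    (hu : u ∈ A) (hv : v ∈ A) (hl : l ∈ A)
    (hu' : u ∉ ({k, d, g, h, v, l} : Finset (Fin n))) (hv' : v ∉ ({k, d, g, h, l} : Finset (Fin n)))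
    (hl' : l ∉ ({k, d, g, h} : Finset (Fin n))) (hkE : {k, l} ⊆ E) (hE : E ⊆ {k, l, u})
    (hET : Disjoint T' E) :
    ∃ z, Reach 3 x z ∧ Desc (A \ E) {g, h} ((A \ E) \ {g, h}) (1 - p) z ∧
      Desc (A \ E) T' ((A \ E) \ T') (1 - p) y ∧ Agree (A \ E) z y := by
  have hd := hx.disj
  simp only [Finset.mem_insert, Finset.mem_singleton, forall_eq_or_imp, forall_eq, not_or] at hd
  have yk := hy.singP k (by simp)
  have yl := hy.singP l (by simp)
  have h1 := hx.sub
  have h2 := hx.subP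
  have xg := hx.singP g (by simp)
  have xh := hx.singP h (by simp)
  have xu := hx.singQ u hu (by grind) (by grind)
  have xv := hx.singQ v hv (by grind) (by grind)
  have xl := hx.singQ l hl (by grind) (by grind)
  obtain ⟨α, hα, hα'⟩ := hy.exists_label hu (by grind) hET
  obtain ⟨β, ε, t, e, hβ, hε, m⟩ := Move.turn k d u v l g h (x.s k) (x.v d) (x.v u) (x.v v) (x.v l)
    (x.v g) (x.v h) (y.v k) (y.v l) α (xv.2.trans xu.2.symm) (xl.2.trans xu.2.symm)
    (hα.trans xu.2.symm) (yk.2.trans xg.2.symm) (yl.2.trans xg.2.symm) (xh.2.trans xg.2.symm)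
  obtain ⟨z, hz, hzD, zk, zl, zu, -, -, hzo⟩ := hx.stage_turn hkd hgh hu hv hl hu' hv' hl'
    yk.2 yl.2 hα hβ hε m
  refine ⟨z, hz, hzD.restrict hy (hzo y ho) hkE ?_ hET ?_ ?_⟩
  · exact Finset.disjoint_of_subset_right hE (by rw [Finset.disjoint_left]; grind)
  · clear m hzD
    intro i hi
    have := hE hi
    grind
  · grind

lemma Desc.turn_restrict_left (hx : Desc A {k, d} {g, h} p x) (hy : Desc A T' {k, l} p y)
    (ho : Agree A x y) (hkd : k ≠ d) (hgh : g ≠ h)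
    (hu : u ∈ A) (hv : v ∈ A) (hl : l ∈ A)
    (hu' : u ∉ ({k, d, g, h, v, l} : Finset (Fin n))) (hv' : v ∉ ({k, d, g, h, l} : Finset (Fin n)))
    (hl' : l ∉ ({k, d, g, h} : Finset (Fin n))) (hkE : {k, l} ⊆ E) (hE : E ⊆ {k, l, u, d})
    (hET : Disjoint T' E) :
    ∃ z, Reach 4 x z ∧ Desc (A \ E) {g, h} ((A \ E) \ {g, h}) (1 - p) z ∧
      Desc (A \ E) T' ((A \ E) \ T') (1 - p) y ∧ Agree (A \ E) z y := by
  have hd := hx.disj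
  simp only [Finset.mem_insert, Finset.mem_singleton, forall_eq_or_imp, forall_eq, not_or] at hd
  have yk := hy.singP k (by simp)
  have yl := hy.singP l (by simp)
  have h1 := hx.sub
  have h2 := hx.subP
  have xg := hx.singP g (by simp)
  have xh := hx.singP h (by simp)
  have xu := hx.singQ u hu (by grind) (by grind)
  have xv := hx.singQ v hv (by grind) (by grind)
  have xl := hx.singQ l hl (by grind) (by grind)
  obtain ⟨α, hα, hα'⟩ := hy.exists_label hu (by grind) hET
  obtain ⟨ε, hε, hε'⟩ := hy.exists_label (u := d) (by grind) (by grind) hET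
  obtain ⟨β, t, e, hβ, m⟩ := Move.turn_left k d u v l g h (x.s k) (x.v d) (x.v u) (x.v v) (x.v l)
    (x.v g) (x.v h) (y.v k) (y.v l) α ε (xv.2.trans xu.2.symm) (xl.2.trans xu.2.symm)
    (hα.trans xu.2.symm) (yk.2.trans xg.2.symm) (yl.2.trans xg.2.symm) (xh.2.trans xg.2.symm)
    (hε.trans xu.2.symm)
  obtain ⟨z, hz, hzD, zk, zl, zu, -, zd, hzo⟩ := hx.stage_turn hkd hgh hu hv hl hu' hv' hl'
    yk.2 yl.2 hα hβ (hε.trans xu.2.symm) m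
  refine ⟨z, hz, hzD.restrict hy (hzo y ho) hkE ?_ hET ?_ ?_⟩
  · exact Finset.disjoint_of_subset_right hE (by rw [Finset.disjoint_left]; grind)
  · clear m hzD
    intro i hi
    have := hE hi
    grind
  · grind

lemma Desc.turn_restrict_right (hx : Desc A {k, d} {g, h} p x) (hy : Desc A T' {k, l} p y)
    (ho : Agree A x y) (hkd : k ≠ d) (hgh : g ≠ h)
    (hu : u ∈ A) (hv : v ∈ A) (hl : l ∈ A)
    (hu' : u ∉ ({k, d, g, h, v, l} : Finset (Fin n))) (hv' : v ∉ ({k, d, g, h, l} : Finset (Fin n)))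
    (hl' : l ∉ ({k, d, g, h} : Finset (Fin n))) (hkE : {k, l} ⊆ E) (hE : E ⊆ {k, l, u, v})
    (hET : Disjoint T' E) :
    ∃ z, Reach 4 x z ∧ Desc (A \ E) {g, h} ((A \ E) \ {g, h}) (1 - p) z ∧
      Desc (A \ E) T' ((A \ E) \ T') (1 - p) y ∧ Agree (A \ E) z y := by
  have hd := hx.disj
  simp only [Finset.mem_insert, Finset.mem_singleton, forall_eq_or_imp, forall_eq, not_or] at hd
  have yk := hy.singP k (by simp)
  have yl := hy.singP l (by simp)
  have h1 := hx.sub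
  have h2 := hx.subP
  have xg := hx.singP g (by simp)
  have xh := hx.singP h (by simp)
  have xu := hx.singQ u hu (by grind) (by grind)
  have xv := hx.singQ v hv (by grind) (by grind)
  have xl := hx.singQ l hl (by grind) (by grind)
  obtain ⟨α, hα, hα'⟩ := hy.exists_label hu (by grind) hET
  obtain ⟨β, hβ, hβ'⟩ := hy.exists_label hv (by grind) hET
  obtain ⟨ε, t, e, hε, m⟩ := Move.turn_right k d u v l g h (x.s k) (x.v d) (x.v u) (x.v v) (x.v l)
    (x.v g) (x.v h) (y.v k) (y.v l) α β (xv.2.trans xu.2.symm) (xl.2.trans xu.2.symm)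
    (hα.trans xu.2.symm) (yk.2.trans xg.2.symm) (yl.2.trans xg.2.symm) (xh.2.trans xg.2.symm)
    (hβ.trans xu.2.symm)
  obtain ⟨z, hz, hzD, zk, zl, zu, zv, -, hzo⟩ := hx.stage_turn hkd hgh hu hv hl hu' hv' hl'
    yk.2 yl.2 hα (hβ.trans xu.2.symm) hε m
  refine ⟨z, hz, hzD.restrict hy (hzo y ho) hkE ?_ hET ?_ ?_⟩
  · exact Finset.disjoint_of_subset_right hE (by rw [Finset.disjoint_left]; grind)
  · clear m hzD
    intro i hi
    have := hE hi
    grind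
  · grind

end TwoSingles

lemma exists_mem_of_card_lt {A B : Finset (Fin n)} (h : B.card < A.card) : ∃ i ∈ A, i ∉ B := by
  by_contra! hc
  exact absurd (Finset.card_le_card fun i hi => hc i hi) (by omega)

lemma card_five_le (a b c d e : Fin n) : ({a, b, c, d, e} : Finset (Fin n)).card ≤ 5 :=
  Finset.card_le_five

lemma card_six_le (a b c d e f : Fin n) : ({a, b, c, d, e, f} : Finset (Fin n)).card ≤ 6 :=
  Finset.card_le_six

section TwoSingles

variable {A T T' P P' : Finset (Fin n)} {p : ℤ} {x y : AffineWeylC n} {a b k l d u v g h : Fin n}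

lemma exists_eq_pair_of_mem (hT : T.card = 2) (ha : a ∈ T) : ∃ b, a ≠ b ∧ T = {a, b} := by
  obtain ⟨b, c, hbc, rfl⟩ := Finset.card_eq_two.1 hT
  simp only [Finset.mem_insert, Finset.mem_singleton] at ha
  rcases ha with rfl | rfl
  exacts [⟨c, hbc, rfl⟩, ⟨b, hbc.symm, Finset.pair_comm _ _⟩]

lemma disjoint_pair_of_desc (hy : Desc A T' P p y) : Disjoint T' P :=
  Finset.disjoint_left.2 hy.disj

set_option maxHeartbeats 1600000 in
/-- Fix the colour `p`, starting from an edge with an endpoint among its 1-cycles. -/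
lemma two_turn (hx : Desc A {k, d} {a, b} p x) (hy : Desc A T' {k, l} p y) (ho : Agree A x y)
    (hkd : k ≠ d) (hab : a ≠ b) (hkl : k ≠ l) (hl : l ∈ A)
    (hl' : l ∉ ({k, d, a, b} : Finset (Fin n))) (hT' : T'.card = 2) (hTT : {a, b} ≠ T')
    (hA : 7 ≤ A.card) (hA' : 8 ≤ A.card ∨ d ∈ T' ∧ Disjoint {a, b} T') :
    Reach (A.card - 1) x y := by
  have hab2 := Finset.card_pair hab
  have hkA := hx.sub
  have hT'A := hy.sub
  have hdj : Disjoint T' {k, l} := disjoint_pair_of_desc hy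
  have hdj1 := hx.disj
  simp only [Finset.mem_insert, Finset.mem_singleton, forall_eq_or_imp, forall_eq, not_or] at hdj1
  have c5 := card_five_le a b k d l
  rw [Finset.insert_subset_iff, Finset.singleton_subset_iff] at hkA
  simp only [Finset.mem_insert, Finset.mem_singleton, not_or] at hl'
  by_cases hc : ¬ Disjoint {a, b} T' ∨ 9 ≤ A.card
  · have h8 : 8 ≤ A.card := by
      rcases hc with hc | hc
      · exact hA'.resolve_right fun h => hc h.2
      · omega
    obtain ⟨u, hu, hu'⟩ : ∃ u ∈ A, u ∉ ({a, b, k, d, l} : Finset (Fin n)) ∪ T' := by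
      refine exists_mem_of_card_lt ?_
      rcases hc with hc | hc
      · rw [Finset.not_disjoint_iff] at hc
        obtain ⟨i, hi, hi'⟩ := hc
        have h1 := Finset.card_union_add_card_inter ({a, b, k, d, l} : Finset (Fin n)) T'
        have h2 : 0 < (({a, b, k, d, l} : Finset (Fin n)) ∩ T').card :=
          Finset.card_pos.2 ⟨i, by simp at hi ⊢; tauto⟩
        omega
      · have := Finset.card_union_le ({a, b, k, d, l} : Finset (Fin n)) T'
        omega
    simp only [Finset.mem_union, Finset.mem_insert, Finset.mem_singleton, not_or] at hu'
    obtain ⟨v, hv, hv'⟩ := exists_mem_of_card_lt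
      (lt_of_le_of_lt (card_six_le a b k d l u) (show 6 < A.card by omega))
    simp only [Finset.mem_insert, Finset.mem_singleton, not_or] at hv'
    have hET : Disjoint T' {k, l, u} := by
      rw [Finset.disjoint_left] at hdj ⊢
      intro i hi
      have := hdj hi
      simp only [Finset.mem_insert, Finset.mem_singleton, not_or] at this ⊢
      exact ⟨this.1, this.2, fun e => hu'.2 (e ▸ hi)⟩
    obtain ⟨z, hz, r1, r2, r3⟩ := hx.turn_restrict hy ho hkd hab (u := u) (v := v)
      (E := {k, l, u}) hu hv hl (by simp; tauto) (by simp; tauto) (by simp; tauto)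
      (by intro i; simp; tauto) (by rfl) hET
    have hc3 : (A \ {k, l, u}).card = A.card - 3 := by
      rw [Finset.card_sdiff_of_subset (by intro i; simp; rintro (rfl | rfl | rfl); exacts [hkA.1, hl, hu]),
        Finset.card_eq_three.2 ⟨k, l, u, hkl, Ne.symm hu'.1.2.2.1, Ne.symm hu'.1.2.2.2.2, rfl⟩]
    have := solo_ne r1 r2 r3 hab2 hT' (by omega) hTT (by rw [hc3]; intro h; rcases hc with hc | hc; exact hc; omega)
    exact (hz.trans this).mono (by omega)
  push Not at hc
  obtain ⟨hd, h9⟩ := hc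
  have hd' := Finset.disjoint_left.1 hd
  simp only [Finset.mem_insert, Finset.mem_singleton, forall_eq_or_imp, forall_eq] at hd'
  by_cases hdT : d ∈ T'
  · obtain ⟨w, hdw, rfl⟩ := exists_eq_pair_of_mem hT' hdT
    have hwA : w ∈ A := hT'A (by simp)
    have hw := Finset.disjoint_left.1 hdj (show w ∈ {d, w} by simp)
    have haw := hd'.1
    have hbw := hd'.2
    simp only [Finset.mem_insert, Finset.mem_singleton, not_or] at hw haw hbw
    obtain ⟨u, hu, hu'⟩ := exists_mem_of_card_lt
      (lt_of_le_of_lt (card_six_le a b k d l w) (show 6 < A.card by omega))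
    simp only [Finset.mem_insert, Finset.mem_singleton, not_or] at hu'
    by_cases h8 : A.card = 8
    · obtain ⟨v, hv, hv'⟩ := exists_mem_of_card_lt (A := A) (B := {a, b, k, d, l, w, u}) (by
        have := Finset.card_insert_le a {b, k, d, l, w, u}
        have := card_six_le b k d l w u
        omega)
      simp only [Finset.mem_insert, Finset.mem_singleton, not_or] at hv'
      obtain ⟨z, hz, r1, r2, r3⟩ := hx.turn_restrict_right hy ho hkd hab (u := u) (v := v)
        (E := {k, l, u, v}) hu hv hl (by simp; tauto) (by simp; tauto) (by simp; tauto)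
        (by intro i; simp; tauto) (by rfl) (by
          rw [Finset.disjoint_left]; simp
          grind)
      have hc3 : (A \ {k, l, u, v}).card = 4 := by
        rw [Finset.card_sdiff_of_subset (by
          intro i; simp; rintro (rfl | rfl | rfl | rfl); exacts [hkA.1, hl, hu, hv]),
          Finset.card_eq_four.2 ⟨k, l, u, v, by tauto, by tauto, by tauto, by tauto, by tauto,
            by tauto, rfl⟩]
        omega
      exact (hz.trans (solo_four_disjoint r1 r2 r3 hab2 hT' hc3 hd)).mono (by omega)
    · obtain ⟨z, hz, r1, r2, r3⟩ := hx.turn_restrict hy ho hkd hab (u := u) (v := w)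
        (E := {k, l, u}) hu hwA hl (by simp; tauto) (by simp; tauto) (by simp; tauto)
        (by intro i; simp; tauto) (by rfl) (by
          rw [Finset.disjoint_left]; simp
          grind)
      have hc3 : (A \ {k, l, u}).card = 4 := by
        rw [Finset.card_sdiff_of_subset (by
          intro i; simp; rintro (rfl | rfl | rfl); exacts [hkA.1, hl, hu]),
          Finset.card_eq_three.2 ⟨k, l, u, by tauto, by tauto, by tauto, rfl⟩]
        omega
      exact (hz.trans (solo_four_disjoint r1 r2 r3 hab2 hT' hc3 hd)).mono (by omega)
  · have h8 : A.card = 8 := by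
      rcases hA' with h | h
      · omega
      · exact absurd h.1 hdT
    obtain ⟨u, hu, hu'⟩ : ∃ u ∈ A, u ∉ ({a, b, k, d, l} : Finset (Fin n)) ∪ T' := by
      refine exists_mem_of_card_lt ?_
      have := Finset.card_union_le ({a, b, k, d, l} : Finset (Fin n)) T'
      omega
    simp only [Finset.mem_union, Finset.mem_insert, Finset.mem_singleton, not_or] at hu'
    obtain ⟨v, hv, hv'⟩ := exists_mem_of_card_lt
      (lt_of_le_of_lt (card_six_le a b k d l u) (show 6 < A.card by omega))
    simp only [Finset.mem_insert, Finset.mem_singleton, not_or] at hv'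
    obtain ⟨z, hz, r1, r2, r3⟩ := hx.turn_restrict_left hy ho hkd hab (u := u) (v := v)
      (E := {k, l, u, d}) hu hv hl (by simp; tauto) (by simp; tauto) (by simp; tauto)
      (by intro i; simp; tauto) (by rfl) (by
        rw [Finset.disjoint_left] at hdj ⊢
        intro i hi
        have := hdj hi
        simp only [Finset.mem_insert, Finset.mem_singleton, not_or] at this ⊢
        exact ⟨this.1, this.2, fun e => hu'.2 (e ▸ hi), fun e => hdT (e ▸ hi)⟩)
    have hc3 : (A \ {k, l, u, d}).card = 4 := by
      rw [Finset.card_sdiff_of_subset (by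
        intro i; simp; rintro (rfl | rfl | rfl | rfl); exacts [hkA.1, hl, hu, hkA.2]),
        Finset.card_eq_four.2 ⟨k, l, u, d, by tauto, by tauto, by tauto, by tauto, by tauto,
          by tauto, rfl⟩]
      omega
    exact (hz.trans (solo_four_disjoint r1 r2 r3 hab2 hT' hc3 hd)).mono (by omega)

lemma two_turn' (hx : Desc A {k, d} {a, b} p x) (hy : Desc A T' {k, l} p y) (ho : Agree A x y)
    (hkd : k ≠ d) (hab : a ≠ b) (hkl : k ≠ l) (hl : l ∈ A)
    (hl' : l ∉ ({k, d, a, b} : Finset (Fin n))) (hT' : T'.card = 2) (hTT : {a, b} ≠ T')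
    (hA : 7 ≤ A.card) : Reach A.card x y := by
  by_cases h : 8 ≤ A.card ∨ d ∈ T' ∧ Disjoint {a, b} T'
  · exact (two_turn hx hy ho hkd hab hkl hl hl' hT' hTT hA h).mono (by omega)
  push Not at h
  obtain ⟨h8, hd⟩ := h
  have h7 : A.card = 7 := by omega
  have hab2 := Finset.card_pair hab
  have hkA := hx.sub
  have hdj : Disjoint T' {k, l} := disjoint_pair_of_desc hy
  have c5 := card_five_le a b k d l
  rw [Finset.insert_subset_iff, Finset.singleton_subset_iff] at hkA
  simp only [Finset.mem_insert, Finset.mem_singleton, not_or] at hl'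
  obtain ⟨u, hu, hu'⟩ := exists_mem_of_card_lt
    (lt_of_le_of_lt c5 (show 5 < A.card by omega))
  simp only [Finset.mem_insert, Finset.mem_singleton, not_or] at hu'
  obtain ⟨v, hv, hv'⟩ := exists_mem_of_card_lt
    (lt_of_le_of_lt (card_six_le a b k d l u) (show 6 < A.card by omega))
  simp only [Finset.mem_insert, Finset.mem_singleton, not_or] at hv'
  by_cases hTd : Disjoint {a, b} T'
  · have hdT : d ∉ T' := fun h => hd h hTd
    obtain ⟨z, hz, r1, r2, r3⟩ := hx.turn_restrict_left hy ho hkd hab (u := u) (v := v)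
      (E := {k, l, d}) hu hv hl (by simp; tauto) (by simp; tauto) (by simp; tauto)
      (by intro i; simp; tauto) (by intro i; simp; tauto) (by
        rw [Finset.disjoint_left] at hdj ⊢
        intro i hi
        have := hdj hi
        simp only [Finset.mem_insert, Finset.mem_singleton, not_or] at this ⊢
        exact ⟨this.1, this.2, fun e => hdT (e ▸ hi)⟩)
    have hc3 : (A \ {k, l, d}).card = 4 := by
      rw [Finset.card_sdiff_of_subset (by
        intro i; simp; rintro (rfl | rfl | rfl); exacts [hkA.1, hl, hkA.2]),
        Finset.card_eq_three.2 ⟨k, l, d, by tauto, by tauto, by tauto, rfl⟩]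
      omega
    exact (hz.trans (solo_four_disjoint r1 r2 r3 hab2 hT' hc3 hTd)).mono (by omega)
  · obtain ⟨z, hz, r1, r2, r3⟩ := hx.turn_restrict hy ho hkd hab (u := u) (v := v)
      (E := {k, l}) hu hv hl (by simp; tauto) (by simp; tauto) (by simp; tauto)
      (by rfl) (by intro i; simp; tauto) hdj
    have hc3 : (A \ {k, l}).card = 5 := by
      rw [Finset.card_sdiff_of_subset (by
        intro i; simp; rintro (rfl | rfl); exacts [hkA.1, hl]), Finset.card_pair hkl]
      omega
    have := solo_ne r1 r2 r3 hab2 hT' hc3.ge hTT (fun _ => hTd)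
    exact (hz.trans this).mono (by omega)

end TwoSingles

section TwoSingles

variable {A T T' P P' : Finset (Fin n)} {p : ℤ} {x y : AffineWeylC n} {a b k l d u v g h : Fin n}

lemma Desc.exch_pair (hx : Desc A T {k, d} p x) (hkd : k ≠ d) (hT : T.card = 2) :
    ∃ z, Reach 1 x z ∧ Desc A {k, d} T p z ∧ ∀ y, Agree A x y → Agree A z y := by
  obtain ⟨a, b, hab, rfl, xab, -⟩ := hx.exists_edge hT
  obtain ⟨w, hw, hwD, -, -, hs⟩ := hx.exch (a := a) (by simp) xab (g := k) (k := d) (by simp)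
    (by simp) hkd (hx.singP k (by simp)).2
  rw [show ({a, b} : Finset (Fin n)) \ {a, b} ∪ {k, d} = {k, d} by grind,
    show ({k, d} : Finset (Fin n)) \ {k, d} ∪ {a, b} = {a, b} by grind] at hwD
  refine ⟨w, reach_one.2 hw, hwD, fun y hy i hi => ?_⟩
  have h4 := hx.sub
  have h5 := hx.subP
  exact (hs i (by grind) (by grind) (by grind) (by grind)).symm.trans (hy i hi)

lemma card_sdiff_pair (hk : k ∈ A) (hl : l ∈ A) (hkl : k ≠ l) :
    (A \ {k, l}).card = A.card - 2 := by
  rw [Finset.card_sdiff_of_subset (by simp [Finset.insert_subset_iff, hk, hl]),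
    Finset.card_pair hkl]

lemma card_sdiff_triple (hk : k ∈ A) (hl : l ∈ A) (hu : u ∈ A) (hkl : k ≠ l) (hku : k ≠ u)
    (hlu : l ≠ u) : (A \ {k, l, u}).card = A.card - 3 := by
  rw [Finset.card_sdiff_of_subset (by simp [Finset.insert_subset_iff, hk, hl, hu]),
    Finset.card_eq_three.2 ⟨k, l, u, hkl, hku, hlu, rfl⟩]

lemma two_pq (hx : Desc A T {k, d} p x) (hy : Desc A T' {k, l} p y) (ho : Agree A x y)
    (hT : T.card = 2) (hT' : T'.card = 2) (hkd : k ≠ d) (hkl : k ≠ l) (hl : l ∈ A)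
    (hlT : l ∉ T) (hld : l ≠ d) (hA : 7 ≤ A.card) (hTT : T ≠ T') : Reach (A.card + 1) x y := by
  obtain ⟨w, hw, hwD, hwo⟩ := hx.exch_pair hkd hT
  obtain ⟨a, b, hab, rfl⟩ := Finset.card_eq_two.1 hT
  have := two_turn' hwD hy (hwo y ho) hkd hab hkl hl (by grind) hT' hTT hA
  exact (hw.trans this).mono (by omega)

lemma two_tp (hx : Desc A {l, b} {k, d} p x) (hy : Desc A T' {k, l} p y) (ho : Agree A x y)
    (hT' : T'.card = 2) (hkd : k ≠ d) (hkl : k ≠ l) (hlb : l ≠ b) (hA : 7 ≤ A.card)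
    (hTT : {l, b} ≠ T') : Reach (A.card + 1) x y := by
  have hdj := hx.disj
  simp only [Finset.mem_insert, Finset.mem_singleton, forall_eq_or_imp, forall_eq, not_or] at hdj
  have hdA : d ∈ A := hx.subP (by simp)
  have hlA : l ∈ A := hx.sub (by simp)
  by_cases hd : d ∈ T'
  · obtain ⟨f, hdf, rfl⟩ := exists_eq_pair_of_mem hT' hd
    have hfA : f ∈ A := hy.sub (by simp)
    obtain ⟨g, hg, hg'⟩ := exists_mem_of_card_lt
      (lt_of_le_of_lt (card_five_le l b k d f) (show 5 < A.card by omega))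
    obtain ⟨h, hh, hh'⟩ := exists_mem_of_card_lt
      (lt_of_le_of_lt (card_six_le l b k d f g) (show 6 < A.card by omega))
    simp only [Finset.mem_insert, Finset.mem_singleton, not_or] at hg' hh'
    have hgh : g ≠ h := Ne.symm hh'.2.2.2.2.2
    have xl : x.π l = b := by have := hx.edge l (by simp); grind
    have sw := hx.swap
    obtain ⟨z, hz, hzD, -, -, hs⟩ := sw.exch (a := l) (by simp) xl (g := g) (k := h)
      (by simp; tauto) (by simp; tauto) hgh (sw.singP g (by simp; tauto)).2
    have hzD := hzD.swap
    rw [sub_sub_cancel, show ({l, b} : Finset (Fin n)) \ {l, b} ∪ {g, h} = {g, h} by grind] at hzD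
    have h4 := hx.sub
    have h5 := hx.subP
    rw [show (A \ {g, h}) \ ((((A \ {l, b}) \ {k, d}) \ {g, h}) ∪ {l, b}) = {k, d} by
      clear hzD sw hx hy
      ext i
      simp only [Finset.mem_sdiff, Finset.mem_union, Finset.mem_insert, Finset.mem_singleton]
      grind] at hzD
    have hzo : Agree A z y := fun i hi =>
      (hs i (by grind) (by grind) (by grind) (by grind)).symm.trans (ho i hi)
    obtain ⟨w, hw, hwD, hwo⟩ := hzD.exch_pair hkd (Finset.card_pair hgh)
    have hd2 : Disjoint ({g, h} : Finset (Fin n)) {d, f} := by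
      rw [Finset.disjoint_left]; simp; tauto
    have := two_turn hwD hy (hwo y hzo) hkd hgh hkl hlA (by simp; tauto) hT'
      (fun e => by rw [e] at hd2; simp at hd2) hA (.inr ⟨by simp, hd2⟩)
    exact (((reach_one.2 hz).trans hw).trans this).mono (by omega)
  · exact (two_pq hy hx (Agree.symm ho) hT' (Finset.card_pair hlb) hkl hkd hdA hd (by tauto) hA
      hTT.symm).symm

lemma two_qq (hx : Desc A {a, b} {g, h} p x) (hy : Desc A T' {k, l} p y) (ho : Agree A x y)
    (hT' : T'.card = 2) (hab : a ≠ b) (hgh : g ≠ h) (hkl : k ≠ l) (hk : k ∈ A) (hl : l ∈ A)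
    (hka : k ∉ ({a, b} : Finset (Fin n))) (hkg : k ∉ ({g, h} : Finset (Fin n)))
    (hla : l ∉ ({a, b} : Finset (Fin n))) (hlg : l ∉ ({g, h} : Finset (Fin n)))
    (hA : 7 ≤ A.card) : Reach (A.card + 1) x y := by
  have hdj := hx.disj
  simp only [Finset.mem_insert, Finset.mem_singleton, forall_eq_or_imp, forall_eq, not_or] at hdj
  have hdT := disjoint_pair_of_desc hy
  have hdT' := Finset.disjoint_left.1 hdT
  have yk := hy.singP k (by simp)
  have yl := hy.singP l (by simp)
  have haA : a ∈ A := hx.sub (by simp)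
  have hak : a ∉ ({k, l} : Finset (Fin n)) := by grind
  have c2 := card_sdiff_pair hk hl hkl
  by_cases h7 : A.card = 7 ∧ {g, h} = T'
  · obtain ⟨h7, rfl⟩ := h7
    have ya := hy.singQ a haA (by simp; tauto) hak
    obtain ⟨z, hz, hzD, zk, zl, za, hzo⟩ := hx.stage_through hab hkl hgh hk hka hkg hl hla hlg
      yk.2 yl.2 ya.2
    obtain ⟨r1, r2, r3⟩ := hzD.restrict hy (hzo y ho) (E := {k, l, a}) (by grind)
      (by rw [Finset.disjoint_left]; grind) (by rw [Finset.disjoint_left]; grind) (by grind)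
      (by grind)
    have c3 := card_sdiff_triple hk hl haA hkl (by grind) (by grind)
    exact (hz.trans (solo_four_eq r1 r2 r3 hT' (by omega))).mono (by omega)
  · obtain ⟨z, hz, hzD, zk, zl, za, hzo⟩ := hx.stage_through hab hkl hgh hk hka hkg hl hla hlg
      yk.2 yl.2 (hx.singQ k hk hka hkg).2
    obtain ⟨r1, r2, r3⟩ := hzD.restrict hy (hzo y ho) (E := {k, l}) (by grind)
      (by rw [Finset.disjoint_left]; grind) (by rw [Finset.disjoint_left]; grind) (by grind)
      (by grind)
    have := solo_any r1 r2 r3 (Finset.card_pair hgh) hT' (by omega) (fun h e => h7 ⟨by omega, e⟩)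
    exact (hz.trans this).mono (by omega)

set_option maxHeartbeats 1600000 in
lemma two_tq (hx : Desc A {k, d} {g, h} p x) (hy : Desc A T' {k, l} p y) (ho : Agree A x y)
    (hT' : T'.card = 2) (hkd : k ≠ d) (hgh : g ≠ h) (hkl : k ≠ l) (hl : l ∈ A)
    (hl' : l ∉ ({k, d, g, h} : Finset (Fin n))) (hA : 7 ≤ A.card) : Reach (A.card + 1) x y := by
  have hdj := hx.disj
  simp only [Finset.mem_insert, Finset.mem_singleton, forall_eq_or_imp, forall_eq, not_or] at hdj
  have hdT := disjoint_pair_of_desc hy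
  have hkA : k ∈ A := hx.sub (by simp)
  have c2 := card_sdiff_pair hkA hl hkl
  simp only [Finset.mem_insert, Finset.mem_singleton, not_or] at hl'
  obtain ⟨u, hu, hu'⟩ := exists_mem_of_card_lt
    (lt_of_le_of_lt (card_five_le k d g h l) (show 5 < A.card by omega))
  simp only [Finset.mem_insert, Finset.mem_singleton, not_or] at hu'
  obtain ⟨v, hv, hv'⟩ := exists_mem_of_card_lt
    (lt_of_le_of_lt (card_six_le k d g h l u) (show 6 < A.card by omega))
  simp only [Finset.mem_insert, Finset.mem_singleton, not_or] at hv'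
  by_cases h7 : A.card = 7 ∧ {g, h} = T'
  · obtain ⟨h7, rfl⟩ := h7
    obtain ⟨z, hz, r1, r2, r3⟩ := hx.turn_restrict hy ho hkd hgh (u := u) (v := v) (E := {k, l, u})
      hu hv hl (by simp; tauto) (by simp; tauto) (by simp; tauto) (by intro i; simp; tauto)
      (by rfl) (by rw [Finset.disjoint_left]; simp; tauto)
    have c3 := card_sdiff_triple hkA hl hu hkl (by tauto) (by tauto)
    clear hdj hl' hu' hv'
    exact (hz.trans (solo_four_eq r1 r2 r3 hT' (by omega))).mono (by omega)
  · obtain ⟨z, hz, r1, r2, r3⟩ := hx.turn_restrict hy ho hkd hgh (u := u) (v := v) (E := {k, l})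
      hu hv hl (by simp; tauto) (by simp; tauto) (by simp; tauto) (by rfl)
      (by intro i; simp; tauto) hdT
    clear hdj hl' hu' hv'
    have := solo_any r1 r2 r3 (Finset.card_pair hgh) hT' (by omega) (fun h e => h7 ⟨by omega, e⟩)
    exact (hz.trans this).mono (by omega)

lemma two_out (hx : Desc A {k, l} {g, h} p x) (hy : Desc A T' {k, l} p y) (ho : Agree A x y)
    (hT' : T'.card = 2) (hgh : g ≠ h) (hkl : k ≠ l) (hA : 7 ≤ A.card) :
    Reach (A.card + 1) x y := by
  have hdj := hx.disj
  simp only [Finset.mem_insert, Finset.mem_singleton, forall_eq_or_imp, forall_eq, not_or] at hdj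
  have hkA : k ∈ A := hx.sub (by simp)
  have hlA : l ∈ A := hx.sub (by simp)
  have c2 := card_sdiff_pair hkA hlA hkl
  obtain ⟨z, hz, hzD, zk, zl, hzo⟩ := hx.stage_out hkl hgh (hy.singP k (by simp)).2
    (hy.singP l (by simp)).2
  obtain ⟨r1, r2, r3⟩ := hzD.restrict hy (hzo y ho) (E := {k, l}) (by grind)
    (by rw [Finset.disjoint_left]; grind) (disjoint_pair_of_desc hy) (by grind) (by grind)
  exact (hz.trans (solo_any' r1 r2 r3 (Finset.card_pair hgh) hT' (by omega))).mono (by omega)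

lemma two_pp (hx : Desc A T {k, l} p x) (hy : Desc A T' {k, l} p y) (ho : Agree A x y)
    (hT : T.card = 2) (hT' : T'.card = 2) (hkl : k ≠ l) (hA : 7 ≤ A.card) (hTT : T ≠ T') :
    Reach (A.card + 1) x y := by
  obtain ⟨a, b, hab, rfl⟩ := Finset.card_eq_two.1 hT
  have hkA : k ∈ A := hx.subP (by simp)
  have hlA : l ∈ A := hx.subP (by simp)
  have c2 := card_sdiff_pair hkA hlA hkl
  obtain ⟨z, hz, hzD, zk, zl, hzo⟩ := hx.stage_relabel hab hkl (hy.singP k (by simp)).2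
    (hy.singP l (by simp)).2
  obtain ⟨r1, r2, r3⟩ := hzD.restrict hy (hzo y ho) (E := {k, l}) (by grind)
    (disjoint_pair_of_desc hx) (disjoint_pair_of_desc hy) (by grind) (by grind)
  exact (hz.trans (solo_ne' r1 r2 r3 hT hT' (by omega) hTT)).mono (by omega)

/-- One edge, two 1-cycles of one colour and at least three of the other, distinct supports of the
edges. -/
lemma two_ne (hx : Desc A T P p x) (hy : Desc A T' P' p y) (ho : Agree A x y)
    (hT : T.card = 2) (hT' : T'.card = 2) (hP : P.card = 2) (hP' : P'.card = 2) (hA : 7 ≤ A.card)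
    (hTT : T ≠ T') : Reach (A.card + 1) x y := by
  obtain ⟨k, l, hkl, rfl⟩ := Finset.card_eq_two.1 hP'
  wlog H : (k ∈ P ∨ l ∉ P) ∧ (l ∈ T → k ∈ T ∨ k ∈ P) generalizing k l
  · refine this l k hkl.symm (by rwa [Finset.pair_comm]) (by rwa [Finset.pair_comm]) ?_
    have := hx.disj k
    have := hx.disj l
    tauto
  have hkA : k ∈ A := hy.subP (by simp)
  have hlA : l ∈ A := hy.subP (by simp)
  by_cases hkP : k ∈ P
  · obtain ⟨d, hkd, rfl⟩ := exists_eq_pair_of_mem hP hkP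
    by_cases hlT : l ∈ T
    · obtain ⟨b, hlb, rfl⟩ := exists_eq_pair_of_mem hT hlT
      exact two_tp hx hy ho hT' hkd hkl hlb hA hTT
    · by_cases hld : l = d
      · subst hld
        exact two_pp hx hy ho hT hT' hkl hA hTT
      · exact two_pq hx hy ho hT hT' hkd hkl hlA hlT hld hA hTT
  · have hlP : l ∉ P := by tauto
    obtain ⟨g, h, hgh, rfl⟩ := Finset.card_eq_two.1 hP
    by_cases hkT : k ∈ T
    · obtain ⟨d, hkd, rfl⟩ := exists_eq_pair_of_mem hT hkT
      by_cases hld : l = d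
      · subst hld
        exact two_out hx hy ho hT' hgh hkl hA
      · exact two_tq hx hy ho hT' hkd hgh hkl hlA (by simp at hlP ⊢; grind) hA
    · have hlT : l ∉ T := by tauto
      obtain ⟨a, b, hab, rfl⟩ := Finset.card_eq_two.1 hT
      exact two_qq hx hy ho hT' hab hgh hkl hkA hlA hkT hkP hlT hlP hA

end TwoSingles

lemma Desc.card_add {A T P : Finset (Fin n)} {p : ℤ} {x : AffineWeylC n} (h : Desc A T P p x) :
    T.card + P.card + ((A \ T) \ P).card = A.card := by
  have h1 : P ⊆ A \ T := fun i hi => Finset.mem_sdiff.2 ⟨h.subP hi, fun h' => h.disj i h' hi⟩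
  have h2 := Finset.card_sdiff_add_card_eq_card h1
  have h3 := Finset.card_sdiff_add_card_eq_card h.sub
  omega

section OneEdge

variable {A T T' P P' : Finset (Fin n)} {p : ℤ} {x y : AffineWeylC n}

lemma Desc.exists_solve (hx : Desc A T P p x) (hy : Desc A T' P' p y) (ho : Agree A x y)
    (hT : T.card = 2) (hT' : T'.card = 2) (hP : 3 ≤ P.card) {a : Fin n} (ha : a ∈ T) (ha' : a ∈ P') :
    ∃ z T₁ P₁, Reach 1 x z ∧ Desc (A.erase a) T₁ P₁ p z ∧ Agree (A.erase a) z y ∧ T₁.card = 2 ∧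
      P₁.card + 1 = P.card ∧ T₁ ≠ T' := by
  obtain ⟨b, hab, rfl, xab, -⟩ := hx.exists_pair hT ha
  obtain ⟨g, hg, hgT⟩ := Finset.exists_mem_notMem_of_card_lt_card (by omega : T'.card < P.card)
  obtain ⟨k, hk, hkg⟩ := Finset.exists_mem_ne (by omega : 1 < P.card) g
  obtain ⟨z, hl, hz, hzo, -, -⟩ := hx.exch_erase ho ha xab hg hk hkg.symm hy.full (hy.singP a ha')
  rw [show ({a, b} : Finset (Fin n)) \ {a, b} ∪ {g, k} = {g, k} by grind] at hz
  refine ⟨z, _, _, reach_one.2 hl, hz, hzo, Finset.card_pair hkg.symm, ?_, ?_⟩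
  · have hb := hx.disj b (by simp)
    rw [Finset.card_union_of_disjoint (by simp [hb]),
      Finset.card_sdiff_of_subset (by simp [Finset.insert_subset_iff, hg, hk]),
      Finset.card_pair hkg.symm, Finset.card_singleton]
    omega
  · rintro rfl
    simp at hgT

/-- One edge and at least two 1-cycles of each colour, distinct supports of the edges. -/
lemma one_ne (k : ℕ) : ∀ {A T T' P P' : Finset (Fin n)} {p : ℤ} {x y : AffineWeylC n},
    Desc A T P p x → Desc A T' P' p y → Agree A x y → T.card = 2 → T'.card = 2 →
    P.card = P'.card → 2 ≤ P.card → P.card + 4 ≤ A.card → A.card = k + 7 → T ≠ T' →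
    Reach (k + 8) x y := by
  induction k with
  | zero =>
    intro A T T' P P' p x y hx hy ho hT hT' hP hP2 hQ2 hA hTT
    have h1 := hx.card_add
    have h2 := hy.card_add
    by_cases h : P.card = 2
    · exact (two_ne hx hy ho hT hT' h (by omega) (by omega) hTT).mono (by omega)
    · exact (two_ne hx.swap hy.swap ho hT hT' (by omega) (by omega) (by omega) hTT).mono (by omega)
  | succ k ih =>
    intro A T T' P P' p x y hx hy ho hT hT' hP hP2 hQ2 hA hTT
    have h1 := hx.card_add
    have h2 := hy.card_add
    by_cases h : P.card = 2
    · exact (two_ne hx hy ho hT hT' h (by omega) (by omega) hTT).mono (by omega)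
    by_cases h' : ((A \ T) \ P).card = 2
    · exact (two_ne hx.swap hy.swap ho hT hT' h' (by omega) (by omega) hTT).mono (by omega)
    obtain ⟨a, haT, haT'⟩ : ∃ a ∈ T, a ∉ T' := by
      by_contra hc
      push Not at hc
      exact hTT (Finset.eq_of_subset_of_card_le hc (by omega))
    have haA := hx.sub haT
    have hAe := Finset.card_erase_of_mem haA
    by_cases haP : a ∈ P'
    · obtain ⟨z, T₁, P₁, hz, hzD, hzo, hT₁, hP₁, hTT₁⟩ :=
        hx.exists_solve hy ho hT hT' (by omega) haT haP
      have := Finset.card_erase_of_mem haP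
      exact (hz.trans (ih hzD (hy.erase haT') hzo hT₁ hT' (by omega) (by omega) (by omega)
        (by omega) hTT₁)).mono (by omega)
    · have haQ : a ∈ (A \ T') \ P' := by simp [haA, haT', haP]
      obtain ⟨z, T₁, P₁, hz, hzD, hzo, hT₁, hP₁, hTT₁⟩ :=
        hx.swap.exists_solve hy.swap ho hT hT' (by omega) haT haQ
      have := Finset.card_erase_of_mem haQ
      exact (hz.trans (ih hzD (hy.swap.erase haT') hzo hT₁ hT' (by omega) (by omega) (by omega)
        (by omega) hTT₁)).mono (by omega)

/-- One edge and at least two 1-cycles of each colour. -/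
lemma one_any (hx : Desc A T P p x) (hy : Desc A T' P' p y) (ho : Agree A x y)
    (hT : T.card = 2) (hT' : T'.card = 2) (hPP : P.card = P'.card) (hP : 2 ≤ P.card)
    (hQ : P.card + 4 ≤ A.card) (hA : 7 ≤ A.card) : Reach (A.card + 2) x y := by
  obtain ⟨k, hk⟩ := Nat.exists_eq_add_of_le' hA
  by_cases hTT : T = T'
  · subst hTT
    obtain ⟨a, b, hab, rfl, xab, -⟩ := hx.exists_edge hT
    obtain ⟨g, hg, h, hh, hgh⟩ := Finset.one_lt_card.1 (by omega : 1 < P.card)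
    obtain ⟨z, hl, hz, -, -, hs⟩ := hx.exch (a := a) (by simp) xab hg hh hgh (hx.singP g hg).2
    rw [show ({a, b} : Finset (Fin n)) \ {a, b} ∪ {g, h} = {g, h} by grind] at hz
    have h1 := hz.card_add
    have hga : g ∉ ({a, b} : Finset (Fin n)) := fun h' => hx.disj g h' hg
    have hP₁ : (P \ {g, h} ∪ {a, b}).card = P.card := by
      have h2 : Disjoint (P \ {g, h}) {a, b} := by
        rw [Finset.disjoint_left]
        exact fun i hi hi' => hx.disj i hi' (Finset.mem_sdiff.1 hi).1
      rw [Finset.card_union_of_disjoint h2,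
        Finset.card_sdiff_of_subset (by simp [Finset.insert_subset_iff, hg, hh]),
        Finset.card_pair hgh, Finset.card_pair hab]
      omega
    have hzo : Agree A z y := fun i hi => by
      have h4 := hx.sub
      have h5 := hx.subP
      exact (hs i (by grind) (by grind) (by grind) (by grind)).symm.trans (ho i hi)
    refine ((reach_one.2 hl).trans (one_ne k hz hy hzo (Finset.card_pair hgh) hT' (by omega)
      (by omega) (by omega) hk ?_)).mono (by omega)
    intro h'
    exact hga (h' ▸ by simp)
  · exact (one_ne k hx hy ho hT hT' hPP hP hQ hk hTT).mono (by omega)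

end OneEdge

lemma Move.par_two {S U T S' U' T' : Multiset (Cyc n)} (h₁ : Move 1 S U) (h₂ : Move 1 U T)
    (h₁' : Move 1 S' U') (h₂' : Move 1 U' T') : Move 2 (S + S') (T + T') :=
  (h₁.par h₁').trans (h₂.par h₂') rfl

/-- An edge can be changed arbitrarily in two steps. -/
lemma Move.edge_two (i j : Fin n) (s s' : ℤˣ) (c c' : ℤ) :
    ∃ t e, Move 1 (ed i j s c) (ed i j t e) ∧ Move 1 (ed i j t e) (ed i j s' c') := by
  rcases eq_or_ne s s' with rfl | h
  · refine ⟨-s, 0, Move.flip _ _ _ _ _, ?_⟩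
    have := Move.flip i j (-s) 0 c'
    rwa [neg_neg] at this
  · refine ⟨s, c, (Move.refl _).mono (by omega), ?_⟩
    rw [Int.units_ne_iff_eq_neg] at h
    subst h
    have := Move.flip i j (-s') c c'
    rwa [neg_neg] at this

/-- Two edges can be changed arbitrarily in two steps. -/
lemma Move.double (a b k l : Fin n) (s t s' t' : ℤˣ) (c e c' e' : ℤ) :
    Move 2 (ed a b s c + ed k l t e) (ed a b s' c' + ed k l t' e') := by
  obtain ⟨_, _, h1, h2⟩ := Move.edge_two a b s s' c c'
  obtain ⟨_, _, h3, h4⟩ := Move.edge_two k l t t' e e'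
  exact Move.par_two h1 h2 h3 h4

/-- Two edges can be replaced by any two edges on the same points in two steps. -/
lemma Move.cross_two (i j k l : Fin n) (s t u w : ℤˣ) (c e d f : ℤ) :
    Move 2 (ed i j s c + ed k l t e) (ed i k u d + ed j l w f) := by
  have hf : ∀ (d' : ℤ), Move 1 (ed i k (-u) d') (ed i k u d) := fun d' => by
    have := Move.flip i k (-u) d' d
    rwa [neg_neg] at this
  rcases eq_or_ne w (t * -u * s) with h | h
  · have h1 := Move.cross i j k l s t (-u) w c e (t * (f - e + w * c)) f h
      (by rw [sign_mul_sign_mul]; ring)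
    exact h1.trans ((hf _).frame _) rfl
  · have h1 := Move.cross i j k l s t (-u) (t * -u * s) c e 0 _ rfl rfl
    refine h1.trans ((hf _).par (T' := ed j l w f) ?_) rfl
    rw [Int.units_ne_iff_eq_neg] at h
    rw [h]
    exact Move.flip _ _ _ _ _

/-- Change two edges and two 1-cycles, keeping their supports. -/
lemma Move.double_relabel (a b k l g h : Fin n) (s t s' t' : ℤˣ) (c e μ ν c' e' μ' ν' : ℤ)
    (hν : ν % 2 = μ % 2) (hμ' : μ' % 2 = μ % 2) (hν' : ν' % 2 = μ % 2) :
    Move 4 (ed a b s c + ed k l t e + sg g μ + sg h ν)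
      (ed a b s' c' + ed k l t' e' + sg g μ' + sg h ν') := by
  obtain ⟨_, _, k1, k2⟩ := Move.edge_two k l t t' e e'
  obtain ⟨β, lam, hβ, -, -, h1⟩ := Move.exch_left a b g h s 1 c μ ν μ rfl hν
  obtain ⟨d, hd⟩ := exists_half_add 1 (hν'.trans hμ'.symm)
  have h2 := Move.exch_edge g h a b (-1) s' d c' μ β μ' ν' hμ' (by simp at hd ⊢; omega) hβ
  refine (((h1.par k1).trans (((Move.flip g h 1 lam d).frame (sg a μ + sg b β)).par k2) ?_).trans
    (h2.frame (ed k l t' e')) ?_).of_eq ?_ ?_ <;> abel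

/-- Re-match two edges and change two 1-cycles. -/
lemma Move.cross_relabel (a b k l g h : Fin n) (s t s' t' : ℤˣ) (c e μ ν c' e' μ' ν' : ℤ)
    (hν : ν % 2 = μ % 2) (hμ' : μ' % 2 = μ % 2) (hν' : ν' % 2 = μ % 2) :
    Move 4 (ed a b s c + ed k l t e + sg g μ + sg h ν)
      (ed a k s' c' + ed b l t' e' + sg g μ' + sg h ν') := by
  have h1 := Move.cross a b k l s t (-s') (t * -s' * s) c e (c' + s' * μ) _ rfl rfl
  obtain ⟨_, _, k1, k2⟩ := Move.edge_two b l (t * -s' * s) t'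
    (t * (c' + s' * μ) + e - (t * -s' * s : ℤˣ) * c) e'
  obtain ⟨β, lam, -, hβ, -, h2⟩ := Move.exch_left a k g h (-s') 1 (c' + s' * μ) μ ν μ rfl hν
  obtain ⟨d, hd⟩ := exists_half_add 1 (hν'.trans hμ'.symm)
  have h3 := Move.exch g h a k (-1) s' d μ β μ' ν' c' hμ' (by simp at hd ⊢; omega)
    (by rw [hβ]; push_cast; ring)
  refine (((h1.frame (sg g μ + sg h ν)).trans (h2.par k1) ?_).trans
    ((((Move.flip g h 1 lam d).frame (sg a μ + sg k β)).par k2).trans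
    (h3.frame (ed b l t' e')) ?_) ?_).of_eq ?_ ?_ <;> abel

/-- Exchange the 1-cycles `e`, `f` for `e`, `a`, keeping one of the edges. -/
lemma Move.double_shift (a z p q e f : Fin n) (s t s' t' : ℤˣ) (c d μ ν c' d' μ' ν' : ℤ)
    (hν : ν % 2 = μ % 2) (hμ' : μ' % 2 = μ % 2) (hν' : ν' % 2 = μ % 2) :
    Move 4 (ed a z s c + ed p q t d + sg e μ + sg f ν)
      (ed z f s' c' + ed p q t' d' + sg e μ' + sg a ν') := by
  obtain ⟨β, lam, hβ, -, -, h1⟩ := Move.exch_left p q e f t (-s' * s) d μ ν μ rfl hν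
  obtain ⟨r, hr⟩ := exists_half_sub 1 (hμ'.trans hν'.symm)
  have h2 := Move.cross a z e f s (-s' * s) 1 (-s') c lam r _
    (by rw [mul_one, mul_assoc, Int.units_mul_self, mul_one]) rfl
  obtain ⟨lam', hl⟩ := exists_half_sub (-t') hβ
  have h3 := Move.exch a e p q 1 (-t') r μ β ν' μ' lam' hν' (by simp at hr ⊢; omega) hl
  have h4 := Move.flip p q (-t') lam' d'
  have h5 := Move.flip z f (-s') ((-s' * s : ℤˣ) * r + lam - (-s' : ℤˣ) * c) c'
  rw [neg_neg] at h4 h5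
  refine ((((h1.frame (ed a z s c)).trans (h2.frame (sg p μ + sg q β)) ?_).trans
    (h3.frame (ed z f (-s') ((-s' * s : ℤˣ) * r + lam - (-s' : ℤˣ) * c))) ?_).trans
    ((h4.par h5).frame (sg e μ' + sg a ν')) ?_).of_eq ?_ ?_ <;> abel

/-- Exchange the 1-cycles `e`, `f` for `e`, `a`, re-matching the edges. -/
lemma Move.cross_shift (a z p q e f : Fin n) (s t s' t' : ℤˣ) (c d μ ν c' d' μ' ν' : ℤ)
    (hν : ν % 2 = μ % 2) (hμ' : μ' % 2 = μ % 2) (hν' : ν' % 2 = μ % 2) :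
    Move 4 (ed p a s c + ed q z t d + sg e μ + sg f ν)
      (ed z f s' c' + ed p q t' d' + sg e μ' + sg a ν') := by
  have h1 := Move.cross p a q z s t (-t') (t * -t' * s) c d (d' + t' * μ) _ rfl rfl
  set σ := t * -t' * s
  set γ := (t : ℤ) * (d' + t' * μ) + d - (σ : ℤˣ) * c
  obtain ⟨β, lam, hβ, hβ', -, h2⟩ := Move.exch_left p q e f (-t') (-s' * σ) (d' + t' * μ) μ ν μ rfl hν
  obtain ⟨r, hr⟩ := exists_half_sub 1 (hμ'.trans hν'.symm)
  have h3 := Move.cross a z e f σ (-s' * σ) 1 (-s') γ lam r _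
    (by rw [mul_one, mul_assoc, Int.units_mul_self, mul_one]) rfl
  have h4 := Move.exch a e p q 1 t' r μ β ν' μ' d' hν' (by simp at hr ⊢; omega)
    (by rw [hβ']; push_cast; ring)
  have h5 := Move.flip z f (-s') ((-s' * σ : ℤˣ) * r + lam - (-s' : ℤˣ) * γ) c'
  rw [neg_neg] at h5
  refine ((((h1.frame (sg e μ + sg f ν)).trans (h2.frame (ed a z σ γ)) ?_).trans
    (h3.frame (sg p μ + sg q β)) ?_).trans (h4.par h5) ?_).of_eq ?_ ?_ <;> abel

/-- Join the endpoints of two edges by a prescribed edge, and exchange it with two 1-cycles,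
setting their labels. -/
lemma Move.cross_exit (i j k l g h : Fin n) (s t : ℤˣ) (c e γ δ κ κ' : ℤ)
    (hδ : δ % 2 = γ % 2) (hκ : κ % 2 = γ % 2) (hκ' : κ' % 2 = γ % 2) :
    ∃ w f lam, Move 2 (ed i j s c + ed k l t e + sg g γ + sg h δ)
      (ed j l w f + ed g h 1 lam + sg i κ + sg k κ') := by
  obtain ⟨r, hr⟩ := exists_half_sub 1 (hκ'.trans hκ.symm)
  obtain ⟨w, f, h1⟩ : ∃ w f, Move 1 (ed i j s c + ed k l t e) (ed i k 1 r + ed j l w f) :=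
    ⟨_, _, Move.cross i j k l s t 1 _ c e r _ rfl rfl⟩
  obtain ⟨lam, hl⟩ := exists_half_sub 1 hδ
  have h2 := Move.exch i k g h 1 1 r γ δ κ κ' lam hκ (by simp at hr ⊢; omega) hl
  refine ⟨w, f, lam, ((h1.frame (sg g γ + sg h δ)).trans (h2.frame (ed j l w f)) ?_).of_eq ?_ ?_⟩ <;>
  abel

section TwoEdges

variable {A T T' P P' : Finset (Fin n)} {p : ℤ} {x y : AffineWeylC n}

lemma Desc.exists_two_edges (hx : Desc A T P p x) (hT : T.card = 4) {a : Fin n} (ha : a ∈ T) :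
    ∃ b k l, [a, b, k, l].Nodup ∧ T = {a, b, k, l} ∧ x.π a = b ∧ x.π b = a ∧ x.π k = l ∧
      x.π l = k := by
  have h1 := hx.edge a ha
  obtain ⟨k, hk⟩ : (T \ {a, x.π a}).Nonempty := by
    rw [← Finset.card_pos, Finset.card_sdiff_of_subset (by
      simp [Finset.insert_subset_iff, ha, h1.1]), Finset.card_pair h1.2.symm]
    omega
  simp only [Finset.mem_sdiff, Finset.mem_insert, Finset.mem_singleton, not_or] at hk
  have h2 := hx.edge k hk.1
  have h3 := hx.full.invol
  have hnd : [a, x.π a, k, x.π k].Nodup := by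
    have := h3 a
    have := h3 k
    simp
    grind
  refine ⟨x.π a, k, x.π k, hnd, (Finset.eq_of_subset_of_card_le ?_ ?_).symm, rfl, h3 a, rfl, h3 k⟩
  · simp [Finset.insert_subset_iff, *]
  · have : ({a, x.π a, k, x.π k} : Finset (Fin n)) = [a, x.π a, k, x.π k].toFinset := by simp
    rw [this, List.toFinset_card_of_nodup hnd, hT]
    simp

lemma eq_last_of_invol {f : Fin n → Fin n} (hi : ∀ i, f (f i) = i) {a b k l : Fin n}
    (h : f a = b) (ha : k ≠ a) (hb : k ≠ b) (hk : f k ≠ k)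
    (hm : f k = a ∨ f k = b ∨ f k = k ∨ f k = l) : f k = l := by
  have h1 := hi a
  have h2 := hi k
  rcases hm with hm | hm | hm | hm
  · rw [hm, h] at h2; exact absurd h2.symm hb
  · rw [hm, ← h, h1] at h2; exact absurd h2.symm ha
  · exact absurd hm hk
  · exact hm

/-- Two edges and nothing else. -/
lemma quad (hx : Desc A A P p x) (hy : Desc A A P' p y) (ho : Agree A x y) (hA : A.card = 4) :
    Reach 2 x y := by
  obtain ⟨a, ha⟩ := Finset.card_pos.1 (by omega : 0 < A.card)
  obtain ⟨b, k, l, hnd, rfl, hab, -, hkl, hlk⟩ := hx.exists_two_edges hA ha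
  have ya := hy.edge a (by simp)
  have yb := hy.edge b (by simp)
  have yk := hy.edge k (by simp)
  have yl := hy.edge l (by simp)
  have hi := hy.full.invol
  simp only [List.nodup_cons, List.mem_cons, List.not_mem_nil, or_false, not_or,
    List.nodup_nil, not_false_eq_true, and_true] at hnd
  obtain ⟨⟨hb, hk, hl⟩, ⟨hbk, hbl⟩, hkl'⟩ := hnd
  simp only [Finset.mem_insert, Finset.mem_singleton] at ya yb yk yl
  have hnd₁ : (pts (ed a b (x.s a) (x.v b) + ed k l (x.s k) (x.v l))).Nodup := by
    clear hx hy ho ya yb yk yl hi; simp; grind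
  have hnd₂ : (pts (ed a b (x.s a) (x.v b) + ed l k (x.s l) (x.v k))).Nodup := by
    clear hx hy ho ya yb yk yl hi; simp; grind
  rcases ya.1 with h | h | h | h
  · exact absurd h ya.2
  · have h' : y.π k = l := eq_last_of_invol hi h (Ne.symm hk) (Ne.symm hbk) yk.2 yk.1
    refine Move.reach (Move.double a b k l _ _ _ _ _ _ _ _) hnd₁
      ((holds_add _ _ _).2 ⟨hx.holds_ed hab, hx.holds_ed hkl⟩)
      ((holds_add _ _ _).2 ⟨hy.holds_ed h, hy.holds_ed h'⟩)
      fun i hi => ho i fun hi' => hi ?_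
    clear hx hy ho hi
    simp at hi' ⊢; grind
  · have h' : y.π b = l := eq_last_of_invol hi h (Ne.symm hb) hbk yb.2 (by clear hx hy ho hi ya yk yl; grind)
    refine Move.reach (Move.cross_two a b k l _ _ _ _ _ _ _ _) hnd₁
      ((holds_add _ _ _).2 ⟨hx.holds_ed hab, hx.holds_ed hkl⟩)
      ((holds_add _ _ _).2 ⟨hy.holds_ed h, hy.holds_ed h'⟩)
      fun i hi => ho i fun hi' => hi ?_
    clear hx hy ho hi
    simp at hi' ⊢; grind
  · have h' : y.π b = k := eq_last_of_invol hi h (Ne.symm hb) hbl yb.2 (by clear hx hy ho hi ya yk yl; grind)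
    refine Move.reach (Move.cross_two a b l k _ _ _ _ _ _ _ _) hnd₂
      ((holds_add _ _ _).2 ⟨hx.holds_ed hab, hx.holds_ed hlk⟩)
      ((holds_add _ _ _).2 ⟨hy.holds_ed h, hy.holds_ed h'⟩)
      fun i hi => ho i fun hi' => hi ?_
    clear hx hy ho hi
    simp at hi' ⊢; grind

lemma six_eq {a b k l e f : Fin n} (hx : Desc {a, b, k, l, e, f} {a, b, k, l} {e, f} p x)
    (hy : Desc {a, b, k, l, e, f} {a, b, k, l} {e, f} p y) (ho : Agree {a, b, k, l, e, f} x y)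
    (hnd : [a, b, k, l, e, f].Nodup) (xab : x.π a = b) (xkl : x.π k = l) (xlk : x.π l = k) :
    Reach 4 x y := by
  have xe := hx.singP e (by simp)
  have xf := hx.singP f (by simp)
  have ye := hy.singP e (by simp)
  have yf := hy.singP f (by simp)
  have ya := hy.edge a (by simp)
  have yb := hy.edge b (by simp)
  have yk := hy.edge k (by simp)
  have hi := hy.full.invol
  simp only [List.nodup_cons, List.mem_cons, List.not_mem_nil, or_false, not_or,
    List.nodup_nil, not_false_eq_true, and_true] at hnd
  obtain ⟨⟨hb, hk, hl, -, -⟩, ⟨hbk, hbl, -, -⟩, -⟩ := id hnd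
  have hnd₁ : (pts (ed a b (x.s a) (x.v b) + ed k l (x.s k) (x.v l) + sg e (x.v e) +
      sg f (x.v f))).Nodup := by
    clear hx hy ho hi; simp; grind
  have hnd₂ : (pts (ed a b (x.s a) (x.v b) + ed l k (x.s l) (x.v k) + sg e (x.v e) +
      sg f (x.v f))).Nodup := by
    clear hx hy ho hi; simp; grind
  simp only [Finset.mem_insert, Finset.mem_singleton] at ya yb yk
  rcases ya.1 with h | h | h | h
  · exact absurd h ya.2
  · have h' : y.π k = l := eq_last_of_invol hi h (Ne.symm hk) (Ne.symm hbk) yk.2 yk.1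
    refine Move.reach (Move.double_relabel a b k l e f _ _ _ _ _ _ _ _ _ _ _ _
      (xf.2.trans xe.2.symm) (ye.2.trans xe.2.symm) (yf.2.trans xe.2.symm)) hnd₁
      (by simp [hx.holds_ed xab, hx.holds_ed xkl, hx.holds_sg xe, hx.holds_sg xf])
      (by simp only [holds_add]; exact ⟨⟨⟨hy.holds_ed h, hy.holds_ed h'⟩, hy.holds_sg ye⟩, hy.holds_sg yf⟩)
      fun i hi => ho i fun hi' => hi ?_
    clear hx hy ho hi
    simp at hi' ⊢; grind
  · have h' : y.π b = l := eq_last_of_invol hi h (Ne.symm hb) hbk yb.2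
      (by clear hx hy ho hi ya yk; grind)
    refine Move.reach (Move.cross_relabel a b k l e f _ _ _ _ _ _ _ _ _ _ _ _
      (xf.2.trans xe.2.symm) (ye.2.trans xe.2.symm) (yf.2.trans xe.2.symm)) hnd₁
      (by simp [hx.holds_ed xab, hx.holds_ed xkl, hx.holds_sg xe, hx.holds_sg xf])
      (by simp only [holds_add]; exact ⟨⟨⟨hy.holds_ed h, hy.holds_ed h'⟩, hy.holds_sg ye⟩, hy.holds_sg yf⟩)
      fun i hi => ho i fun hi' => hi ?_
    clear hx hy ho hi
    simp at hi' ⊢; grind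
  · have h' : y.π b = k := eq_last_of_invol hi h (Ne.symm hb) hbl yb.2
      (by clear hx hy ho hi ya yk; grind)
    refine Move.reach (Move.cross_relabel a b l k e f _ _ _ _ _ _ _ _ _ _ _ _
      (xf.2.trans xe.2.symm) (ye.2.trans xe.2.symm) (yf.2.trans xe.2.symm)) hnd₂
      (by simp [hx.holds_ed xab, hx.holds_ed xlk, hx.holds_sg xe, hx.holds_sg xf])
      (by simp only [holds_add]; exact ⟨⟨⟨hy.holds_ed h, hy.holds_ed h'⟩, hy.holds_sg ye⟩, hy.holds_sg yf⟩)
      fun i hi => ho i fun hi' => hi ?_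
    clear hx hy ho hi
    simp at hi' ⊢; grind

lemma six_overlap {a z k l e f : Fin n} (hx : Desc {a, z, k, l, e, f} {a, z, k, l} {e, f} p x)
    (hy : Desc {a, z, k, l, e, f} {f, z, k, l} {e, a} p y) (ho : Agree {a, z, k, l, e, f} x y)
    (hnd : [a, z, k, l, e, f].Nodup) (yf : y.π f = z) (ykl : y.π k = l) (ylk : y.π l = k) :
    Reach 4 x y := by
  have xe := hx.singP e (by simp)
  have xf := hx.singP f (by simp)
  have ye := hy.singP e (by simp)
  have ya := hy.singP a (by simp)
  have yz : y.π z = f := yf ▸ hy.full.invol f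
  have xa := hx.edge a (by simp)
  have xz := hx.edge z (by simp)
  have xk := hx.edge k (by simp)
  have hi := hx.full.invol
  simp only [List.nodup_cons, List.mem_cons, List.not_mem_nil, or_false, not_or,
    List.nodup_nil, not_false_eq_true, and_true] at hnd
  obtain ⟨⟨hz, hk, hl, -, -⟩, ⟨hzk, hzl, -, -⟩, -⟩ := id hnd
  simp only [Finset.mem_insert, Finset.mem_singleton] at xa xz xk
  rcases xa.1 with h | h | h | h
  · exact absurd h xa.2
  · have h' : x.π k = l := eq_last_of_invol hi h (Ne.symm hk) (Ne.symm hzk) xk.2 xk.1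
    refine Move.reach (Move.double_shift a z k l e f _ _ _ _ _ _ _ _ _ _ _ _
      (xf.2.trans xe.2.symm) (ye.2.trans xe.2.symm) (ya.2.trans xe.2.symm)) ?_
      (by simp only [holds_add]; exact ⟨⟨⟨hx.holds_ed h, hx.holds_ed h'⟩, hx.holds_sg xe⟩, hx.holds_sg xf⟩)
      (by simp only [holds_add]; exact ⟨⟨⟨hy.holds_ed yz, hy.holds_ed ykl⟩, hy.holds_sg ye⟩, hy.holds_sg ya⟩)
      fun i hi => ho i fun hi' => hi ?_
    · clear hx hy ho hi; simp; grind
    · clear hx hy ho hi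
      simp at hi' ⊢; grind
  · have h' : x.π z = l := eq_last_of_invol hi h (Ne.symm hz) hzk xz.2
      (by clear hx hy ho hi xa xk; grind)
    have h1 : x.π k = a := h ▸ hi a
    have h2 : x.π l = z := h' ▸ hi z
    refine Move.reach (Move.cross_shift a z k l e f _ _ _ _ _ _ _ _ _ _ _ _
      (xf.2.trans xe.2.symm) (ye.2.trans xe.2.symm) (ya.2.trans xe.2.symm)) ?_
      (by simp only [holds_add]; exact ⟨⟨⟨hx.holds_ed h1, hx.holds_ed h2⟩, hx.holds_sg xe⟩, hx.holds_sg xf⟩)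
      (by simp only [holds_add]; exact ⟨⟨⟨hy.holds_ed yz, hy.holds_ed ykl⟩, hy.holds_sg ye⟩, hy.holds_sg ya⟩)
      fun i hi => ho i fun hi' => hi ?_
    · clear hx hy ho hi; simp; grind
    · clear hx hy ho hi
      simp at hi' ⊢; grind
  · have h' : x.π z = k := eq_last_of_invol hi h (Ne.symm hz) hzl xz.2
      (by clear hx hy ho hi xa xk; grind)
    have h1 : x.π l = a := h ▸ hi a
    have h2 : x.π k = z := h' ▸ hi z
    refine Move.reach (Move.cross_shift a z l k e f _ _ _ _ _ _ _ _ _ _ _ _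
      (xf.2.trans xe.2.symm) (ye.2.trans xe.2.symm) (ya.2.trans xe.2.symm)) ?_
      (by simp only [holds_add]; exact ⟨⟨⟨hx.holds_ed h1, hx.holds_ed h2⟩, hx.holds_sg xe⟩, hx.holds_sg xf⟩)
      (by simp only [holds_add]; exact ⟨⟨⟨hy.holds_ed yz, hy.holds_ed ylk⟩, hy.holds_sg ye⟩, hy.holds_sg ya⟩)
      fun i hi => ho i fun hi' => hi ?_
    · clear hx hy ho hi; simp; grind
    · clear hx hy ho hi
      simp at hi' ⊢; grind

lemma Desc.cross_exit {i j k l g h : Fin n} (hx : Desc A {i, j, k, l} {g, h} p x)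
    (hnd : [i, j, k, l, g, h].Nodup) (xij : x.π i = j) (xkl : x.π k = l) {κ κ' : ℤ}
    (hκ : κ % 2 = p) (hκ' : κ' % 2 = p) :
    ∃ z, Reach 2 x z ∧ Desc A {j, l, g, h} {i, k} p z ∧ z.v i = κ ∧ z.v k = κ' ∧
      ∀ y, Agree A x y → Agree A z y := by
  have h1 := hx.sub
  have h2 := hx.subP
  have xg := hx.singP g (by simp)
  have xh := hx.singP h (by simp)
  simp only [List.nodup_cons, List.mem_cons, List.not_mem_nil, or_false, not_or,
    List.nodup_nil, not_false_eq_true, and_true] at hnd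
  obtain ⟨w, f, lam, m⟩ := Move.cross_exit i j k l g h (x.s i) (x.s k) (x.v j) (x.v l) (x.v g)
    (x.v h) κ κ' (xh.2.trans xg.2.symm) (hκ.trans xg.2.symm) (hκ'.trans xg.2.symm)
  have hA : ∀ u ∈ pts (ed i j (x.s i) (x.v j) + ed k l (x.s k) (x.v l) + sg g (x.v g)
      + sg h (x.v h)), u ∈ A := by
    clear hx m; simp; grind
  obtain ⟨z, hz, hzS, hzD, hs⟩ := hx.move m (T' := {j, l, g, h}) (P' := {i, k})
    (by clear hx m; simp; grind)
    (by simp only [holds_add]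
        exact ⟨⟨⟨hx.holds_ed xij, hx.holds_ed xkl⟩, hx.holds_sg xg⟩, hx.holds_sg xh⟩)
    hA (by clear hx m; simp; grind) (by clear hx m; simp; grind)
    (by
      clear m hA hx
      simp only [holds_add, AffineWeylC.holds_ed, AffineWeylC.holds_sg, pts_add, pts_ed, pts_sg,
        Sing]
      simp
      grind) (by clear hx m; grind) (by clear hx m; grind)
  simp only [holds_add, AffineWeylC.holds_ed, AffineWeylC.holds_sg] at hzS
  exact ⟨z, hz, hzD, hzS.1.2.2.2, hzS.2.2.2, fun y hy => hy.of_frame hA hs⟩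

lemma Desc.exch_out {a b e f c d : Fin n} (hx : Desc A {a, b, e, f} {c, d} p x)
    (hnd : [a, b, e, f, c, d].Nodup) (xab : x.π a = b) (xef : x.π e = f) {κ κ' : ℤ}
    (hκ : κ % 2 = p) (hκ' : κ' % 2 = p) :
    ∃ z, Reach 2 x z ∧ Desc A {c, d, e, f} {a, b} p z ∧ z.v a = κ ∧ z.v b = κ' ∧
      ∀ y, Agree A x y → Agree A z y := by
  have h1 := hx.sub
  have h2 := hx.subP
  have xc := hx.singP c (by simp)
  have xd := hx.singP d (by simp)
  simp only [List.nodup_cons, List.mem_cons, List.not_mem_nil, or_false, not_or,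
    List.nodup_nil, not_false_eq_true, and_true] at hnd
  obtain ⟨lam, -, m₀⟩ := Move.exch_both a b c d (x.s a) 1 (x.v b) (x.v c) (x.v d) κ κ'
    (hκ.trans xc.2.symm) (hκ'.trans xc.2.symm) (xd.2.trans xc.2.symm)
  have m := m₀.frame (ed e f (x.s e) (x.v f))
  clear m₀
  have hA : ∀ u ∈ pts (ed a b (x.s a) (x.v b) + sg c (x.v c) + sg d (x.v d)
      + ed e f (x.s e) (x.v f)), u ∈ A := by
    clear hx m; simp; grind
  obtain ⟨z, hz, hzS, hzD, hs⟩ := hx.move m (T' := {c, d, e, f}) (P' := {a, b})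
    (by clear hx m; simp; grind)
    (by simp only [holds_add]
        exact ⟨⟨⟨hx.holds_ed xab, hx.holds_sg xc⟩, hx.holds_sg xd⟩, hx.holds_ed xef⟩)
    hA (by clear hx m; simp; grind) (by clear hx m; simp; grind)
    (by
      clear m hA hx
      simp only [holds_add, AffineWeylC.holds_ed, AffineWeylC.holds_sg, pts_add, pts_ed, pts_sg,
        Sing]
      simp
      grind) (by clear hx m; grind) (by clear hx m; grind)
  simp only [holds_add, AffineWeylC.holds_ed, AffineWeylC.holds_sg] at hzS
  exact ⟨z, hz, hzD, hzS.1.1.2.2.2, hzS.1.2.2.2, fun y hy => hy.of_frame hA hs⟩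

lemma six_finish {A T T' : Finset (Fin n)} {g h : Fin n} {z : AffineWeylC n}
    (hz : Desc A T {g, h} p z) (hy : Desc A T' {g, h} p y)
    (ho : Agree A z y) (hT : T.card = 4) (hT' : T'.card = 4) (hA : A.card = 6) (hgh : g ≠ h)
    (hg : z.v g = y.v g) (hh : z.v h = y.v h) : Reach 2 z y := by
  have h1 := hy.subP
  have h3 := hy.sub
  have h4 := hz.sub
  have d1 : Disjoint T {g, h} := Finset.disjoint_left.2 hz.disj
  have d2 : Disjoint T' {g, h} := Finset.disjoint_left.2 hy.disj
  obtain ⟨hz', hy', ho'⟩ := hz.restrict hy ho subset_rfl d1 d2 (by simp [hg, hh]) h1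
  have h2 : (A \ {g, h}).card = 4 := by
    rw [Finset.card_sdiff_of_subset h1, Finset.card_pair hgh, hA]
  have e1 : T = A \ {g, h} := Finset.eq_of_subset_of_card_le hz'.sub (by omega)
  have e2 : T' = A \ {g, h} := Finset.eq_of_subset_of_card_le hy'.sub (by omega)
  rw [← e1] at hz' hy' ho'
  rw [e2, ← e1] at hy'
  exact quad hz' hy' ho' hT

lemma card_four {a b c d : Fin n} (h : [a, b, c, d].Nodup) :
    ({a, b, c, d} : Finset (Fin n)).card = 4 := by
  rw [show ({a, b, c, d} : Finset (Fin n)) = [a, b, c, d].toFinset by simp,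
    List.toFinset_card_of_nodup h]
  simp

lemma Desc.eq_sdiff (hx : Desc A T P p x) (h : A.card ≤ T.card + P.card) : T = A \ P := by
  refine Finset.eq_of_subset_of_card_le (fun i hi => Finset.mem_sdiff.2 ⟨hx.sub hi, hx.disj i hi⟩) ?_
  rw [Finset.card_sdiff_of_subset hx.subP]
  omega

/-- Two edges and two 1-cycles. -/
lemma duo_six (hx : Desc A T P p x) (hy : Desc A T' P' p y) (ho : Agree A x y)
    (hT : T.card = 4) (hT' : T'.card = 4) (hP : P.card = 2) (hP' : P'.card = 2)
    (hA : A.card = 6) : Reach 4 x y := by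
  have eT := hx.eq_sdiff (by omega)
  have eT' := hy.eq_sdiff (by omega)
  obtain ⟨e, f, hef, rfl⟩ := Finset.card_eq_two.1 hP
  have d := hx.disj
  have sP := hx.subP
  have sP' := hy.subP
  by_cases h0 : P' = {e, f}
  · subst h0
    obtain ⟨a, ha⟩ := Finset.card_pos.1 (by omega : 0 < T.card)
    obtain ⟨b, k, l, hnd, rfl, hab, -, hkl, hlk⟩ := hx.exists_two_edges hT ha
    obtain rfl : T' = {a, b, k, l} := by rw [eT', eT]
    obtain rfl : A = {a, b, k, l, e, f} := by
      rw [← Finset.sdiff_union_of_subset sP, ← eT]; clear hx hy ho; grind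
    exact six_eq hx hy ho (by
      clear hx hy ho hT hT' hP hP' hA
      simp at hnd ⊢; grind) hab hkl hlk
  obtain ⟨g, hg, hgP⟩ : ∃ g ∈ P', g ∉ ({e, f} : Finset (Fin n)) := by
    by_contra! hc
    exact h0 (Finset.eq_of_subset_of_card_le hc (by omega))
  have hgT : g ∈ T := by rw [eT]; exact Finset.mem_sdiff.2 ⟨sP' hg, hgP⟩
  obtain ⟨h, hh, hgh⟩ := Finset.exists_mem_ne (by omega : 1 < P'.card) g
  obtain rfl : P' = {g, h} := by
    refine (Finset.eq_of_subset_of_card_le ?_ ?_).symm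
    · simp [Finset.insert_subset_iff, hg, hh]
    · rw [Finset.card_pair hgh.symm, hP']
  have yg := hy.singP g (by simp)
  have yh := hy.singP h (by simp)
  by_cases hhT : h ∈ T
  · obtain ⟨j, k, l, hnd, rfl, xgj, -, xkl, xlk⟩ := hx.exists_two_edges hT hgT
    have hnd' : [g, j, k, l, e, f].Nodup := by
      clear hx hy ho eT eT' hT hT' hP hP' hA
      simp at hnd d ⊢; grind
    have key : ∀ {z : AffineWeylC n} {T₁ : Finset (Fin n)}, Reach 2 x z → Desc A T₁ {g, h} p z →
        T₁.card = 4 → z.v g = y.v g → z.v h = y.v h → Agree A z y → Reach 4 x y :=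
      fun hz hzD hT₁ h1 h2 h3 => hz.trans (six_finish hzD hy h3 hT₁ hT' hA hgh.symm h1 h2)
    have hh' : h = j ∨ h = k ∨ h = l := by
      clear hx hy ho eT eT' hT hT' hP hP' hA
      simp at hhT
      grind
    clear eT eT' sP sP' d
    rcases hh' with rfl | rfl | rfl
    · obtain ⟨z, hz, hzD, h1, h2, h3⟩ := hx.exch_out hnd' xgj xkl yg.2 yh.2
      exact key hz hzD (card_four (by clear hx hy ho; simp at hnd' ⊢; grind)) h1 h2 (h3 y ho)
    · obtain ⟨z, hz, hzD, h1, h2, h3⟩ := hx.cross_exit hnd' xgj xkl yg.2 yh.2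
      exact key hz hzD (card_four (by clear hx hy ho; simp at hnd' ⊢; grind)) h1 h2 (h3 y ho)
    · rw [show ({g, j, k, h} : Finset (Fin n)) = {g, j, h, k} by clear hx hy ho; grind] at hx
      obtain ⟨z, hz, hzD, h1, h2, h3⟩ := hx.cross_exit
        (by clear hx hy ho; simp at hnd' ⊢; grind) xgj xlk yg.2 yh.2
      exact key hz hzD (card_four (by clear hx hy ho; simp at hnd' ⊢; grind)) h1 h2 (h3 y ho)
  · have key : ∀ {e f : Fin n}, e ≠ f → h = e → Desc A T {e, f} p x → Reach 4 x y := by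
      rintro e f hef rfl hx
      have hd := hx.disj
      have hfA : f ∈ A := hx.subP (by simp)
      have hfT : f ∈ T' := by
        rw [eT']
        simp [hfA, hef.symm]
        rintro rfl
        exact hd f hgT (by simp)
      obtain ⟨z, k, l, hnd, rfl, yfz, -, ykl, ylk⟩ := hy.exists_two_edges hT' hfT
      have eA : A = {g, z, k, l, h, f} := by
        rw [← Finset.sdiff_union_of_subset sP', ← eT']
        ext i
        simp only [Finset.mem_union, Finset.mem_insert, Finset.mem_singleton]
        clear * -
        tauto
      have hnd' : [g, z, k, l, h, f].Nodup := by
        have hd' := hy.disj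
        clear hx hy ho hT hT' hP hP' hA eA eT eT' hd
        simp at hnd hd' ⊢
        grind
      have eTx : T = {g, z, k, l} := by
        rw [hx.eq_sdiff (by rw [hA, hT, Finset.card_pair hef]), eA]
        clear hx hy ho hT hT' hP hP' hA eA eT eT' hd d
        simp at hnd'
        grind
      subst eTx
      rw [Finset.pair_comm g h] at hy
      rw [eA] at hx hy ho
      exact six_overlap hx hy ho hnd' yfz ykl ylk
    have hh' : h = e ∨ h = f := by
      rw [eT] at hhT
      have := sP' hh
      clear hx hy ho key
      simp at hhT
      grind
    rcases hh' with h1 | h1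
    · exact key hef h1 hx
    · exact key hef.symm h1 (by rwa [Finset.pair_comm])

lemma duo_step (hx : Desc A T (A \ T) p x) (hy : Desc A T' (A \ T') p y) (ho : Agree A x y)
    (hT : T.card = 4) (hT' : T'.card = 4) (hA : 7 ≤ A.card) (hTT : T ≠ T') :
    ∃ z a T₁, Reach 1 x z ∧ a ∈ A ∧ Desc (A.erase a) T₁ (A.erase a \ T₁) p z ∧
      Desc (A.erase a) T' (A.erase a \ T') p y ∧ Agree (A.erase a) z y ∧ T₁.card = 4 ∧
      (8 ≤ A.card → T₁ ≠ T') := by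
  obtain ⟨a, ha, haT'⟩ : ∃ a ∈ T, a ∉ T' := by
    by_contra! hc
    exact hTT (Finset.eq_of_subset_of_card_le hc (by omega))
  have hP : (A \ T).card + 4 = A.card := by
    rw [← hT]; exact Finset.card_sdiff_add_card_eq_card hx.sub
  have haA := hx.sub ha
  have hb := hx.edge a ha
  have hbA := hx.sub hb.1
  have key : ∃ g ∈ A \ T, ∃ k ∈ A \ T, g ≠ k ∧
      (8 ≤ A.card → (T \ {a, x.π a}) ∪ {g, k} ≠ T') := by
    by_cases h : ∃ g ∈ A \ T, g ∉ T'
    · obtain ⟨g, hg, hgT⟩ := h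
      obtain ⟨k, hk, hkg⟩ := Finset.exists_mem_ne (by omega : 1 < (A \ T).card) g
      refine ⟨g, hg, k, hk, hkg.symm, fun _ => ?_⟩
      rintro rfl
      simp at hgT
    · push Not at h
      obtain ⟨g, hg, k, hk, hgk⟩ := Finset.one_lt_card.1 (by omega : 1 < (A \ T).card)
      refine ⟨g, hg, k, hk, hgk, fun h8 h' => ?_⟩
      have h1 : A \ T = T' := Finset.eq_of_subset_of_card_le h (by omega)
      obtain ⟨c, hc⟩ : (T \ {a, x.π a}).Nonempty := by
        rw [← Finset.card_pos, Finset.card_sdiff_of_subset (by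
          simp [Finset.insert_subset_iff, ha, hb.1]), Finset.card_pair hb.2.symm]
        omega
      have h2 : c ∈ A \ T := by rw [h1, ← h']; exact Finset.mem_union_left _ hc
      exact (Finset.mem_sdiff.1 h2).2 (Finset.mem_sdiff.1 hc).1
  obtain ⟨g, hg, k, hk, hgk, h8⟩ := key
  obtain ⟨z, hl, hz, hzo, -, -⟩ := hx.exch_erase ho ha rfl hg hk hgk hy.full
    (hy.singP a (by simp [haA, haT']))
  have e1 : (A \ T) \ {g, k} ∪ {x.π a} = A.erase a \ (T \ {a, x.π a} ∪ {g, k}) := by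
    clear hx hy ho hz hzo h8 hP
    grind
  have e2 : (A \ T').erase a = A.erase a \ T' := by
    clear hx hy ho hz hzo h8 hP
    grind
  rw [e1] at hz
  refine ⟨z, a, _, reach_one.2 hl, haA, hz, e2 ▸ hy.erase haT', hzo, ?_, h8⟩
  rw [Finset.card_union_of_disjoint, Finset.card_sdiff_of_subset, Finset.card_pair hgk,
    Finset.card_pair hb.2.symm, hT]
  · simp [Finset.insert_subset_iff, ha, hb.1]
  · rw [Finset.disjoint_left]
    clear hx hy ho hz hzo h8 hP
    grind

lemma duo_ne (k : ℕ) : ∀ {A T T' : Finset (Fin n)} {p : ℤ} {x y : AffineWeylC n},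
    Desc A T (A \ T) p x → Desc A T' (A \ T') p y → Agree A x y → T.card = 4 → T'.card = 4 →
    A.card = k + 6 → (T ≠ T' ∨ k = 0) → Reach (k + 4) x y := by
  induction k with
  | zero =>
    intro A T T' p x y hx hy ho hT hT' hA _
    refine duo_six hx hy ho hT hT' ?_ ?_ hA
    · rw [Finset.card_sdiff_of_subset hx.sub]; omega
    · rw [Finset.card_sdiff_of_subset hy.sub]; omega
  | succ k ih =>
    intro A T T' p x y hx hy ho hT hT' hA hTT
    obtain ⟨z, a, T₁, hz, haA, hzD, hyD, hzo, hT₁, h8⟩ :=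
      duo_step hx hy ho hT hT' (by omega) (by simpa using hTT)
    have hAe := Finset.card_erase_of_mem haA
    refine (hz.trans (ih hzD hyD hzo hT₁ hT' (by omega) ?_)).mono (by omega)
    rcases Nat.eq_zero_or_pos k with h | h
    · exact .inr h
    · exact .inl (h8 (by omega))

lemma duo_any (hx : Desc A T (A \ T) p x) (hy : Desc A T' (A \ T') p y) (ho : Agree A x y)
    (hT : T.card = 4) (hT' : T'.card = 4) (hA : 6 ≤ A.card) : Reach (A.card - 1) x y := by
  obtain ⟨k, hk⟩ := Nat.exists_eq_add_of_le' hA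
  by_cases h : T ≠ T' ∨ k = 0
  · exact (duo_ne k hx hy ho hT hT' hk h).mono (by omega)
  push Not at h
  obtain ⟨rfl, h0⟩ := h
  have hP : (A \ T).card + 4 = A.card := by
    rw [← hT]; exact Finset.card_sdiff_add_card_eq_card hx.sub
  obtain ⟨g, hg, l, hl, hgl⟩ := Finset.one_lt_card.1 (by omega : 1 < (A \ T).card)
  obtain ⟨a, ha⟩ := Finset.card_pos.1 (by omega : 0 < T.card)
  have hb := hx.edge a ha
  have hS := hx.sub
  obtain ⟨z, hz, hzD, -, -, hs⟩ := hx.exch ha rfl hg hl hgl (hx.singP g hg).2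
  have e1 : (A \ T) \ {g, l} ∪ {a, x.π a} = A \ (T \ {a, x.π a} ∪ {g, l}) := by
    clear hx hy ho hs hP hzD
    grind
  rw [e1] at hzD
  have hzo : Agree A z y := fun i hi =>
    (hs i (by grind) (by grind) (by grind) (by grind)).symm.trans (ho i hi)
  have hT₁ : (T \ {a, x.π a} ∪ {g, l}).card = 4 := by
    rw [Finset.card_union_of_disjoint, Finset.card_sdiff_of_subset, Finset.card_pair hgl,
      Finset.card_pair hb.2.symm, hT]
    · simp [Finset.insert_subset_iff, ha, hb.1]
    · rw [Finset.disjoint_left]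
      clear hx hy ho hs hP hzD hzo
      grind
  refine ((reach_one.2 hz).trans (duo_ne k hzD hy hzo hT₁ hT' hk (.inl fun h => ?_))).mono
    (by omega)
  exact (Finset.mem_sdiff.1 hg).2 (h ▸ by simp)

lemma Desc.exch_two {a b e f c d : Fin n} (hx : Desc A {a, b, e, f} {c, d} p x)
    (hnd : [a, b, e, f, c, d].Nodup) (xab : x.π a = b) (xef : x.π e = f) :
    ∃ z, Reach 1 x z ∧ Desc A {c, d, e, f} {a, b} p z ∧ z.π c = d ∧ z.π e = f ∧
      ∀ y, Agree A x y → Agree A z y := by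
  have h1 := hx.sub
  have h2 := hx.subP
  simp only [List.nodup_cons, List.mem_cons, List.not_mem_nil, or_false, not_or,
    List.nodup_nil, not_false_eq_true, and_true] at hnd
  obtain ⟨z, hz, hzD, -, hcd, hs⟩ := hx.exch (a := a) (by simp) xab (g := c) (k := d) (by simp)
    (by simp) (by grind) (hx.singP c (by simp)).2
  rw [show ({a, b, e, f} : Finset (Fin n)) \ {a, b} ∪ {c, d} = {c, d, e, f} by
      clear hx hzD hs; grind,
    show ({c, d} : Finset (Fin n)) \ {c, d} ∪ {a, b} = {a, b} by clear hx hzD hs; grind] at hzD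
  refine ⟨z, reach_one.2 hz, hzD, hcd, ?_, fun y hy i hi => (hs i ?_ ?_ ?_ ?_).symm.trans (hy i hi)⟩
  · have := (hs e (by grind) (by grind) (by grind) (by grind)).1
    rw [← xef]
    exact this.symm
  all_goals
    clear hx hzD hs hy
    grind

lemma Desc.exch_two' {a b e f c d l o : Fin n} (hx : Desc A {a, b, e, f} {c, d} p x)
    (hnd : [a, b, e, f, c, d, l, o].Nodup) (hl : l ∈ A) (ho : o ∈ A) (xab : x.π a = b)
    (xef : x.π e = f) :
    ∃ z, Reach 1 x z ∧ Desc A {l, o, e, f} {c, d} p z ∧ z.π l = o ∧ z.π e = f ∧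
      ∀ y, Agree A x y → Agree A z y := by
  have h1 := hx.sub
  have h2 := hx.subP
  simp only [List.nodup_cons, List.mem_cons, List.not_mem_nil, or_false, not_or,
    List.nodup_nil, not_false_eq_true, and_true] at hnd
  have hlQ : l ∈ (A \ {a, b, e, f}) \ {c, d} := by clear hx; simp [hl]; grind
  obtain ⟨z, hz, hzD, -, hcd, hs⟩ := hx.swap.exch (a := a) (by simp) xab (g := l) (k := o) hlQ
    (by clear hx hlQ; simp [ho]; grind) (by grind) (hx.swap.singP l hlQ).2
  have hzD := hzD.swap
  rw [sub_sub_cancel, show ({a, b, e, f} : Finset (Fin n)) \ {a, b} ∪ {l, o} = {l, o, e, f} by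
      clear hx hzD hs; grind] at hzD
  rw [show (A \ {l, o, e, f}) \ (((A \ {a, b, e, f}) \ {c, d}) \ {l, o} ∪ {a, b}) = {c, d} by
      clear hx hzD hs; grind] at hzD
  refine ⟨z, reach_one.2 hz, hzD, hcd, ?_, fun y hy i hi => (hs i ?_ ?_ ?_ ?_).symm.trans (hy i hi)⟩
  · have := (hs e (by grind) (by grind) (by grind) (by grind)).1
    rw [← xef]
    exact this.symm
  all_goals
    clear hx hzD hs hy
    grind

lemma Desc.exch_par_label {a b e f c d l o : Fin n} (hx : Desc A {a, b, e, f} P p x)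
    (hnd : [a, b, e, f, c, d, l, o].Nodup) (hc : c ∈ P) (hd : d ∈ P) (hl : l ∈ A \ P) (ho : o ∈ A \ P)
    (xab : x.π a = b) (xef : x.π e = f) {α γ : ℤ} (hα : α % 2 = p) (hγ : γ % 2 = 1 - p) :
    ∃ z, Reach 1 x z ∧ Desc A {c, d, l, o} (P \ {c, d} ∪ {a, b}) p z ∧ z.π c = d ∧ z.π l = o ∧
      z.v a = α ∧ z.v e = γ ∧ ∀ y, Agree A x y → Agree A z y := by
  have h1 := hx.sub
  have h2 := hx.subP
  have h3 := hx.disj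
  simp only [Finset.mem_insert, Finset.mem_singleton, forall_eq_or_imp, forall_eq] at h3
  simp only [Finset.insert_subset_iff, Finset.singleton_subset_iff] at h1
  have h4 := h2 hc
  have h5 := h2 hd
  rw [Finset.mem_sdiff] at hl ho
  simp only [List.nodup_cons, List.mem_cons, List.not_mem_nil, or_false, not_or,
    List.nodup_nil, not_false_eq_true, and_true] at hnd
  have xc := hx.singP c hc
  have xd := hx.singP d hd
  have xl := hx.singQ l hl.1 (by clear hx; grind) hl.2
  have xo := hx.singQ o ho.1 (by clear hx; grind) ho.2
  obtain ⟨β, lam, hβ, -, -, m₁⟩ := Move.exch_left a b c d (x.s a) 1 (x.v b) (x.v c) (x.v d)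
    α (hα.trans xc.2.symm) (xd.2.trans xc.2.symm)
  obtain ⟨β', lam', hβ', -, -, m₂⟩ := Move.exch_left e f l o (x.s e) 1 (x.v f) (x.v l) (x.v o)
    γ (hγ.trans xl.2.symm) (xo.2.trans xl.2.symm)
  have m := m₁.par m₂
  clear m₁ m₂
  have hA : ∀ u ∈ pts (ed a b (x.s a) (x.v b) + sg c (x.v c) + sg d (x.v d)
      + (ed e f (x.s e) (x.v f) + sg l (x.v l) + sg o (x.v o))), u ∈ A := by
    clear hx m; simp; grind
  obtain ⟨z, hz, hzS, hzD, hs⟩ := hx.move m (T' := {c, d, l, o}) (P' := P \ {c, d} ∪ {a, b})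
    (by clear hx m; simp; grind)
    (by simp only [holds_add]
        exact ⟨⟨⟨hx.holds_ed xab, hx.holds_sg xc⟩, hx.holds_sg xd⟩,
          ⟨hx.holds_ed xef, hx.holds_sg xl⟩, hx.holds_sg xo⟩)
    hA (by clear hx m; simp; grind) (by clear hx m; simp; grind)
    (by
      have xc := xc.2
      have xl := xl.2
      clear m hA hx h2 xd xo h4 h5
      intro z hz
      simp only [holds_add, AffineWeylC.holds_ed, AffineWeylC.holds_sg] at hz
      simp only [pts_add, pts_ed, pts_sg, Sing]
      simp
      grind) (by clear hx m; grind) (by clear hx m; grind)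
  simp only [holds_add, AffineWeylC.holds_ed, AffineWeylC.holds_sg] at hzS
  exact ⟨z, hz, hzD, hzS.1.1.1.1, hzS.2.1.1.1, hzS.1.1.2.2.2, hzS.2.1.2.2.2, fun y hy => hy.of_frame hA hs⟩

lemma Desc.exch_par {a b e f c d l o : Fin n} (hx : Desc A {a, b, e, f} P p x)
    (hnd : [a, b, e, f, c, d, l, o].Nodup) (hc : c ∈ P) (hd : d ∈ P) (hl : l ∈ A \ P) (ho : o ∈ A \ P)
    (xab : x.π a = b) (xef : x.π e = f) :
    ∃ z, Reach 1 x z ∧ Desc A {c, d, l, o} (P \ {c, d} ∪ {a, b}) p z ∧ z.π c = d ∧ z.π l = o ∧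
      ∀ y, Agree A x y → Agree A z y := by
  have xc := hx.singP c hc
  obtain ⟨z, h1, h2, h3, h4, -, -, h5⟩ := hx.exch_par_label hnd hc hd hl ho xab xef
    (γ := 1 - x.v c) xc.2 (by have := xc.2; omega)
  exact ⟨z, h1, h2, h3, h4, h5⟩

/-- `x` can be moved, in three steps or in four steps avoiding the support `T'` of the edges, so
that the 1-cycles of colour `p` become `k` and `l`, with labels `κ` and `κ'`. -/
def Exits (A T' : Finset (Fin n)) (p : ℤ) (x : AffineWeylC n) (k l : Fin n) (κ κ' : ℤ) : Prop :=
  ∃ z T, Desc A T {k, l} p z ∧ z.v k = κ ∧ z.v l = κ' ∧ T.card = 4 ∧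
    (∀ y, Agree A x y → Agree A z y) ∧ (Reach 3 x z ∨ Reach 4 x z ∧ T ≠ T')

lemma Exits.symm {k l : Fin n} {κ κ' : ℤ} (h : Exits A T' p x k l κ κ') :
    Exits A T' p x l k κ' κ := by
  obtain ⟨z, T, h1, h2, h3, h4⟩ := h
  exact ⟨z, T, Finset.pair_comm k l ▸ h1, h3, h2, h4⟩

lemma Exits.reach {k l : Fin n} (h : Exits A T' p x k l (y.v k) (y.v l))
    (hy : Desc A T' {k, l} p y) (ho : Agree A x y) (hT' : T'.card = 4) (hkl : k ≠ l)
    (hA : 8 ≤ A.card) : Reach A.card x y := by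
  obtain ⟨z, T, hz, hk, hl, hT, hzo, hr⟩ := h
  have h1 := hy.subP
  obtain ⟨hzD, hyD, hzo⟩ := hz.restrict hy (hzo y ho) subset_rfl (Finset.disjoint_left.2 hz.disj)
    (Finset.disjoint_left.2 hy.disj) (by simp [hk, hl]) h1
  have h2 : (A \ {k, l}).card + 2 = A.card := by
    rw [← Finset.card_pair hkl]; exact Finset.card_sdiff_add_card_eq_card h1
  rcases hr with hr | ⟨hr, hTT⟩
  · exact (hr.trans (duo_any hzD hyD hzo hT hT' (by omega))).mono (by omega)
  · obtain ⟨j, hj⟩ := Nat.exists_eq_add_of_le' (show 6 ≤ (A \ {k, l}).card by omega)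
    exact (hr.trans (duo_ne j hzD hyD hzo hT hT' hj (.inl hTT))).mono (by omega)

section Exits

variable {a b e f c d k l j m u w : Fin n} {κ κ' : ℤ}

lemma exits_edge (hx : Desc A {k, l, e, f} {c, d} p x) (hnd : [k, l, e, f, c, d].Nodup)
    (xkl : x.π k = l) (xef : x.π e = f) (hκ : κ % 2 = p) (hκ' : κ' % 2 = p) :
    Exits A T' p x k l κ κ' := by
  obtain ⟨z, hz, hzD, h1, h2, h3⟩ := hx.exch_out hnd xkl xef hκ hκ'
  refine ⟨z, _, hzD, h1, h2, card_four ?_, h3, .inl (hz.mono (by omega))⟩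
  clear hx hzD
  simp at hnd ⊢
  grind

lemma exits_cross (hx : Desc A {k, j, l, m} {c, d} p x) (hnd : [k, j, l, m, c, d].Nodup)
    (xkj : x.π k = j) (xlm : x.π l = m) (hκ : κ % 2 = p) (hκ' : κ' % 2 = p) :
    Exits A T' p x k l κ κ' := by
  obtain ⟨z, hz, hzD, h1, h2, h3⟩ := hx.cross_exit hnd xkj xlm hκ hκ'
  refine ⟨z, _, hzD, h1, h2, card_four ?_, h3, .inl (hz.mono (by omega))⟩
  clear hx hzD
  simp at hnd ⊢
  grind

lemma exits_far (hx : Desc A {a, b, e, f} {c, d} p x) (hnd : [a, b, e, f, c, d, k, l].Nodup)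
    (hk : k ∈ A) (hl : l ∈ A) (xab : x.π a = b) (xef : x.π e = f) (hκ : κ % 2 = p)
    (hκ' : κ' % 2 = p) : Exits A T' p x k l κ κ' := by
  obtain ⟨y, hy, hyD, ykl, yef, hyo⟩ := hx.exch_two' hnd hk hl xab xef
  simp at hnd
  obtain ⟨z, hz, hzD, h1, h2, h3⟩ := hyD.exch_out (by clear hx hyD; simp; grind) ykl yef hκ hκ'
  refine ⟨z, _, hzD, h1, h2, card_four ?_, fun w hw => h3 w (hyo w hw),
    .inl ((hy.trans hz).mono (by omega))⟩
  clear hx hyD hzD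
  simp
  grind

lemma exits_same (hx : Desc A {a, b, e, f} {k, l} p x) (hnd : [a, b, e, f, k, l].Nodup)
    (xab : x.π a = b) (xef : x.π e = f) (hκ : κ % 2 = p)
    (hκ' : κ' % 2 = p) : Exits A T' p x k l κ κ' := by
  obtain ⟨y, hy, hyD, ykl, yef, hyo⟩ := hx.exch_two hnd xab xef
  simp at hnd
  obtain ⟨z, hz, hzD, h1, h2, h3⟩ := hyD.exch_out (by clear hx hyD; simp; grind) ykl yef hκ hκ'
  refine ⟨z, _, hzD, h1, h2, card_four ?_, fun w hw => h3 w (hyo w hw),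
    .inl ((hy.trans hz).mono (by omega))⟩
  clear hx hyD hzD
  simp
  grind

lemma exits_edge_far (hx : Desc A {e, f, k, b} {c, d} p x)
    (hnd : [e, f, k, b, c, d, l, m].Nodup) (hl : l ∈ A) (hm : m ∈ A) (xkb : x.π k = b)
    (xef : x.π e = f) (hκ : κ % 2 = p) (hκ' : κ' % 2 = p) : Exits A T' p x k l κ κ' := by
  obtain ⟨y, hy, hyD, ylm, ykb, hyo⟩ := hx.exch_two' hnd hl hm xef xkb
  simp at hnd
  obtain ⟨z, hz, hzD, h1, h2, h3⟩ := hyD.cross_exit (by clear hx hyD; simp; grind) ylm ykb hκ' hκ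
  refine Exits.symm ⟨z, _, hzD, h1, h2, card_four ?_, fun w hw => h3 w (hyo w hw),
    .inl ((hy.trans hz).mono (by omega))⟩
  clear hx hyD hzD
  simp
  grind

lemma exits_same_far (hx : Desc A {a, b, e, f} {k, d} p x)
    (hnd : [a, b, e, f, k, d, l, m].Nodup) (hl : l ∈ A \ {k, d}) (hm : m ∈ A \ {k, d})
    (xab : x.π a = b) (xef : x.π e = f) (hκ : κ % 2 = p) (hκ' : κ' % 2 = p) :
    Exits A T' p x k l κ κ' := by
  obtain ⟨y, hy, hyD, ykd, ylm, hyo⟩ := hx.exch_par hnd (by simp) (by simp) hl hm xab xef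
  rw [Finset.sdiff_self, Finset.empty_union] at hyD
  simp at hnd
  obtain ⟨z, hz, hzD, h1, h2, h3⟩ := hyD.cross_exit (by clear hx hyD; simp; grind) ykd ylm hκ hκ'
  refine ⟨z, _, hzD, h1, h2, card_four ?_, fun w hw => h3 w (hyo w hw),
    .inl ((hy.trans hz).mono (by omega))⟩
  clear hx hyD hzD
  simp
  grind

lemma exits_edge_same (hx : Desc A {l, b, e, f} {k, d} p x)
    (hnd : [l, b, e, f, k, d, u, w].Nodup) (hu : u ∈ A \ {k, d}) (hw : w ∈ A \ {k, d})
    (xlb : x.π l = b) (xef : x.π e = f) (hκ : κ % 2 = p) (hκ' : κ' % 2 = p) :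
    Exits A T' p x k l κ κ' := by
  by_cases hT : ({b, d, e, f} : Finset (Fin n)) = T'
  · obtain ⟨y, hy, hyD, ykd, yuw, hyo⟩ := hx.exch_par hnd (by simp) (by simp) hu hw xlb xef
    rw [Finset.sdiff_self, Finset.empty_union,
      show ({k, d, u, w} : Finset (Fin n)) = {u, w, k, d} by clear * -; grind] at hyD
    simp at hnd
    obtain ⟨z, hz, hzD, zlb, zkd, hzo⟩ := hyD.exch_two (by clear hx hyD; simp; grind) yuw ykd
    obtain ⟨z', hz', hzD', h1, h2, h3⟩ := hzD.cross_exit (by clear hx hyD hzD; simp; grind)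
      zlb zkd hκ' hκ
    refine Exits.symm ⟨z', _, hzD', h1, h2, card_four ?_, fun w hw => h3 w (hzo w (hyo w hw)),
      .inr ⟨((hy.trans hz).trans hz').mono (by omega), ?_⟩⟩
    · clear hx hyD hzD hzD'
      simp
      grind
    · intro h
      have he : e ∈ ({b, d, u, w} : Finset (Fin n)) := by rw [h, ← hT]; simp
      clear hx hyD hzD hzD'
      simp at he
      grind
  · obtain ⟨y, hy, hyD, ykd, yef, hyo⟩ := hx.exch_two
      (by clear hx; simp at hnd ⊢; grind) xlb xef
    rw [show ({k, d, e, f} : Finset (Fin n)) = {e, f, k, d} by clear * -; grind] at hyD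
    simp at hnd
    obtain ⟨z, hz, hzD, zlb, zkd, hzo⟩ := hyD.exch_two (by clear hx hyD; simp; grind) yef ykd
    obtain ⟨z', hz', hzD', h1, h2, h3⟩ := hzD.cross_exit (by clear hx hyD hzD; simp; grind)
      zlb zkd hκ' hκ
    refine Exits.symm ⟨z', _, hzD', h1, h2, card_four ?_, fun w hw => h3 w (hzo w (hyo w hw)),
      .inr ⟨((hy.trans hz).trans hz').mono (by omega), hT⟩⟩
    clear hx hyD hzD hzD'
    simp
    grind

end Exits

lemma Desc.nodup_six {a b e f c d : Fin n} (hx : Desc A {a, b, e, f} {c, d} p x)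
    (hnd : [a, b, e, f].Nodup) (hcd : c ≠ d) : [a, b, e, f, c, d].Nodup := by
  have hd := hx.disj
  simp only [Finset.mem_insert, Finset.mem_singleton, forall_eq_or_imp, forall_eq, not_or] at hd
  clear hx
  simp at hnd ⊢
  grind

lemma Desc.nodup_eight {a b e f c d u w : Fin n} (hx : Desc A {a, b, e, f} {c, d} p x)
    (hnd : [a, b, e, f].Nodup) (hcd : c ≠ d) (hu : u ∈ (A \ {a, b, e, f}) \ {c, d})
    (hw : w ∈ (A \ {a, b, e, f}) \ {c, d}) (huw : u ≠ w) :
    [a, b, e, f, c, d, u, w].Nodup := by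
  have h := hx.nodup_six hnd hcd
  clear hx
  simp at h hu hw ⊢
  grind

lemma exists_eq_pair (hP : P.card = 2) {k : Fin n} (hk : k ∈ P) : ∃ d, k ≠ d ∧ P = {k, d} := by
  obtain ⟨d, hd, hdk⟩ := Finset.exists_mem_ne (by omega : 1 < P.card) k
  refine ⟨d, hdk.symm, (Finset.eq_of_subset_of_card_le ?_ ?_).symm⟩
  · simp [Finset.insert_subset_iff, hk, hd]
  · rw [Finset.card_pair hdk.symm, hP]

/-- Two edges and two 1-cycles of colour `p`. -/
lemma two_edges_two (hx : Desc A T P p x) (hy : Desc A T' P' p y) (ho : Agree A x y)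
    (hT : T.card = 4) (hT' : T'.card = 4) (hP : P.card = 2) (hP' : P'.card = 2)
    (hA : 8 ≤ A.card) : Reach A.card x y := by
  obtain ⟨k, l, hkl, rfl⟩ := Finset.card_eq_two.1 hP'
  have yk := (hy.singP k (by simp)).2
  have yl := (hy.singP l (by simp)).2
  have kA := hy.subP (show k ∈ ({k, l} : Finset (Fin n)) by simp)
  have lA := hy.subP (show l ∈ ({k, l} : Finset (Fin n)) by simp)
  refine Exits.reach ?_ hy ho hT' hkl hA
  clear hy ho
  have hQ := hx.card_add
  have key : ∀ {k l : Fin n}, k ≠ l → k ∈ A → l ∈ A → y.v k % 2 = p → y.v l % 2 = p →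
      (k ∈ T ∨ k ∈ P ∧ l ∉ T ∨ (k ∉ T ∧ k ∉ P) ∧ l ∉ T ∧ l ∉ P) →
      Exits A T' p x k l (y.v k) (y.v l) := by
    clear hkl yk yl kA lA hP'
    intro k l hkl kA lA yk yl hcase
    have mQ : ∀ {i}, i ∈ A → i ∉ T → i ∉ P → i ∈ (A \ T) \ P := by
      simp +contextual
    have hQQ : ∀ {i}, i ∈ (A \ T) \ P → i ∈ A \ P := by
      clear hx; grind
    rcases hcase with hk | ⟨hk, hlT⟩ | ⟨⟨hkT, hkP⟩, hlT, hlP⟩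
    · obtain ⟨b, e, f, hnd, rfl, xkb, -, xef, xfe⟩ := hx.exists_two_edges hT hk
      by_cases hl : l ∈ ({k, b, e, f} : Finset (Fin n))
      · obtain ⟨c, d, hcd, rfl⟩ := Finset.card_eq_two.1 hP
        have hnd' := hx.nodup_six hnd hcd
        simp only [Finset.mem_insert, Finset.mem_singleton, hkl.symm, false_or] at hl
        rcases hl with rfl | rfl | rfl
        · exact exits_edge hx hnd' xkb xef yk yl
        · exact exits_cross hx hnd' xkb xef yk yl
        · rw [show ({k, b, e, l} : Finset (Fin n)) = {k, b, l, e} by clear * -; grind] at hx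
          exact exits_cross hx (by clear * - hnd'; simp at hnd' ⊢; grind) xkb xfe yk yl
      by_cases hlP : l ∈ P
      · obtain ⟨d, hld, rfl⟩ := exists_eq_pair hP hlP
        obtain ⟨u, hu, w, hw, huw⟩ := Finset.one_lt_card.1
          (by omega : 1 < ((A \ {k, b, e, f}) \ {l, d}).card)
        exact (exits_edge_same hx (hx.nodup_eight hnd hld hu hw huw) (hQQ hu) (hQQ hw) xkb xef
          yl yk).symm
      · obtain ⟨c, d, hcd, rfl⟩ := Finset.card_eq_two.1 hP
        have hlQ := mQ lA hl hlP
        obtain ⟨u, hu, hul⟩ := Finset.exists_mem_ne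
          (by omega : 1 < ((A \ {k, b, e, f}) \ {c, d}).card) l
        have hnd' := hx.nodup_eight hnd hcd hlQ hu hul.symm
        rw [show ({k, b, e, f} : Finset (Fin n)) = {e, f, k, b} by clear * -; grind] at hx
        exact exits_edge_far hx (by clear * - hnd'; simp at hnd' ⊢; grind) lA
          (Finset.mem_sdiff.1 (hQQ hu)).1 xkb xef yk yl
    · obtain ⟨a, ha⟩ := Finset.card_pos.1 (by omega : 0 < T.card)
      obtain ⟨b, e, f, hnd, rfl, xab, -, xef, -⟩ := hx.exists_two_edges hT ha
      obtain ⟨d, hkd, rfl⟩ := exists_eq_pair hP hk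
      by_cases hld : l = d
      · subst hld
        exact exits_same hx (hx.nodup_six hnd hkd) xab xef yk yl
      · have hlQ := mQ lA hlT (by simp [hld, hkl.symm])
        obtain ⟨u, hu, hul⟩ := Finset.exists_mem_ne
          (by omega : 1 < ((A \ {a, b, e, f}) \ {k, d}).card) l
        exact exits_same_far hx (hx.nodup_eight hnd hkd hlQ hu hul.symm) (hQQ hlQ) (hQQ hu) xab xef
          yk yl
    · obtain ⟨a, ha⟩ := Finset.card_pos.1 (by omega : 0 < T.card)
      obtain ⟨b, e, f, hnd, rfl, xab, -, xef, -⟩ := hx.exists_two_edges hT ha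
      obtain ⟨c, d, hcd, rfl⟩ := Finset.card_eq_two.1 hP
      exact exits_far hx (hx.nodup_eight hnd hcd (mQ kA hkT hkP) (mQ lA hlT hlP) hkl) kA lA xab xef
        yk yl
  have hd := hx.disj
  by_cases hkT : k ∈ T
  · exact key hkl kA lA yk yl (.inl hkT)
  by_cases hlT : l ∈ T
  · exact (key hkl.symm lA kA yl yk (.inl hlT)).symm
  by_cases hkP : k ∈ P
  · exact key hkl kA lA yk yl (.inr (.inl ⟨hkP, hlT⟩))
  by_cases hlP : l ∈ P
  · exact (key hkl.symm lA kA yl yk (.inr (.inl ⟨hlP, hkT⟩))).symm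
  · exact key hkl kA lA yk yl (.inr (.inr ⟨⟨hkT, hkP⟩, hlT, hlP⟩))

lemma Agree.erase {a : Fin n} (h : Agree A x y) (ha : SameAt x y a) : Agree (A.erase a) x y :=
  fun i hi => by
    by_cases e : i = a
    · exact e ▸ ha
    · exact h i fun hA => hi (Finset.mem_erase.2 ⟨e, hA⟩)

lemma Full.sameAt_of_sing {q q' : ℤ} {i : Fin n} (hx : Full x) (hy : Full y) (h : Sing x q i)
    (h' : Sing y q' i) (hv : x.v i = y.v i) : SameAt x y i :=
  ⟨h.1.trans h'.1.symm, (hx.neg i h.1).trans (hy.neg i h'.1).symm, hv⟩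

lemma Desc.nodup_parallel {a b e f c d l o : Fin n} (hx : Desc A {a, b, e, f} P p x)
    (hnd : [a, b, e, f].Nodup) (hc : c ∈ P) (hd : d ∈ P) (hcd : c ≠ d)
    (hl : l ∈ (A \ {a, b, e, f}) \ P) (ho : o ∈ (A \ {a, b, e, f}) \ P) (hlo : l ≠ o) :
    [a, b, e, f, c, d, l, o].Nodup := by
  have hj := hx.disj
  clear hx
  simp only [Finset.mem_insert, Finset.mem_singleton, forall_eq_or_imp, forall_eq] at hj
  simp at hnd hl ho ⊢
  and_intros <;> grind

lemma Desc.card_exch_erase {a b g k : Fin n} (h : Desc A T P p x) (ha : a ∈ T) (hab : x.π a = b)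
    (hg : g ∈ P) (hk : k ∈ P) (hgk : g ≠ k) :
    ((T \ {a, b}) ∪ {g, k}).card = T.card ∧ ((P \ {g, k}) ∪ {b}).card + 1 = P.card := by
  have hb := h.edge a ha
  rw [hab] at hb
  have hj := h.disj
  constructor
  · rw [Finset.card_union_of_disjoint, Finset.card_sdiff_of_subset, Finset.card_pair hgk,
      Finset.card_pair hb.2.symm]
    · have := Finset.card_le_card (show {a, b} ⊆ T by grind)
      rw [Finset.card_pair hb.2.symm] at this
      omega
    · grind
    · rw [Finset.disjoint_left]; grind
  · have hs : {g, k} ⊆ P := by grind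
    rw [Finset.card_union_of_disjoint, Finset.card_sdiff_of_subset hs, Finset.card_pair hgk,
      Finset.card_singleton]
    · have := Finset.card_le_card hs
      rw [Finset.card_pair hgk] at this
      omega
    · rw [Finset.disjoint_left]; grind

/-- The bound `M` for elements with two edges and at least two 1-cycles of each colour, all of them
in a set of size `M`. -/
def TwoEdgesReach (n M : ℕ) : Prop :=
  ∀ ⦃A T P T' P' : Finset (Fin n)⦄ ⦃p : ℤ⦄ ⦃x y : AffineWeylC n⦄, Desc A T P p x →
    Desc A T' P' p y → Agree A x y → A.card = M → T.card = 4 → T'.card = 4 → P.card = P'.card →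
    2 ≤ P.card → P.card + 6 ≤ M → Reach M x y

lemma two_edges_ne {M : ℕ} (ih : TwoEdgesReach n M) (hx : Desc A T P p x) (hy : Desc A T' P' p y)
    (ho : Agree A x y) (hA : A.card = M + 1) (hT : T.card = 4) (hT' : T'.card = 4)
    (hPP : P.card = P'.card) (hP : 3 ≤ P.card) (hPA : P.card + 6 ≤ M + 1)
    {a : Fin n} (ha : a ∈ T) (ha' : a ∈ P') : Reach (M + 1) x y := by
  obtain ⟨g, hg, k, hk, hgk⟩ := Finset.one_lt_card.1 (by omega : 1 < P.card)
  obtain ⟨z, h1, h2, h3, -, -⟩ := hx.exch_erase ho ha rfl hg hk hgk hy.full (hy.singP a ha')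
  have hc := hx.card_exch_erase ha rfl hg hk hgk
  have hy' := hy.erase (a := a) fun h => hy.disj a h ha'
  have hc' := Finset.card_erase_of_mem ha'
  have hcA := Finset.card_erase_of_mem (hx.sub ha)
  exact ((reach_one.2 h1).trans (ih h2 hy' h3 (by omega) (by omega) hT' (by omega) (by omega)
    (by omega))).mono (by omega)

lemma two_edges_drop {M : ℕ} {w : AffineWeylC n} {c l : Fin n} (ih : TwoEdgesReach n M)
    (hw : Desc A T P p w) (hy : Desc A T P' p y) (ho : Agree A w y) (hA : A.card = M + 2)
    (hT : T.card = 4) (hPP : P.card = P'.card) (hP : 3 ≤ P.card) (hPA : P.card + 7 ≤ M + 2)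
    (hc : c ∈ P) (hc' : c ∈ P') (hl : l ∈ A) (hlT : l ∉ T) (hlP : l ∉ P) (hlP' : l ∉ P')
    (wc : w.v c = y.v c) (wl : w.v l = y.v l) : Reach M w y := by
  have hcT : c ∉ T := fun h => hw.disj c h hc
  have o1 := ho.erase (hw.full.sameAt_of_sing hy.full (hw.singP c hc) (hy.singP c hc') wc)
  have o2 := o1.erase (hw.full.sameAt_of_sing hy.full (hw.singQ l hl hlT hlP)
    (hy.singQ l hl hlT hlP') wl)
  have hlc : l ∉ P.erase c := fun h => hlP (Finset.mem_of_mem_erase h)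
  have hlc' : l ∉ P'.erase c := fun h => hlP' (Finset.mem_of_mem_erase h)
  have hcA := Finset.card_erase_of_mem (hw.subP hc)
  have hlA := Finset.card_erase_of_mem
    (Finset.mem_erase.2 ⟨fun e => hlP (e ▸ hc), hl⟩ : l ∈ A.erase c)
  have hcP := Finset.card_erase_of_mem hc
  have hcP' := Finset.card_erase_of_mem hc'
  have d1 := (hw.erase hcT).erase hlT
  have d2 := (hy.erase hcT).erase hlT
  rw [Finset.erase_eq_of_notMem hlc] at d1
  rw [Finset.erase_eq_of_notMem hlc'] at d2
  exact ih d1 d2 o2 (by omega) hT hT (by omega) (by omega) (by omega)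

/-- Two edges at the same place: leave on parallel edges, return to correct two labels. -/
lemma two_edges_eq {M : ℕ} (ih : TwoEdgesReach n M) (hx : Desc A T P p x) (hy : Desc A T P' p y)
    (ho : Agree A x y) (hA : A.card = M + 2) (hT : T.card = 4)
    (hPP : P.card = P'.card) (hP : 3 ≤ P.card) (hPA : P.card + 7 ≤ M + 2) :
    Reach (M + 2) x y := by
  obtain ⟨a, ha⟩ := Finset.card_pos.1 (by omega : 0 < T.card)
  obtain ⟨b, e, f, hnd, rfl, xab, -, xef, -⟩ := hx.exists_two_edges hT ha
  have hQ := hx.card_add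
  have hdx := hx.disj
  have hdy := hy.disj
  have hsub := hx.sub
  simp only [Finset.mem_insert, Finset.mem_singleton, forall_eq_or_imp, forall_eq] at hdx hdy
  simp only [Finset.insert_subset_iff, Finset.singleton_subset_iff] at hsub
  suffices ∃ w P₁ c l, Reach 2 x w ∧ Desc A {a, b, e, f} P₁ p w ∧ Agree A w y ∧
      P₁.card = P.card ∧ c ∈ P₁ ∧ c ∈ P' ∧ l ∈ A ∧ l ∉ ({a, b, e, f} : Finset (Fin n)) ∧ l ∉ P₁ ∧
      l ∉ P' ∧ w.v c = y.v c ∧ w.v l = y.v l by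
    obtain ⟨w, P₁, c, l, h1, h2, h3, h4, h5, h6, h7, h8, h9, h10, h11, h12⟩ := this
    exact (h1.trans (two_edges_drop ih h2 hy h3 hA hT (by omega) (by omega) (by omega) h5 h6 h7 h8
      h9 h10 h11 h12)).mono (by omega)
  by_cases hPe : P = P'
  · subst hPe
    obtain ⟨c, hc, d, hd, hcd⟩ := Finset.one_lt_card.1 (by omega : 1 < P.card)
    obtain ⟨l, hl, o, hlo, hlo'⟩ := Finset.one_lt_card.1
      (by omega : 1 < ((A \ {a, b, e, f}) \ P).card)
    have hn := hx.nodup_parallel hnd hc hd hcd hl hlo hlo'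
    have hl' := hl
    simp only [Finset.mem_sdiff] at hl hlo
    obtain ⟨z, h1, h2, h3, h4, h5⟩ := hx.exch_par hn hc hd (by grind) (by grind) xab xef
    obtain ⟨w, g1, g2, -, -, g5, g6, g7⟩ := h2.exch_par_label (a := c) (b := d) (e := l) (f := o)
      (c := a) (d := b) (l := e) (o := f) (α := y.v c) (γ := y.v l)
      (by clear * - hn; simp at hn ⊢; grind) (by simp) (by simp)
      (by clear * - hn hdx hsub; simp at hn ⊢; grind)
      (by clear * - hn hdx hsub; simp at hn ⊢; grind) h3 h4 (hy.singP c hc).2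
      (hy.singQ l hl.1.1 hl.1.2 hl.2).2
    rw [show (P \ {c, d} ∪ {a, b}) \ {a, b} ∪ {c, d} = P by
      clear * - hc hd hdx; grind] at g2
    exact ⟨w, P, c, l, (h1.trans g1).mono (by omega), g2, g7 y (h5 y ho), rfl, hc, hc, hl.1.1,
      hl.1.2, hl.2, hl.2, g5, g6⟩
  · obtain ⟨c, hc, hc'⟩ := Finset.not_subset.1
      fun h => hPe (Finset.eq_of_subset_of_card_le h (by omega))
    obtain ⟨l, hl, hl'⟩ := Finset.not_subset.1
      fun h => hPe (Finset.eq_of_subset_of_card_le h (by omega)).symm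
    have hlA := hy.subP hl
    have hlT : l ∉ ({a, b, e, f} : Finset (Fin n)) := fun h => hy.disj l h hl
    have hcT : c ∉ ({a, b, e, f} : Finset (Fin n)) := fun h => hx.disj c h hc
    obtain ⟨d, hd, hdc⟩ := Finset.exists_mem_ne (by omega : 1 < P.card) c
    obtain ⟨o, hlo, hlo'⟩ := Finset.exists_mem_ne
      (by omega : 1 < ((A \ {a, b, e, f}) \ P).card) l
    have hn := hx.nodup_parallel hnd hc hd hdc.symm (l := l) (by simp_all) hlo hlo'.symm
    simp only [Finset.mem_sdiff] at hlo
    obtain ⟨z, h1, h2, h3, h4, h5⟩ := hx.exch_par hn hc hd (by grind) (by grind) xab xef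
    rw [show ({c, d, l, o} : Finset (Fin n)) = {l, o, c, d} by clear * -; grind] at h2
    obtain ⟨w, g1, g2, -, -, g5, g6, g7⟩ := h2.exch_par_label (a := l) (b := o) (e := c) (f := d)
      (c := a) (d := b) (l := e) (o := f) (α := y.v l) (γ := y.v c)
      (by clear * - hn; simp at hn ⊢; grind) (by simp) (by simp)
      (by clear * - hn hdx hsub; simp at hn ⊢; grind)
      (by clear * - hn hdx hsub; simp at hn ⊢; grind) h4 h3 (hy.singP l hl).2
      (hy.singQ c (hx.subP hc) hcT hc').2
    have hcdP : {c, d} ⊆ P := by simp [Finset.insert_subset_iff, hc, hd]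
    have hcP := Finset.card_le_card hcdP
    rw [Finset.card_pair hdc.symm] at hcP
    rw [show (P \ {c, d} ∪ {a, b}) \ {a, b} ∪ {l, o} = P \ {c, d} ∪ {l, o} by
      clear * - hdx; grind] at g2
    refine ⟨w, _, l, c, (h1.trans g1).mono (by omega), g2, g7 y (h5 y ho), ?_, by simp, hl,
      hx.subP hc, hcT, ?_, hc', g5, g6⟩
    · rw [Finset.card_union_of_disjoint (by
          rw [Finset.disjoint_left]; clear * - hlo hl'; simp; grind),
        Finset.card_sdiff_of_subset hcdP, Finset.card_pair hdc.symm, Finset.card_pair hlo'.symm]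
      omega
    · clear * - hc hlo hl'; simp; grind

lemma twoEdgesReach (M : ℕ) : TwoEdgesReach n M := by
  induction M using Nat.strong_induction_on with
  | _ M ih =>
    intro A T P T' P' p x y hx hy ho hA hT hT' hPP hP hPA
    have hQ := hx.card_add
    have hQ' := hy.card_add
    by_cases h2 : P.card = 2
    · exact hA ▸ two_edges_two hx hy ho hT hT' h2 (by omega) (by omega)
    by_cases h3 : ((A \ T) \ P).card = 2
    · exact hA ▸ two_edges_two hx.swap hy.swap ho hT hT' h3 (by omega) (by omega)
    by_cases hTT : T = T'
    · subst hTT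
      obtain ⟨N, rfl⟩ := Nat.exists_eq_add_of_le' (show 2 ≤ M by omega)
      exact two_edges_eq (ih N (by omega)) hx hy ho hA hT hPP (by omega) (by omega)
    · obtain ⟨a, ha, ha'⟩ := Finset.not_subset.1
        fun h => hTT (Finset.eq_of_subset_of_card_le h (by omega))
      obtain ⟨N, rfl⟩ := Nat.exists_eq_add_of_le' (show 1 ≤ M by omega)
      by_cases haP : a ∈ P'
      · exact two_edges_ne (ih N (by omega)) hx hy ho hA hT hT' hPP (by omega) (by omega) ha haP
      · exact two_edges_ne (ih N (by omega)) hx.swap hy.swap ho hA hT hT' (by omega) (by omega)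
          (by omega) ha (by have := hx.sub ha; simp_all)

open Classical in
lemma Full.desc (hx : Full x) (hA : ∀ i ∈ A, x.π i ∈ A) (hp : p = 0 ∨ p = 1) :
    Desc A (A.filter fun i => x.π i ≠ i) (A.filter (Sing x p)) p x where
  full := hx
  sub := Finset.filter_subset _ _
  subP := Finset.filter_subset _ _
  disj i hi hi' := (Finset.mem_filter.1 hi).2 (Finset.mem_filter.1 hi').2.1
  edge i hi := by
    rw [Finset.mem_filter] at hi
    refine ⟨Finset.mem_filter.2 ⟨hA i hi.1, ?_⟩, hi.2⟩
    rw [hx.invol]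
    exact hi.2.symm
  singP i hi := (Finset.mem_filter.1 hi).2
  singQ i hi hT hP := by
    simp only [Finset.mem_filter, hi, true_and, not_not, Sing] at hT hP ⊢
    refine ⟨hT, ?_⟩
    have := fun h => hP ⟨hT, h⟩
    omega

open Classical in
lemma Desc.filter_sing (hx : Desc A T P p x) : A.filter (Sing x p) = P := by
  ext i
  rw [Finset.mem_filter]
  refine ⟨fun h => ?_, fun h => ⟨hx.subP h, hx.singP i h⟩⟩
  by_contra hP
  have h1 := hx.singQ i h.1 (fun hT => (hx.edge i hT).2 h.2.1) hP
  have := h.2.2.symm.trans h1.2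
  omega

open Classical in
lemma card_filter_sing_of_agree {z : AffineWeylC n} (hx : Full x) (hz : IsConj x z)
    (ho : Agree A x z) (q : ℤ) : (A.filter (Sing z q)).card = (A.filter (Sing x q)).card := by
  have h := card_sing_of_isConj hx hz q
  have h1 : (Finset.univ \ A).filter (Sing z q) = (Finset.univ \ A).filter (Sing x q) := by
    refine Finset.filter_congr fun i hi => ?_
    have := ho i (by simpa using hi)
    rw [Sing, Sing, this.1, this.2.2]
  rw [← Finset.union_sdiff_of_subset (Finset.subset_univ A), Finset.filter_union,
    Finset.filter_union, Finset.card_union_of_disjoint, Finset.card_union_of_disjoint, h1] at h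
  · omega
  all_goals exact Finset.disjoint_filter_filter Finset.disjoint_sdiff

lemma Desc.map_mem (hx : Desc A T P p x) {i : Fin n} (hi : i ∈ A) : x.π i ∈ A := by
  by_cases hT : i ∈ T
  · exact hx.sub (hx.edge i hT).1
  by_cases hP : i ∈ P
  · rwa [(hx.singP i hP).1]
  · rwa [(hx.singQ i hi hT hP).1]

/-- Moves inside `A` preserve the numbers of points of the three kinds. -/
lemma Desc.exists_of_move (hx : Desc A T P p x) (hp : p = 0 ∨ p = 1) {N : ℕ}
    {S S' : Multiset (Cyc n)} (m : Move N S S') (hd : (pts S).Nodup) (hS : Holds x S)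
    (hA : ∀ i ∈ pts S, i ∈ A) :
    ∃ z T' P', Reach N x z ∧ Holds z S' ∧ Desc A T' P' p z ∧ T'.card = T.card ∧
      P'.card = P.card ∧ ∀ y, Agree A x y → Agree A z y := by
  classical
  obtain ⟨z, h1, h2, h3⟩ := m.2 x hd hS
  have ho : Agree A x z := fun i hi => h3 i fun h => hi (hA i h)
  have hz := hx.full.of_isConj h1.isConj
  have hzA : ∀ i ∈ A, z.π i ∈ A := by
    intro i hi
    by_contra hn
    have := (ho _ hn).1
    rw [hz.invol] at this
    have h5 := hx.full.invol (z.π i)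
    rw [this] at h5
    exact hn (h5 ▸ hx.map_mem hi)
  have hD := hz.desc hzA hp
  have e1 := card_filter_sing_of_agree hx.full h1.isConj ho p
  have e2 := card_filter_sing_of_agree hx.full h1.isConj ho (1 - p)
  rw [hx.filter_sing] at e1
  rw [hx.swap.filter_sing, hD.swap.filter_sing] at e2
  have e3 := hx.card_add
  have e4 := hD.card_add
  exact ⟨z, _, _, h1, h2, hD, by omega, e1, fun y hy i hi => (ho i hi).symm.trans (hy i hi)⟩

lemma Desc.erase_edge {a b : Fin n} (hx : Desc A T P p x) (ha : a ∈ T) (hab : x.π a = b) :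
    Desc (A \ {a, b}) (T \ {a, b}) P p x := by
  have hb := hx.edge a ha
  have hba := hx.full.invol a
  rw [hab] at hb hba
  refine ⟨hx.full, Finset.sdiff_subset_sdiff hx.sub subset_rfl, fun i hi => ?_, fun i hi => ?_,
    fun i hi => ?_, hx.singP, fun i hi hT hP => ?_⟩
  · simp only [Finset.mem_sdiff, Finset.mem_insert, Finset.mem_singleton]
    refine ⟨hx.subP hi, ?_⟩
    rintro (rfl | rfl)
    exacts [hx.disj _ ha hi, hx.disj _ hb.1 hi]
  · exact hx.disj i (Finset.mem_sdiff.1 hi).1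
  · have h1 := hx.edge i (Finset.mem_sdiff.1 hi).1
    have h2 := hx.full.invol i
    clear hx
    simp only [Finset.mem_sdiff, Finset.mem_insert, Finset.mem_singleton] at hi ⊢
    grind
  · simp only [Finset.mem_sdiff] at hi hT
    exact hx.singQ i hi.1 (fun h => hT ⟨h, hi.2⟩) hP

lemma Agree.sdiff_edge {a b : Fin n} {t : ℤˣ} {e : ℤ} (ho : Agree A x y)
    (hx : Holds x (ed a b t e)) (hy : Holds y (ed a b t e)) : Agree (A \ {a, b}) x y := by
  rw [holds_ed] at hx hy
  obtain ⟨h1, h2, h3, h4, h5, h6⟩ := hx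
  obtain ⟨k1, k2, k3, k4, k5, k6⟩ := hy
  intro i hi
  by_cases ha : i = a
  · subst ha
    exact ⟨h1.trans k1.symm, h3.trans k3.symm, h6.trans k6.symm⟩
  by_cases hb : i = b
  · subst hb
    exact ⟨h2.trans k2.symm, h4.trans k4.symm, h5.trans k5.symm⟩
  exact ho i fun h => hi (by simp [h, ha, hb])

lemma Desc.exists_partner (hx : Desc A T P p x) (hP : 2 ≤ P.card) (hQ : 2 ≤ ((A \ T) \ P).card)
    {b : Fin n} (hb : b ∈ A) (hbT : b ∉ T) :
    ∃ q b', b ≠ b' ∧ b' ∈ A ∧ b' ∉ T ∧ Sing x q b ∧ Sing x q b' := by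
  by_cases hbP : b ∈ P
  · obtain ⟨c, hc, hcb⟩ := Finset.exists_mem_ne (by omega : 1 < P.card) b
    exact ⟨p, c, hcb.symm, hx.subP hc, fun h => hx.disj c h hc, hx.singP b hbP, hx.singP c hc⟩
  · obtain ⟨c, hc, hcb⟩ := Finset.exists_mem_ne (by omega : 1 < ((A \ T) \ P).card) b
    simp only [Finset.mem_sdiff] at hc
    exact ⟨1 - p, c, hcb.symm, hc.1.1, hc.1.2, hx.singQ b hb hbT hbP,
      hx.singQ c hc.1.1 hc.1.2 hc.2⟩

/-- The edge `{a, b}` with prescribed sign and label can be created in two steps inside `A`. -/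
def Matches (A : Finset (Fin n)) (x : AffineWeylC n) (a b : Fin n) (t : ℤˣ) (e : ℤ) : Prop :=
  ∃ S S', (pts S).Nodup ∧ Holds x S ∧ (∀ i ∈ pts S, i ∈ A) ∧ Move 2 S (ed a b t e + S')

lemma Matches.symm {a b : Fin n} {t : ℤˣ} {e : ℤ} (h : Matches A x a b t e) :
    Matches A x b a t (-(t : ℤ) * e) := by
  obtain ⟨S, S', h1, h2, h3, h4⟩ := h
  exact ⟨S, S', h1, h2, h3, h4.trans ((Move.edge_symm a b t e).frame S') rfl⟩

lemma Desc.matches_same (hx : Desc A T P p x) {a b : Fin n} (ha : a ∈ T) (hab : x.π a = b)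
    (t : ℤˣ) (e : ℤ) : Matches A x a b t e := by
  obtain ⟨_, _, h1, h2⟩ := Move.edge_two a b (x.s a) t (x.v b) e
  have hb := hx.edge a ha
  rw [hab] at hb
  refine ⟨_, 0, ?_, hx.holds_ed hab, ?_, (h1.trans h2 rfl).of_eq rfl (add_zero _).symm⟩
  · simp [hb.2.symm]
  · simp [hx.sub ha, hx.sub hb.1]

lemma Desc.matches_cross (hx : Desc A T P p x) {a b : Fin n} (ha : a ∈ T) (hb : b ∈ T)
    (hne : a ≠ b) (hab : x.π a ≠ b) (t : ℤˣ) (e : ℤ) : Matches A x a b t e := by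
  have h1 := hx.edge a ha
  have h2 := hx.edge b hb
  have h3 := hx.full.invol a
  have h4 := hx.full.invol b
  refine ⟨_, _, ?_, (holds_add _ _ _).2 ⟨hx.holds_ed rfl, hx.holds_ed rfl⟩, ?_,
    Move.cross_two a (x.π a) b (x.π b) _ _ t 1 _ _ e 0⟩
  · clear hx; simp; grind
  · simp [hx.sub ha, hx.sub hb, hx.sub h1.1, hx.sub h2.1]

lemma Desc.matches_exch (hx : Desc A T P p x) (hT : T.Nonempty) {a b : Fin n} {q : ℤ}
    (ha : a ∈ A) (hb : b ∈ A) (haT : a ∉ T) (hbT : b ∉ T) (hne : a ≠ b) (sa : Sing x q a)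
    (sb : Sing x q b) (t : ℤˣ) (e : ℤ) : Matches A x a b t e := by
  obtain ⟨i, hi⟩ := hT
  have h1 := hx.edge i hi
  refine ⟨_, _, ?_, (holds_add _ _ _).2 ⟨(holds_add _ _ _).2 ⟨hx.holds_ed rfl, hx.holds_sg sa⟩,
    hx.holds_sg sb⟩, ?_, (Move.exch_edge i (x.π i) a b _ t _ e _ _ (x.v a) _ rfl rfl
      (sb.2.trans sa.2.symm)).of_eq rfl (add_assoc _ _ _)⟩
  · clear hx; simp; grind
  · simp [hx.sub hi, hx.sub h1.1, ha, hb]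

lemma Desc.exists_other_edge (hx : Desc A T P p x) (hT : 4 ≤ T.card) {a : Fin n} (ha : a ∈ T) :
    ∃ d ∈ T, d ≠ a ∧ d ≠ x.π a := by
  have h1 := hx.edge a ha
  obtain ⟨d, hd⟩ : (T \ {a, x.π a}).Nonempty := by
    rw [← Finset.card_pos, Finset.card_sdiff_of_subset (by
      simp [Finset.insert_subset_iff, ha, h1.1]), Finset.card_pair h1.2.symm]
    omega
  simp only [Finset.mem_sdiff, Finset.mem_insert, Finset.mem_singleton, not_or] at hd
  exact ⟨d, hd⟩

lemma Desc.matches_half (hx : Desc A T P p x) (hT : 4 ≤ T.card) {a b b' : Fin n} {q : ℤ}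
    (ha : a ∈ T) (hb : b ∈ A) (hb' : b' ∈ A) (hbT : b ∉ T) (hbT' : b' ∉ T) (hne : b ≠ b')
    (sb : Sing x q b) (sb' : Sing x q b') (t : ℤˣ) (e : ℤ) : Matches A x a b t e := by
  obtain ⟨d, hd, hda, hdc⟩ := hx.exists_other_edge hT ha
  have h1 := hx.edge a ha
  have h2 := hx.edge d hd
  have h3 := hx.full.invol a
  have h4 := hx.full.invol d
  obtain ⟨β, lam, -, -, -, m1⟩ := Move.exch_left d (x.π d) b b' (x.s d) 1 (x.v (x.π d)) (x.v b)
    (x.v b') (x.v b) rfl (sb'.2.trans sb.2.symm)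
  refine ⟨_, _, ?_, (holds_add _ _ _).2 ⟨(holds_add _ _ _).2 ⟨(holds_add _ _ _).2
    ⟨hx.holds_ed rfl, hx.holds_sg sb⟩, hx.holds_sg sb'⟩, hx.holds_ed (a := a) rfl⟩, ?_,
    ((m1.frame (ed a (x.π a) (x.s a) (x.v (x.π a)))).trans
      ((Move.cross a (x.π a) b b' (x.s a) 1 t _ (x.v (x.π a)) lam e _ rfl rfl).frame
        (sg d (x.v b) + sg (x.π d) β)) (by abel)).of_eq rfl (add_assoc _ _ _)⟩
  · clear hx m1; simp; grind
  · simp [hx.sub ha, hx.sub h1.1, hx.sub hd, hx.sub h2.1, hb, hb']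

lemma Desc.matches_par (hx : Desc A T P p x) (hT : 4 ≤ T.card) {a a' b b' : Fin n} {q r : ℤ}
    (ha : a ∈ A) (ha' : a' ∈ A) (haT : a ∉ T) (haT' : a' ∉ T) (hne : a ≠ a') (sa : Sing x q a)
    (sa' : Sing x q a') (hb : b ∈ A) (hb' : b' ∈ A) (hbT : b ∉ T) (hbT' : b' ∉ T) (hne' : b ≠ b')
    (sb : Sing x r b) (sb' : Sing x r b') (hqr : q ≠ r) (t : ℤˣ) (e : ℤ) :
    Matches A x a b t e := by
  obtain ⟨i, hi⟩ := Finset.card_pos.1 (by omega : 0 < T.card)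
  obtain ⟨d, hd, hda, hdc⟩ := hx.exists_other_edge hT hi
  have h1 := hx.edge i hi
  have h2 := hx.edge d hd
  have h3 := hx.full.invol i
  have h4 := hx.full.invol d
  obtain ⟨β, lam, -, -, -, m1⟩ := Move.exch_left d (x.π d) b b' (x.s d) 1 (x.v (x.π d)) (x.v b)
    (x.v b') (x.v b) rfl (sb'.2.trans sb.2.symm)
  obtain ⟨β', lam', -, -, -, m2⟩ := Move.exch_left i (x.π i) a a' (x.s i) 1 (x.v (x.π i)) (x.v a)
    (x.v a') (x.v a) rfl (sa'.2.trans sa.2.symm)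
  have hab : ∀ {u v}, Sing x q u → Sing x r v → u ≠ v := by
    rintro u v hu hv rfl
    exact hqr (hu.2.symm.trans hv.2)
  have e1 := hab sa sb
  have e2 := hab sa sb'
  have e3 := hab sa' sb
  have e4 := hab sa' sb'
  refine ⟨_, _, ?_, (holds_add _ _ _).2 ⟨(holds_add _ _ _).2 ⟨(holds_add _ _ _).2
    ⟨hx.holds_ed rfl, hx.holds_sg sa⟩, hx.holds_sg sa'⟩, (holds_add _ _ _).2 ⟨(holds_add _ _ _).2
    ⟨hx.holds_ed rfl, hx.holds_sg sb⟩, hx.holds_sg sb'⟩⟩, ?_,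
    ((m2.par m1).trans
      ((Move.cross a a' b b' 1 1 t _ lam' lam e _ rfl rfl).frame
        (sg d (x.v b) + sg (x.π d) β + (sg i (x.v a) + sg (x.π i) β'))) (by abel)).of_eq rfl
        (add_assoc _ _ _)⟩
  · clear hx m1 m2 hab sa sa' sb sb'; simp; and_intros <;> grind
  · simp [hx.sub hi, hx.sub h1.1, hx.sub hd, hx.sub h2.1, hb, hb', ha, ha']

lemma Desc.matches (hx : Desc A T P p x) (hT : 4 ≤ T.card) (hP : 2 ≤ P.card)
    (hQ : 2 ≤ ((A \ T) \ P).card) {a b : Fin n} (ha : a ∈ A) (hb : b ∈ A) (hne : a ≠ b)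
    (t : ℤˣ) (e : ℤ) : Matches A x a b t e := by
  by_cases haT : a ∈ T <;> by_cases hbT : b ∈ T
  · by_cases hab : x.π a = b
    · exact hx.matches_same haT hab t e
    · exact hx.matches_cross haT hbT hne hab t e
  · obtain ⟨q, b', h1, h2, h3, h4, h5⟩ := hx.exists_partner hP hQ hb hbT
    exact hx.matches_half hT haT hb h2 hbT h3 h1 h4 h5 t e
  · obtain ⟨q, a', h1, h2, h3, h4, h5⟩ := hx.exists_partner hP hQ ha haT
    have := (hx.matches_half hT hbT ha h2 haT h3 h1 h4 h5 t (-(t : ℤ) * e)).symm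
    rwa [show -(t : ℤ) * (-(t : ℤ) * e) = e by
      linear_combination sign_mul_sign_mul t e] at this
  · obtain ⟨q, a', h1, h2, h3, h4, h5⟩ := hx.exists_partner hP hQ ha haT
    obtain ⟨r, b', k1, k2, k3, k4, k5⟩ := hx.exists_partner hP hQ hb hbT
    by_cases hqr : q = r
    · subst hqr
      exact hx.matches_exch (Finset.card_pos.1 (by omega)) ha hb haT hbT hne h4 k4 t e
    · exact hx.matches_par hT ha h2 haT h3 h1 h4 h5 hb k2 hbT k3 k1 k4 k5 hqr t e

/-- At least two edges. -/
lemma many_edges (hp : p = 0 ∨ p = 1) (k : ℕ) :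
    ∀ {A T P T' P' : Finset (Fin n)} {x y : AffineWeylC n}, Desc A T P p x → Desc A T' P' p y →
    Agree A x y → T.card = 2 * k + 4 → T'.card = 2 * k + 4 → P.card = P'.card → 2 ≤ P.card →
    2 ≤ ((A \ T) \ P).card → Reach A.card x y := by
  induction k with
  | zero =>
    intro A T P T' P' x y hx hy ho hT hT' hPP hP hQ
    have hc := hx.card_add
    exact twoEdgesReach A.card hx hy ho rfl (by omega) (by omega) hPP hP (by omega)
  | succ k ih =>
    intro A T P T' P' x y hx hy ho hT hT' hPP hP hQ
    obtain ⟨a, ha⟩ := Finset.card_pos.1 (by omega : 0 < T'.card)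
    have hb := hy.edge a ha
    obtain ⟨S, S', h1, h2, h3, h4⟩ := hx.matches (by omega) hP hQ (hy.sub ha) (hy.sub hb.1)
      hb.2.symm (y.s a) (y.v (y.π a))
    obtain ⟨z, T₁, P₁, g1, g2, g3, g4, g5, g6⟩ := hx.exists_of_move hp h4 h1 h2 h3
    have g7 := ((holds_add _ _ _).1 g2).1
    have g8 := (holds_ed.1 g7).1
    have haT : a ∈ T₁ := by
      by_contra haT
      refine hb.2 (g8.symm.trans ?_)
      by_cases haP : a ∈ P₁
      · exact (g3.singP a haP).1
      · exact (g3.singQ a (hy.sub ha) haT haP).1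
    have hbT := (g3.edge a haT).1
    rw [g8] at hbT
    have c1 := hx.card_add
    have hz := g3.erase_edge haT g8
    have hy' := hy.erase_edge ha rfl
    have c2 := hz.card_add
    have hsub : ∀ {U : Finset (Fin n)}, a ∈ U → y.π a ∈ U → (U \ {a, y.π a}).card + 2 = U.card := by
      intro U h h'
      have hs : {a, y.π a} ⊆ U := by simp [Finset.insert_subset_iff, h, h']
      have := Finset.card_le_card hs
      rw [Finset.card_sdiff_of_subset hs]
      rw [Finset.card_pair hb.2.symm] at this ⊢
      omega
    have c3 := hsub haT hbT
    have c4 := hsub ha hb.1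
    have c5 := hsub (hy.sub ha) (hy.sub hb.1)
    exact (g1.trans (ih hz hy' ((g6 y ho).sdiff_edge g7 (hy.holds_ed rfl)) (by omega) (by omega)
      (by omega) (by omega) (by omega))).mono (by omega)

open Classical in
lemma card_moved (x : AffineWeylC n) :
    (Finset.univ.filter fun i => x.π i ≠ i).card + (Finset.univ.filter (Sing x 0)).card +
      (Finset.univ.filter (Sing x 1)).card = n := by
  have h1 := Finset.card_filter_add_card_filter_not (s := Finset.univ) fun i => x.π i = i
  have h2 := Finset.card_filter_add_card_filter_not
    (s := Finset.univ.filter fun i => x.π i = i) fun i => x.v i % 2 = 0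
  rw [Finset.filter_filter, Finset.filter_filter] at h2
  rw [Finset.card_fin] at h1
  have h5 : (Finset.univ.filter fun i => x.π i ≠ i).card =
      (Finset.univ.filter fun i => ¬ x.π i = i).card := rfl
  have h3 : (Finset.univ.filter (Sing x 1)) =
      Finset.univ.filter fun i => x.π i = i ∧ ¬ x.v i % 2 = 0 := by
    refine Finset.filter_congr fun i _ => and_congr_right fun _ => ?_
    omega
  have h4 : (Finset.univ.filter (Sing x 0)) =
      Finset.univ.filter fun i => x.π i = i ∧ x.v i % 2 = 0 :=
    Finset.filter_congr fun i _ => Iff.rfl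
  rw [h3, h4, h5, add_assoc, h2, add_comm]
  convert h1

lemma Full.of_numPos {a : AffineWeylC n} (ha : a * a = 1) (h : a.numPos = 0) : Full a := by
  refine full_of_mul_self ha fun i hi => ?_
  rw [numPos, Set.ncard_eq_zero] at h
  refine (Int.units_eq_one_or _).resolve_left fun h1 => ?_
  exact Set.notMem_empty i (h ▸ (⟨hi, h1⟩ : a.π i = i ∧ a.s i = 1))

open Classical in
lemma Full.numNegEven_eq (hx : Full x) : x.numNegEven = (Finset.univ.filter (Sing x 0)).card := by
  rw [numNegEven, ← Set.ncard_coe_finset]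
  congr 1
  ext i
  simp only [Set.mem_ofPred_eq, Finset.coe_filter, Finset.mem_univ, true_and, Sing, Int.even_iff]
  exact ⟨fun h => ⟨h.1, h.2.2⟩, fun h => ⟨h.1, hx.neg i h.1, h.2⟩⟩

open Classical in
lemma Full.numNegOdd_eq (hx : Full x) : x.numNegOdd = (Finset.univ.filter (Sing x 1)).card := by
  rw [numNegOdd, ← Set.ncard_coe_finset]
  congr 1
  ext i
  simp only [Set.mem_ofPred_eq, Finset.coe_filter, Finset.mem_univ, true_and, Sing, Int.odd_iff]
  exact ⟨fun h => ⟨h.1, h.2.2⟩, fun h => ⟨h.1, hx.neg i h.1, h.2⟩⟩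

lemma exists_desc_of_isConj {a : AffineWeylC n} {m ke ko : ℕ} (ha : Full a)
    (he : a.numNegEven = ke) (ho : a.numNegOdd = ko) (hs : 2 * m + ke + ko = n)
    (h : IsConj a x) : ∃ T P : Finset (Fin n), Desc Finset.univ T P 0 x ∧ T.card = 2 * m ∧
      P.card = ke ∧ ((Finset.univ \ T) \ P).card = ko := by
  classical
  have hx := ha.of_isConj h
  have hD := hx.desc (A := Finset.univ) (p := 0) (fun i _ => Finset.mem_univ _) (.inl rfl)
  have h0 := card_sing_of_isConj ha h 0
  have h1 := card_sing_of_isConj ha h 1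
  have h2 := card_moved x
  have h3 := hD.card_add
  rw [Finset.card_fin] at h3
  rw [ha.numNegEven_eq] at he
  rw [ha.numNegOdd_eq] at ho
  exact ⟨_, _, hD, by omega, by omega, by omega⟩

lemma Reach.exists_walk {X : Set (AffineWeylC n)} (hX : ∀ x y, x ∈ X → IsConj x y → y ∈ X)
    {N : ℕ} {x y : X} (h : Reach N (x : AffineWeylC n) y) :
    ∃ w : (commGraph X).Walk x y, w.length ≤ N := by
  induction N generalizing x with
  | zero =>
    obtain rfl : x = y := Subtype.ext h
    exact ⟨.nil, le_rfl⟩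
  | succ N ih =>
    obtain ⟨z, ⟨h1, h1'⟩, h2⟩ := h
    have hz : z ∈ X := hX _ _ x.2 h1'
    obtain ⟨w, hw⟩ := ih (x := ⟨z, hz⟩) h2
    by_cases e : (x : AffineWeylC n) = z
    · subst e
      exact ⟨w, hw.trans (by omega)⟩
    · have hadj : (commGraph X).Adj x ⟨z, hz⟩ := ⟨e, h1⟩
      exact ⟨.cons hadj w, by rw [SimpleGraph.Walk.length_cons]; omega⟩

end TwoEdges

end AffineWeylC

open AffineWeylC

/-- Suppose `n ≥ 7`, `m ≥ 1`, `l = 0` and `k_e, k_o ≥ 2`.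
Then the graph is connected with diameter at most `n+2`; if moreover `m ≥ 2`
the diameter is at most `n`. -/
theorem stmt_15 (n m ke ko : ℕ) (hn : 7 ≤ n) (hm : 1 ≤ m)
    (hke : 2 ≤ ke) (hko : 2 ≤ ko) (hsum : 2 * m + ke + ko = n)
    (a : AffineWeylC n) (ha : a.Involution) (htype : a.HasType m ke ko 0)
    (X : Set (AffineWeylC n)) (hX : X = AffineWeylC.conjClass a) :
    (commGraph X).Connected ∧ (commGraph X).ediam ≤ (n : ℕ∞) + 2 ∧
    (2 ≤ m → (commGraph X).ediam ≤ (n : ℕ∞)) := by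
  subst hX
  obtain ⟨-, he, ho, hl⟩ := htype
  have hf := Full.of_numPos ha.2 hl
  have hcl : ∀ x y, x ∈ conjClass a → IsConj x y → y ∈ conjClass a :=
    fun x y h h' => IsConj.trans h h'
  have key : ∀ x y : conjClass a, Reach (if 2 ≤ m then n else n + 2) (x : AffineWeylC n) y := by
    intro x y
    obtain ⟨T, P, hx, h1, h2, h3⟩ := exists_desc_of_isConj hf he ho hsum x.2
    obtain ⟨T', P', hy, h1', h2', h3'⟩ := exists_desc_of_isConj hf he ho hsum y.2
    have hag : Agree Finset.univ (x : AffineWeylC n) y := fun i hi => absurd (Finset.mem_univ i) hi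
    have hc := Finset.card_fin n
    split_ifs with hm2
    · have := many_edges (.inl rfl) (m - 2) hx hy hag (by omega) (by omega) (by omega) (by omega)
        (by omega)
      rwa [hc] at this
    · have := one_any hx hy hag (by omega) (by omega) (by omega) (by omega) (by omega) (by omega)
      rwa [hc] at this
  have walk := fun x y => (key x y).exists_walk hcl
  refine ⟨{ preconnected := fun x y => ?_, nonempty := ⟨⟨a, IsConj.refl a⟩⟩ }, ?_, fun hm2 => ?_⟩
  · exact (walk x y).choose.reachable
  · refine SimpleGraph.ediam_le_of_edist_le fun x y => ?_
    obtain ⟨w, hw⟩ := walk x y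
    refine w.edist_le.trans ?_
    have : w.length ≤ n + 2 := by split_ifs at hw <;> omega
    exact_mod_cast this
  · refine SimpleGraph.ediam_le_of_edist_le fun x y => ?_
    obtain ⟨w, hw⟩ := walk x y
    rw [if_pos hm2] at hw
    exact w.edist_le.trans (by exact_mod_cast hw)
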